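/- arXiv:1802.03092 — 4 statements merged into one kernel-verified Lean document; each statement's English description precedes it below -/
import Mathlib

section
/- Let d ≥ 1 and let G be a finite simple graph on at most 2d − 1 vertices. Then G or its complement is realizable on the sphere 𝕊^{d−1} of radius 1/√2 in ℝ^d. -/
/-- A graph `G` is realizable on the sphere `𝕊^{d-1}` of radius `1/√2` in `ℝ^d`. -/
def SphereRealizable {V : Type*} (G : SimpleGraph V) (d : ℕ) : Prop :=
  ∃ f : V → EuclideanSpace ℝ (Fin d), Function.Injective f ∧
    (∀ v : V, ‖f v‖ = 1 / Real.sqrt 2) ∧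
    ∀ u v : V, G.Adj u v → dist (f u) (f v) = 1

open scoped Classical in
/-- In a graph whose restriction to `C` has minimum degree at least `δ`, where `2 * δ ≤ #C`, there
is a matching of size `δ` inside `C`, given by a set `T` of vertices and an injection `g` of `T`
into `C \ T`. -/
theorem exists_matching_of_le_degree {V : Type*} [Fintype V] (K : SimpleGraph V) (C : Finset V)
    (δ : ℕ) (hdeg : ∀ x ∈ C, δ ≤ (C.filter (K.Adj x)).card) (hC : 2 * δ ≤ C.card) :
    ∃ (T : Finset V) (g : V → V), T.card = δ ∧ T ⊆ C ∧ Set.InjOn g T ∧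
      ∀ t ∈ T, g t ∈ C ∧ g t ∉ T ∧ K.Adj t (g t) := by
  suffices h : ∀ m ≤ δ, ∃ (T : Finset V) (g : V → V), T.card = m ∧ T ⊆ C ∧ Set.InjOn g T ∧
      ∀ t ∈ T, g t ∈ C ∧ g t ∉ T ∧ K.Adj t (g t) from h δ le_rfl
  intro m
  induction m with
  | zero => exact fun _ => ⟨∅, id, by simp⟩
  | succ m ih =>
    intro hm
    obtain ⟨T, g, hT, hTC, hinj, hg⟩ := ih (by omega)
    have hU : 1 < (C \ (T ∪ T.image g)).card := by
      have h₁ := Finset.le_card_sdiff (T ∪ T.image g) C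
      have h₂ := Finset.card_union_le T (T.image g)
      have h₃ := Finset.card_image_le (s := T) (f := g)
      omega
    obtain ⟨u, hu, v, hv, huv⟩ := Finset.one_lt_card.1 hU
    simp only [Finset.mem_sdiff, Finset.mem_union, Finset.mem_image, not_or, not_exists,
      not_and] at hu hv
    obtain ⟨huC, huT, hug⟩ := hu
    obtain ⟨hvC, hvT, hvg⟩ := hv
    have extend : ∀ a b, a ∈ C → b ∈ C → a ∉ T → b ∉ T → (∀ t ∈ T, g t ≠ a) →
        (∀ t ∈ T, g t ≠ b) → K.Adj a b → ∃ (T : Finset V) (g : V → V), T.card = m + 1 ∧ T ⊆ C ∧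
          Set.InjOn g T ∧ ∀ t ∈ T, g t ∈ C ∧ g t ∉ T ∧ K.Adj t (g t) := by
      intro a b haC hbC haT hbT hag hbg hab
      refine ⟨insert a T, Function.update g a b, by simp [haT, hT], ?_, ?_, ?_⟩
      · grind
      · intro x hx y hy hxy
        have hxy' : x ∈ T → y ∈ T → g x = g y → x = y := fun hx hy h => hinj hx hy h
        simp only [Function.update_apply, Finset.coe_insert, Set.mem_insert_iff,
          Finset.mem_coe] at hx hy hxy
        clear ih hdeg hU
        grind
      · have := hab.ne
        intro t ht
        have hgt := hg t
        have hat := hag t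
        rw [Finset.mem_insert] at ht
        simp only [Function.update_apply, Finset.mem_insert]
        clear ih hdeg hU hg
        grind
    have augment : ∀ a b, a ∈ C → b ∈ C → a ∉ T → b ∉ T → (∀ t ∈ T, g t ≠ a) →
        (∀ t ∈ T, g t ≠ b) → a ≠ b → (∃ t ∈ T, K.Adj a t ∧ K.Adj b (g t)) →
        ∃ (T : Finset V) (g : V → V), T.card = m + 1 ∧ T ⊆ C ∧
          Set.InjOn g T ∧ ∀ t ∈ T, g t ∈ C ∧ g t ∉ T ∧ K.Adj t (g t) := by
      rintro a b haC hbC haT hbT hag hbg hab ⟨t, ht, hat, hbt⟩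
      refine ⟨insert b T, Function.update (Function.update g t a) b (g t), by simp [hbT, hT],
        ?_, ?_, ?_⟩
      · grind
      · intro x hx y hy hxy
        have hxy' : x ∈ T → y ∈ T → g x = g y → x = y := fun hx hy h => hinj hx hy h
        have hxt : x ∈ T → g x = g t → x = t := fun hx h => hinj hx ht h
        have hyt : y ∈ T → g y = g t → y = t := fun hy h => hinj hy ht h
        simp only [Function.update_apply, Finset.coe_insert, Set.mem_insert_iff,
          Finset.mem_coe] at hx hy hxy
        clear ih hdeg hU
        grind
      · have hta := hat.symm
        have hgt := hg t ht
        have hbt' := hbg t ht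
        intro x hx
        have hgx := hg x
        have hbx := hbg x
        rw [Finset.mem_insert] at hx
        simp only [Function.update_apply, Finset.mem_insert]
        clear ih hdeg hU hg
        grind
    by_contra hno
    have bound : ∀ a, a ∈ C → a ∉ T → (∀ t ∈ T, g t ≠ a) →
        δ ≤ (T.filter fun t => K.Adj a t).card + (T.filter fun t => K.Adj a (g t)).card := by
      intro a haC haT hag
      refine (hdeg a haC).trans ?_
      have hsub : C.filter (K.Adj a) ⊆
          (T.filter fun t => K.Adj a t) ∪ (T.filter fun t => K.Adj a (g t)).image g := by
        intro y hy
        rw [Finset.mem_filter] at hy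
        by_contra hy'
        refine hno (extend a y haC hy.1 haT ?_ hag ?_ hy.2) <;> grind
      refine (Finset.card_le_card hsub).trans ((Finset.card_union_le _ _).trans
        (Nat.add_le_add_left Finset.card_image_le _))
    have disj : ∀ a b : V, (¬ ∃ t ∈ T, K.Adj a t ∧ K.Adj b (g t)) →
        (T.filter fun t => K.Adj a t).card + (T.filter fun t => K.Adj b (g t)).card ≤ m := by
      intro a b h
      have hdisj : Disjoint (T.filter fun t => K.Adj a t) (T.filter fun t => K.Adj b (g t)) := by
        rw [Finset.disjoint_left]
        grind
      rw [← hT, ← Finset.card_union_of_disjoint hdisj]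
      exact Finset.card_le_card
        (Finset.union_subset (Finset.filter_subset _ _) (Finset.filter_subset _ _))
    have h₁ := bound u huC huT hug
    have h₂ := bound v hvC hvT hvg
    have h₃ := disj u v fun h => hno (augment u v huC hvC huT hvT hug hvg huv h)
    have h₄ := disj v u fun h => hno (augment v u hvC huC hvT huT hvg hug huv.symm h)
    omega

/-- The subgraph of `G` induced on `S` has an injective representation by vectors of norm `1/√2`
in `ℝ^d` in which adjacent vertices are orthogonal. -/
def OrthogonalRealizableOn {V : Type*} (G : SimpleGraph V) (d : ℕ) (S : Finset V) : Prop :=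
  ∃ f : V → EuclideanSpace ℝ (Fin d), Set.InjOn f S ∧
    (∀ v ∈ S, ‖f v‖ = 1 / Real.sqrt 2) ∧
    ∀ u ∈ S, ∀ v ∈ S, G.Adj u v → inner ℝ (f u) (f v) = 0

theorem OrthogonalRealizableOn.sphereRealizable {V : Type*} [Fintype V] {G : SimpleGraph V} {d : ℕ}
    (h : OrthogonalRealizableOn G d Finset.univ) : SphereRealizable G d := by
  obtain ⟨f, hinj, hnorm, horth⟩ := h
  refine ⟨f, fun x y hxy => hinj (by simp) (by simp) hxy, fun v => hnorm v (by simp),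
    fun u v huv => ?_⟩
  have h₁ := norm_sub_sq_real (f u) (f v)
  rw [horth u (by simp) v (by simp) huv, hnorm u (by simp), hnorm v (by simp), div_pow,
    Real.sq_sqrt (by norm_num)] at h₁
  rw [dist_eq_norm]
  nlinarith [norm_nonneg (f u - f v)]

/-- A vector of prescribed positive norm in a subspace of dimension at least two can be chosen
outside any given finite set. -/
theorem Submodule.exists_norm_eq_notMem_of_two_le_finrank {E : Type*} [NormedAddCommGroup E]
    [NormedSpace ℝ E] (W : Submodule ℝ E) (hW : 2 ≤ Module.finrank ℝ W) {r : ℝ} (hr : 0 < r)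
    {F : Set E} (hF : F.Finite) : ∃ x ∈ W, ‖x‖ = r ∧ x ∉ F := by
  have hrank : 1 < Module.rank ℝ W := Module.lt_rank_of_lt_finrank (by exact_mod_cast hW)
  have : Nontrivial W := Module.nontrivial_of_finrank_pos (R := ℝ) (by omega)
  have hinf : (Metric.sphere (0 : W) r).Infinite := by
    refine (isPreconnected_sphere hrank 0 r).infinite_of_nontrivial ?_
    obtain ⟨x, hx⟩ := (NormedSpace.sphere_nonempty (x := (0 : W)) (r := r)).2 hr.le
    have hx' : ‖x‖ = r := by simpa using hx
    refine ⟨x, hx, -x, by simpa using hx, fun h => ?_⟩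
    have h₂ : (2 : ℝ) • x = 0 := by rw [two_smul, add_eq_zero_iff_eq_neg, ← h]
    rw [(smul_eq_zero_iff_right two_ne_zero).1 h₂, norm_zero] at hx'
    exact hr.ne hx'
  obtain ⟨y, ⟨x, hx, rfl⟩, hy⟩ :=
    ((hinf.image Subtype.val_injective.injOn).sdiff hF).nonempty
  exact ⟨x, x.2, by simpa using hx, hy⟩

open scoped Classical in
theorem OrthogonalRealizableOn.insert {V : Type*} {G : SimpleGraph V} {d : ℕ} {S : Finset V}
    (h : OrthogonalRealizableOn G d S) {v : V} (hv : v ∉ S)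
    (hdeg : (S.filter (G.Adj v)).card + 2 ≤ d) : OrthogonalRealizableOn G d (insert v S) := by
  obtain ⟨f, hinj, hnorm, horth⟩ := h
  set N := (S.filter (G.Adj v)).image f with hN
  have hspan : Module.finrank ℝ (Submodule.span ℝ (N : Set (EuclideanSpace ℝ (Fin d)))) ≤
      (S.filter (G.Adj v)).card :=
    (finrank_span_finset_le_card N).trans Finset.card_image_le
  have hsum := Submodule.finrank_add_finrank_orthogonal
    (Submodule.span ℝ (N : Set (EuclideanSpace ℝ (Fin d))))
  rw [finrank_euclideanSpace_fin] at hsum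
  obtain ⟨x, hxW, hxr, hxF⟩ := Submodule.exists_norm_eq_notMem_of_two_le_finrank
    (Submodule.span ℝ (N : Set (EuclideanSpace ℝ (Fin d))))ᗮ (by omega)
    (r := 1 / Real.sqrt 2) (by positivity) (S.image f).finite_toSet
  have hx : ∀ u ∈ S, G.Adj v u → inner ℝ (f u) x = 0 := fun u hu huv =>
    (Submodule.mem_orthogonal _ _).1 hxW _ (Submodule.subset_span (by
      simp only [hN, Finset.coe_image]
      exact ⟨u, by simp [hu, huv], rfl⟩))
  have hne : ∀ u ∈ S, u ≠ v := fun u hu h => hv (h ▸ hu)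
  have hxF' : ∀ u ∈ S, f u ≠ x := fun u hu h => hxF (by simpa using ⟨u, hu, h⟩)
  refine ⟨Function.update f v x, ?_, ?_, ?_⟩
  · intro a ha b hb hab
    have hab' : a ∈ S → b ∈ S → f a = f b → a = b := fun ha hb h => hinj ha hb h
    simp only [Function.update_apply, Finset.coe_insert, Set.mem_insert_iff,
      Finset.mem_coe] at ha hb hab
    grind
  · intro a ha
    simp only [Function.update_apply]
    grind
  · intro a ha b hb hab
    rw [Finset.mem_insert] at ha hb
    rcases ha with rfl | ha <;> rcases hb with rfl | hb
    · exact absurd hab (G.irrefl)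
    · rw [Function.update_self, Function.update_of_ne (hne b hb), real_inner_comm]
      exact hx b hb hab
    · rw [Function.update_self, Function.update_of_ne (hne a ha)]
      exact hx a ha hab.symm
    · rw [Function.update_of_ne (hne a ha), Function.update_of_ne (hne b hb)]
      exact horth a ha b hb hab

open scoped Classical in
/-- A graph without orthogonal representation in `ℝ^d` contains an induced subgraph of minimum
degree at least `d - 1` without such a representation. -/
theorem exists_core_of_not_orthogonalRealizableOn {V : Type*} {G : SimpleGraph V} {d : ℕ}
    {S : Finset V} (h : ¬ OrthogonalRealizableOn G d S) :
    ∃ A : Finset V, A.Nonempty ∧ ¬ OrthogonalRealizableOn G d A ∧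
      ∀ v ∈ A, d ≤ (A.filter (G.Adj v)).card + 1 := by
  induction S using Finset.strongInduction with
  | H S ih =>
    by_cases hS : ∀ v ∈ S, d ≤ (S.filter (G.Adj v)).card + 1
    · refine ⟨S, ?_, h, hS⟩
      rw [Finset.nonempty_iff_ne_empty]
      rintro rfl
      exact h ⟨fun _ => 0, by simp⟩
    · push Not at hS
      obtain ⟨v, hv, hlt⟩ := hS
      refine ih (S.erase v) (Finset.erase_ssubset hv) fun hr => h ?_
      rw [← Finset.insert_erase hv]
      refine hr.insert (Finset.notMem_erase v S) ?_
      have : ((S.erase v).filter (G.Adj v)).card ≤ (S.filter (G.Adj v)).card :=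
        Finset.card_le_card (Finset.filter_subset_filter _ (Finset.erase_subset v S))
      omega

open scoped Classical in
/-- Pairing non-adjacent vertices as antipodal points on coordinate axes. -/
theorem orthogonalRealizableOn_of_matching {V : Type*} {G : SimpleGraph V} {d : ℕ}
    {A T : Finset V} {g : V → V} (hTA : T ⊆ A) (hinj : Set.InjOn g T)
    (hg : ∀ t ∈ T, g t ∈ A ∧ g t ∉ T ∧ Gᶜ.Adj t (g t)) (hcard : A.card ≤ d + T.card) :
    OrthogonalRealizableOn G d A := by
  have hsub : T.image g ⊆ A := by grind
  have hR : (A \ T.image g).card ≤ d := by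
    rw [Finset.card_sdiff_of_subset hsub, Finset.card_image_of_injOn hinj]
    omega
  rcases A.eq_empty_or_nonempty with rfl | hA
  · exact ⟨fun _ => 0, by simp⟩
  have hd : 0 < d := by
    by_contra h0
    have hTA' : T = A := Finset.eq_of_subset_of_card_le hTA (by omega)
    obtain ⟨t, ht⟩ := hA
    have ht' := hg t (hTA' ▸ ht)
    exact ht'.2.1 (hTA' ▸ ht'.1)
  have : Nonempty (Fin d) := ⟨⟨0, hd⟩⟩
  obtain ⟨e, -, he⟩ := Set.Finite.exists_injOn_of_encard_le
    (s := ((A \ T.image g : Finset V) : Set V)) (t := (Set.univ : Set (Fin d)))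
    (Finset.finite_toSet _) (by
      rw [Set.encard_coe_eq_coe_finsetCard, Set.encard_univ, ENat.card_eq_coe_fintype_card,
        Fintype.card_fin]
      exact_mod_cast hR)
  have hrep : ∀ x, ∃ y, x ∈ A → y ∈ A \ T.image g ∧ (y = x ∨ y ∈ T ∧ g y = x) := by
    intro x
    by_cases hx : x ∈ T.image g
    · obtain ⟨t, ht, rfl⟩ := Finset.mem_image.1 hx
      exact ⟨t, by grind⟩
    · exact ⟨x, by grind⟩
  choose r hr using hrep
  have hr' : ∀ x ∈ A, ∀ y ∈ A, e (r x) = e (r y) → r x = r y := fun x hx y hy h =>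
    he (Finset.mem_coe.2 (hr x hx).1) (Finset.mem_coe.2 (hr y hy).1) h
  have hpos : 0 < 1 / Real.sqrt 2 := by positivity
  refine ⟨fun x => EuclideanSpace.single (e (r x))
    (if x ∈ T.image g then -(1 / Real.sqrt 2) else 1 / Real.sqrt 2), ?_, ?_, ?_⟩
  · intro x hx y hy hxy
    have h := congrArg (fun w : EuclideanSpace ℝ (Fin d) => w (e (r x))) hxy
    simp only [PiLp.single_apply, if_true] at h
    have hxy' : e (r x) = e (r y) := by
      by_contra hne
      rw [if_neg hne] at h
      split_ifs at h <;> linarith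
    rw [if_pos hxy'] at h
    have hsign : x ∈ T.image g ↔ y ∈ T.image g := by
      split_ifs at h with h₁ h₂ h₂
      · simp only [h₁, h₂]
      · linarith
      · linarith
      · simp only [h₁, h₂]
    have h₁ := hr' x hx y hy hxy'
    have h₂ := hr x hx
    have h₃ := hr y hy
    grind
  · intro x _
    rw [PiLp.norm_single, Real.norm_eq_abs]
    split_ifs <;> simp
  · intro x hx y hy hxy
    have hne : e (r x) ≠ e (r y) := by
      intro h
      have h₁ := hr' x hx y hy h
      have h₂ := hr x hx
      have h₃ := hr y hy
      have h₄ := hg (r x)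
      have h₅ := hxy.ne
      have h₆ := hxy.symm
      simp only [SimpleGraph.compl_adj] at h₄
      grind
    simp [EuclideanSpace.inner_single_left, hne]

open scoped Classical in
theorem orthogonalRealizableOn_of_card_sdiff_le {V : Type*} [Fintype V] {G : SimpleGraph V}
    {d : ℕ} (hcard : Fintype.card V ≤ 2 * d - 1) {A B : Finset V}
    (hA : ∀ v ∈ A, d ≤ (A.filter (G.Adj v)).card + 1)
    (hB : ∀ v ∈ B, d ≤ (B.filter (Gᶜ.Adj v)).card + 1) (hAB : (A ∩ B).Nonempty)
    (hle : (A \ B).card ≤ (B \ A).card) : OrthogonalRealizableOn G d A := by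
  have hunion := (Finset.card_le_univ (A ∪ B)).trans hcard
  have h₁ := Finset.card_inter_add_card_sdiff A B
  have h₂ := Finset.card_inter_add_card_sdiff B A
  have h₃ := Finset.card_union_add_card_inter A B
  rw [Finset.inter_comm B A] at h₂
  have hC : 2 * (d - 1 - (B \ A).card) ≤ (A ∩ B).card := by
    obtain ⟨x, hx⟩ := hAB
    rw [Finset.mem_inter] at hx
    have hdisj : Disjoint (A.filter (G.Adj x)) (B.filter (Gᶜ.Adj x)) := by
      rw [Finset.disjoint_left]
      simp only [Finset.mem_filter, SimpleGraph.compl_adj]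
      tauto
    have hsub : A.filter (G.Adj x) ∪ B.filter (Gᶜ.Adj x) ⊆ (A ∪ B).erase x := by
      intro y hy
      simp only [Finset.mem_union, Finset.mem_filter, Finset.mem_erase] at hy ⊢
      rcases hy with hy | hy
      · exact ⟨hy.2.ne', Or.inl hy.1⟩
      · exact ⟨hy.2.ne', Or.inr hy.1⟩
    have h₄ := Finset.card_le_card hsub
    rw [Finset.card_union_of_disjoint hdisj,
      Finset.card_erase_of_mem (Finset.mem_union_left _ hx.1)] at h₄
    have h₅ := hA x hx.1
    have h₆ := hB x hx.2
    omega
  have hdeg : ∀ x ∈ A ∩ B, d - 1 - (B \ A).card ≤ ((A ∩ B).filter (Gᶜ.Adj x)).card := by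
    intro x hx
    have hsub : B.filter (Gᶜ.Adj x) ⊆ (A ∩ B).filter (Gᶜ.Adj x) ∪ (B \ A) := by
      intro y hy
      simp only [Finset.mem_union, Finset.mem_filter, Finset.mem_inter, Finset.mem_sdiff] at hy ⊢
      tauto
    have h₄ := (Finset.card_le_card hsub).trans (Finset.card_union_le _ _)
    have h₅ := hB x (Finset.mem_inter.1 hx).2
    omega
  obtain ⟨T, g, hT, hTC, hinj, hg⟩ := exists_matching_of_le_degree Gᶜ (A ∩ B)
    (d - 1 - (B \ A).card) (by convert hdeg) hC
  refine orthogonalRealizableOn_of_matching (hTC.trans Finset.inter_subset_left) hinj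
    (fun t ht => ⟨(Finset.mem_inter.1 (hg t ht).1).1, (hg t ht).2⟩) ?_
  omega

open scoped Classical in
theorem le_card_of_le_degree {V : Type*} {G : SimpleGraph V} {d : ℕ} {A : Finset V}
    (hne : A.Nonempty) (hA : ∀ v ∈ A, d ≤ (A.filter (G.Adj v)).card + 1) : d ≤ A.card := by
  obtain ⟨v, hv⟩ := hne
  have hlt : (A.filter (G.Adj v)).card < A.card :=
    Finset.card_lt_card (Finset.filter_ssubset.2 ⟨v, hv, G.irrefl⟩)
  have := hA v hv
  omega

theorem stmt_4 {V : Type*} [Fintype V] (d : ℕ) (hd : 1 ≤ d)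
    (G : SimpleGraph V) (hcard : Fintype.card V ≤ 2 * d - 1) :
    SphereRealizable G d ∨ SphereRealizable Gᶜ d := by
  classical
  by_contra! h
  obtain ⟨A, hAne, hAnot, hA⟩ := exists_core_of_not_orthogonalRealizableOn
    (mt OrthogonalRealizableOn.sphereRealizable h.1)
  obtain ⟨B, hBne, hBnot, hB⟩ := exists_core_of_not_orthogonalRealizableOn
    (mt OrthogonalRealizableOn.sphereRealizable h.2)
  have hAB : (A ∩ B).Nonempty := by
    rw [← Finset.card_pos]
    have h₁ := le_card_of_le_degree hAne hA
    have h₂ := le_card_of_le_degree hBne hB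
    have h₃ := Finset.card_union_add_card_inter A B
    have h₄ := Finset.card_le_univ (A ∪ B)
    omega
  rcases le_total (A \ B).card (B \ A).card with hle | hle
  · exact hAnot (orthogonalRealizableOn_of_card_sdiff_le hcard (by convert hA) (by convert hB)
      (by convert hAB) (by convert hle))
  · refine hBnot (orthogonalRealizableOn_of_card_sdiff_le (B := A) hcard (by convert hB) ?_
      (by rw [Finset.inter_comm]; convert hAB) (by convert hle))
    intro v hv
    convert hA v hv using 4
    rw [compl_compl]
end

section
/- Let d ≥ 1 and let G be a finite simple graph on at most 2d vertices. Then G or its complement is realizable in ℝ^d. -/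
/-- A graph `G` is realizable in `ℝ^d` if there is an injective map from its vertices to
`EuclideanSpace ℝ (Fin d)` sending adjacent vertices to points at distance `1`. -/
def GraphRealizable {V : Type*} (G : SimpleGraph V) (d : ℕ) : Prop :=
  ∃ f : V → EuclideanSpace ℝ (Fin d), Function.Injective f ∧
    ∀ u v : V, G.Adj u v → dist (f u) (f v) = 1

open Finset

/-- `OrthRep G S d` says that the vertices in `S` can be represented by distinct unit vectors of
`ℝ^d` in such a way that adjacent vertices are represented by orthogonal vectors. -/
def OrthRep {V : Type*} (G : SimpleGraph V) (S : Finset V) (d : ℕ) : Prop :=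
  ∃ f : V → EuclideanSpace ℝ (Fin d), (∀ v ∈ S, ‖f v‖ = 1) ∧ Set.InjOn f S ∧
    ∀ u ∈ S, ∀ v ∈ S, G.Adj u v → inner ℝ (f u) (f v) = 0

theorem Submodule.infinite_unit_vectors {E : Type*} [NormedAddCommGroup E] [InnerProductSpace ℝ E]
    [FiniteDimensional ℝ E] (W : Submodule ℝ E) (hW : 2 ≤ Module.finrank ℝ W) :
    {x : E | x ∈ W ∧ ‖x‖ = 1}.Infinite := by
  have h1 : 1 < Module.rank ℝ W := by
    rw [← Module.finrank_eq_rank]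
    exact_mod_cast hW
  have : Nontrivial W := Module.nontrivial_of_finrank_pos (R := ℝ) (by omega)
  obtain ⟨a, ha⟩ := exists_norm_eq W (zero_le_one (α := ℝ))
  have h2 : (Metric.sphere (0 : W) 1).Infinite := by
    apply (isPreconnected_sphere h1 0 1).infinite_of_nontrivial
    refine ⟨a, by simpa using ha, -a, by simpa using ha, fun h => ?_⟩
    have : IsAddTorsionFree W := .of_isTorsionFree ℝ W
    rw [self_eq_neg.mp h] at ha
    simp at ha
  refine (h2.image Subtype.val_injective.injOn).mono ?_
  rintro _ ⟨x, hx, rfl⟩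
  exact ⟨x.2, by simpa using hx⟩

namespace OrthRep

variable {V : Type*} {G : SimpleGraph V} {S T : Finset V} {d e : ℕ}

theorem mono (h : OrthRep G S d) (hTS : T ⊆ S) : OrthRep G T d := by
  obtain ⟨f, h1, h2, h3⟩ := h
  exact ⟨f, fun v hv => h1 v (hTS hv), h2.mono (by exact_mod_cast hTS),
    fun u hu v hv => h3 u (hTS hu) v (hTS hv)⟩

theorem empty (G : SimpleGraph V) (d : ℕ) : OrthRep G ∅ d :=
  ⟨fun _ => 0, by simp, by simp, by simp⟩

variable [DecidableEq V]

/-- A non-adjacent pair is represented by antipodal vectors in a new dimension. -/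
theorem insert_pair (h : OrthRep G S d) {u v : V} (huv : ¬ G.Adj u v) :
    OrthRep G (insert u (insert v S)) (d + 1) := by
  obtain ⟨f, h1, h2, h3⟩ := h
  let pole : EuclideanSpace ℝ (Fin (d + 1)) := EuclideanSpace.single 0 1
  let lift : EuclideanSpace ℝ (Fin d) → EuclideanSpace ℝ (Fin (d + 1)) :=
    fun x => WithLp.toLp 2 (Fin.cons 0 x.ofLp)
  have hll (x y) : inner ℝ (lift x) (lift y) = inner ℝ x y := by
    simp [lift, PiLp.inner_apply, Fin.sum_univ_succ]
  have hpl (x) : inner ℝ pole (lift x) = 0 := by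
    simp [lift, pole, PiLp.inner_apply]
  have hlp (x) : inner ℝ (lift x) pole = 0 := by rw [real_inner_comm, hpl]
  have hpp : inner ℝ pole pole = 1 := by simp [pole]
  have hp : ‖pole‖ = 1 := by simp [pole]
  have hl (x) : ‖lift x‖ = ‖x‖ := by
    rw [norm_eq_sqrt_real_inner, norm_eq_sqrt_real_inner, hll]
  have hpl_ne (x) : pole ≠ lift x := fun hx => by
    have := hpl x
    rw [← hx, hpp] at this
    exact one_ne_zero this
  have hnl_ne (x) : -pole ≠ lift x := fun hx => by
    have := hpl x
    rw [← hx, inner_neg_right, hpp] at this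
    norm_num at this
  have hinj {x y} (hxy : lift x = lift y) : x = y := by
    ext i
    have := congrArg (fun z => z.ofLp i.succ) hxy
    simpa [lift] using this
  have hpn : pole ≠ -pole := fun hx => by
    have : IsAddTorsionFree (EuclideanSpace ℝ (Fin (d + 1))) := .of_isTorsionFree ℝ _
    rw [self_eq_neg.mp hx] at hp
    simp at hp
  let F : V → EuclideanSpace ℝ (Fin (d + 1)) :=
    fun w => if w = u then pole else if w = v then -pole else lift (f w)
  have key (w) (hw : w ∈ insert u (insert v S)) : (w = u ∧ F w = pole) ∨
      (w = v ∧ w ≠ u ∧ F w = -pole) ∨ (w ∈ S ∧ F w = lift (f w)) := by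
    by_cases hwu : w = u
    · simp [F, hwu]
    · by_cases hwv : w = v
      · simp [F, hwv, hwv ▸ hwu]
      · simp only [mem_insert, hwu, hwv, false_or] at hw
        simp [F, hwu, hwv, hw]
  refine ⟨F, fun w hw => ?_, fun w hw w' hw' hww => ?_, fun w hw w' hw' hww => ?_⟩
  · rcases key w hw with ⟨-, h⟩ | ⟨-, -, h⟩ | ⟨hwS, h⟩
    · rw [h, hp]
    · rw [h, norm_neg, hp]
    · rw [h, hl, h1 w hwS]
  · rcases key w hw with ⟨rfl, h⟩ | ⟨rfl, -, h⟩ | ⟨hwS, h⟩ <;>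
    rcases key w' hw' with ⟨h0, h'⟩ | ⟨h0, -, h'⟩ | ⟨hwS', h'⟩ <;> rw [h, h'] at hww
    · exact h0.symm
    · exact absurd hww hpn
    · exact absurd hww (hpl_ne _)
    · exact absurd hww.symm hpn
    · exact h0.symm
    · exact absurd hww (hnl_ne _)
    · exact absurd hww.symm (hpl_ne _)
    · exact absurd hww.symm (hnl_ne _)
    · exact h2 hwS hwS' (hinj hww)
  · rcases key w hw with ⟨rfl, h⟩ | ⟨rfl, -, h⟩ | ⟨hwS, h⟩ <;>
    rcases key w' hw' with ⟨h0, h'⟩ | ⟨h0, -, h'⟩ | ⟨hwS', h'⟩ <;> rw [h, h']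
    · exact absurd (h0 ▸ hww) G.irrefl
    · exact absurd (h0 ▸ hww) huv
    · exact hpl _
    · exact absurd (h0 ▸ hww.symm) huv
    · exact absurd (h0 ▸ hww) G.irrefl
    · rw [inner_neg_left, hpl, neg_zero]
    · exact hlp _
    · rw [inner_neg_right, hlp, neg_zero]
    · rw [hll, h3 w hwS w' hwS' hww]

theorem insert_single (h : OrthRep G S d) (v : V) : OrthRep G (insert v S) (d + 1) := by
  simpa using h.insert_pair (G.irrefl (v := v))

theorem mono_dim (h : OrthRep G S d) (hde : d ≤ e) : OrthRep G S e := by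
  induction e, hde using Nat.le_induction with
  | base => exact h
  | succ e _ ih =>
    rcases S.eq_empty_or_nonempty with rfl | ⟨v, hv⟩
    · exact empty G _
    · simpa [hv] using ih.insert_single v

theorem union_singles (h : OrthRep G S d) (T : Finset V) : OrthRep G (S ∪ T) (d + #T) := by
  induction T using Finset.induction_on with
  | empty => simpa using h
  | insert a T ha ih =>
    rw [union_insert, card_insert_of_notMem ha, ← add_assoc]
    exact ih.insert_single a

theorem extend (h : OrthRep G T e) (hTS : T ⊆ S) (hcard : #S + e ≤ d + #T) : OrthRep G S d := by
  have h1 := h.union_singles (S \ T)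
  rw [union_sdiff_of_subset hTS] at h1
  refine h1.mono_dim ?_
  rw [card_sdiff_of_subset hTS]
  have := card_le_card hTS
  omega

/-- A vertex with few neighbours is represented by a generic vector orthogonal to them. -/
theorem insert_generic [DecidableRel G.Adj] (h : OrthRep G S d) {v : V}
    (hv : #{w ∈ S | G.Adj v w} + 2 ≤ d) : OrthRep G (insert v S) d := by
  by_cases hvS : v ∈ S
  · rwa [insert_eq_of_mem hvS]
  obtain ⟨f, h1, h2, h3⟩ := h
  let N : Finset (EuclideanSpace ℝ (Fin d)) := {w ∈ S | G.Adj v w}.image f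
  let W := Submodule.span ℝ (N : Set (EuclideanSpace ℝ (Fin d)))
  have hW : 2 ≤ Module.finrank ℝ Wᗮ := by
    have e1 := W.finrank_add_finrank_orthogonal
    have e2 : Module.finrank ℝ W ≤ #N := finrank_span_finset_le_card N
    have e3 : #N ≤ #{w ∈ S | G.Adj v w} := card_image_le
    rw [finrank_euclideanSpace_fin] at e1
    omega
  obtain ⟨x, ⟨hxW, hx1⟩, hxS⟩ := (Wᗮ.infinite_unit_vectors hW).exists_notMem_finset (S.image f)
  have hne {w} (hw : w ∈ S) : w ≠ v := fun h => hvS (h ▸ hw)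
  have horth {w} (hw : w ∈ S) (hvw : G.Adj v w) : inner ℝ (f w) x = 0 :=
    (Submodule.mem_orthogonal _ _).mp hxW _
      (Submodule.subset_span (mem_image_of_mem f (by simp [hw, hvw])))
  refine ⟨Function.update f v x, fun w hw => ?_, fun w hw w' hw' hww => ?_,
    fun w hw w' hw' hww => ?_⟩
  · rcases mem_insert.mp hw with rfl | hw
    · simpa using hx1
    · simpa [hne hw] using h1 w hw
  · rcases mem_insert.mp hw with h0 | hwS <;> rcases mem_insert.mp hw' with h0' | hwS'
    · rw [h0, h0']
    · rw [h0, Function.update_self, Function.update_of_ne (hne hwS')] at hww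
      exact absurd (hww ▸ mem_image_of_mem f hwS') hxS
    · rw [h0', Function.update_self, Function.update_of_ne (hne hwS)] at hww
      exact absurd (hww ▸ mem_image_of_mem f hwS) hxS
    · rw [Function.update_of_ne (hne hwS), Function.update_of_ne (hne hwS')] at hww
      exact h2 hwS hwS' hww
  · rcases mem_insert.mp hw with h0 | hwS <;> rcases mem_insert.mp hw' with h0' | hwS'
    · rw [h0, h0'] at hww
      exact absurd hww G.irrefl
    · rw [h0, Function.update_self, Function.update_of_ne (hne hwS'), real_inner_comm]
      exact horth hwS' (h0 ▸ hww)
    · rw [h0', Function.update_self, Function.update_of_ne (hne hwS)]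
      exact horth hwS (h0' ▸ hww.symm)
    · rw [Function.update_of_ne (hne hwS), Function.update_of_ne (hne hwS')]
      exact h3 w hwS w' hwS' hww

theorem union_generic [DecidableRel G.Adj] (h : OrthRep G S d) {T : Finset V}
    (hT : ∀ t ∈ T, #{w ∈ S ∪ T | G.Adj t w} + 2 ≤ d) : OrthRep G (S ∪ T) d := by
  induction T using Finset.induction_on with
  | empty => simpa using h
  | insert a T ha ih =>
    have hsub : S ∪ T ⊆ S ∪ insert a T := union_subset_union_right (subset_insert a T)
    have hle (t) : #{w ∈ S ∪ T | G.Adj t w} ≤ #{w ∈ S ∪ insert a T | G.Adj t w} :=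
      card_le_card (filter_subset_filter _ hsub)
    rw [union_insert]
    refine (ih fun t ht => ?_).insert_generic ?_
    · exact (Nat.add_le_add_right (hle t) 2).trans (hT t (mem_insert_of_mem ht))
    · exact (Nat.add_le_add_right (hle a) 2).trans (hT a (mem_insert_self a T))

/-- Each vertex of `F` shares its dimension with a non-neighbour in `X`. -/
theorem of_matching (X F : Finset V) (g : V → V) (hg : Set.InjOn g F) (hgX : ∀ a ∈ F, g a ∈ X)
    (hG : ∀ a ∈ F, ¬ G.Adj a (g a)) : OrthRep G (X ∪ F) #X := by
  induction F using Finset.induction_on generalizing X with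
  | empty => simpa using (empty G 0).union_singles X
  | insert a F ha ih =>
    have haX := hgX a (mem_insert_self a F)
    have h := ih (X.erase (g a)) (hg.mono (by simp)) (fun b hb => ?_)
      fun b hb => hG b (mem_insert_of_mem hb)
    · have h' := h.insert_pair (hG a (mem_insert_self a F))
      rw [card_erase_add_one haX] at h'
      refine h'.mono fun w hw => ?_
      simp only [mem_union, mem_insert, mem_erase] at hw ⊢
      tauto
    · refine mem_erase.mpr ⟨fun hab => ha ?_, hgX b (mem_insert_of_mem hb)⟩
      rwa [← hg (mem_insert_of_mem hb) (mem_insert_self a F) hab]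

end OrthRep

theorem dist_inv_sqrt_two_smul {E : Type*} [NormedAddCommGroup E] [NormedSpace ℝ E] {x y : E}
    (h : ‖x - y‖ ^ 2 = 2) : dist ((√2 : ℝ)⁻¹ • x) ((√2 : ℝ)⁻¹ • y) = 1 := by
  rw [dist_eq_norm, ← smul_sub, norm_smul, norm_inv, Real.norm_of_nonneg (Real.sqrt_nonneg 2),
    ← h, Real.sqrt_sq (norm_nonneg _), inv_mul_cancel₀]
  intro h0
  rw [h0] at h
  norm_num at h

theorem OrthRep.graphRealizable {V : Type*} [Fintype V] {G : SimpleGraph V} {d : ℕ}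
    (h : OrthRep G univ d) : GraphRealizable G d := by
  obtain ⟨f, h1, h2, h3⟩ := h
  refine ⟨fun v => (√2)⁻¹ • f v, fun u v huv => ?_, fun u v huv => dist_inv_sqrt_two_smul ?_⟩
  · exact h2 (by simp) (by simp) (smul_right_injective _ (by positivity) huv)
  · rw [norm_sub_sq_real, h1 u (mem_univ u), h1 v (mem_univ v),
      h3 u (mem_univ u) v (mem_univ v) huv]
    norm_num

/-- The complement of an independent set `I` is mapped to the vertices of a regular simplex, and
`I` to a circle of points equidistant from these vertices. -/
theorem graphRealizable_of_isIndepSet {V : Type*} [Fintype V] [DecidableEq V] {G : SimpleGraph V}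
    {d : ℕ} {I : Finset V} (hI : G.IsIndepSet I) (hd : #Iᶜ + 1 ≤ d) : GraphRealizable G d := by
  classical
  rcases Iᶜ.eq_empty_or_nonempty with hK | hK
  · rw [compl_eq_empty_iff] at hK
    subst hK
    have : Nonempty (Fin d) := ⟨⟨0, by omega⟩⟩
    have : Infinite (EuclideanSpace ℝ (Fin d)) := Module.Free.infinite ℝ _
    let g := (Fintype.equivFin V).toEmbedding.trans
      (Fin.valEmbedding.trans (Infinite.natEmbedding (EuclideanSpace ℝ (Fin d))))
    exact ⟨g, g.injective, fun u v huv => absurd huv (hI (by simp) (by simp) huv.ne)⟩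
  let G' : SimpleGraph V := SimpleGraph.fromRel fun u v => u ∉ I ∨ v ∉ I
  have hG' {u v} : G'.Adj u v ↔ u ≠ v ∧ (u ∉ I ∨ v ∉ I) := by
    simp only [G', SimpleGraph.fromRel_adj]
    tauto
  have hrep : OrthRep G' univ (d + 1) := by
    have h1 : OrthRep G' (∅ ∪ I) 2 := (OrthRep.empty G' 2).union_generic fun t ht => by
      rw [card_eq_zero.mpr]
      refine filter_eq_empty_iff.mpr fun w hw => ?_
      rw [empty_union] at hw
      simp [hG', ht, hw]
    refine h1.extend (subset_univ _) ?_
    rw [empty_union, card_univ, ← card_compl_add_card I]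
    omega
  obtain ⟨f, h1, h2, h3⟩ := hrep
  simp only [mem_univ, forall_const, coe_univ, Set.injOn_univ] at h1 h2 h3
  set k : ℝ := ((#Iᶜ : ℕ) : ℝ) with hk
  have hk0 : 0 < k := Nat.cast_pos.mpr (card_pos.mpr hK)
  let w : EuclideanSpace ℝ (Fin (d + 1)) := k⁻¹ • ∑ v ∈ Iᶜ, f v
  have hwK {v} (hv : v ∉ I) : inner ℝ w (f v) = k⁻¹ := by
    rw [real_inner_smul_left, sum_inner, sum_eq_single_of_mem v (by simpa using hv),
      real_inner_self_eq_norm_sq, h1]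
    · simp
    · exact fun u _ huv => h3 u v (hG'.mpr ⟨huv, Or.inr hv⟩)
  have hwI {v} (hv : v ∈ I) : inner ℝ w (f v) = 0 := by
    rw [real_inner_smul_left, sum_inner, sum_eq_zero, mul_zero]
    intro u hu
    have hu' : u ∉ I := by simpa using hu
    exact h3 u v (hG'.mpr ⟨fun h => hu' (h ▸ hv), Or.inl hu'⟩)
  have hww : inner ℝ w w = k⁻¹ := by
    conv_lhs => enter [3]; rw [show w = k⁻¹ • ∑ v ∈ Iᶜ, f v from rfl]
    rw [real_inner_smul_right, inner_sum, sum_congr rfl fun v hv => hwK (by simpa using hv),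
      sum_const, nsmul_eq_mul, ← hk]
    field_simp
  have hw0 : w ≠ 0 := fun h => by
    rw [h, inner_zero_left] at hww
    exact (inv_pos.mpr hk0).ne hww
  clear_value w
  let s : ℝ := √(1 + k⁻¹)
  have hs : s ^ 2 = 1 + k⁻¹ := Real.sq_sqrt (by positivity)
  have hs0 : s ≠ 0 := fun h => by
    rw [h] at hs
    have : 0 < k⁻¹ := by positivity
    nlinarith
  let p : V → EuclideanSpace ℝ (Fin (d + 1)) := fun v => if v ∈ I then s • f v else f v - w
  have hp (v) : p v ∈ (ℝ ∙ w)ᗮ := by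
    rw [Submodule.mem_orthogonal_singleton_iff_inner_right]
    by_cases hv : v ∈ I
    · simp [p, hv, real_inner_smul_right, hwI hv]
    · simp only [p, hv, if_false]
      rw [inner_sub_right, hwK hv, hww, sub_self]
  have hpKI {u v} (hu : u ∉ I) (hv : v ∈ I) : ‖p u - p v‖ ^ 2 = 2 := by
    have huv : inner ℝ (f u) (f v) = 0 := h3 u v (hG'.mpr ⟨fun h => hu (h ▸ hv), Or.inl hu⟩)
    simp only [p, hu, hv, if_true, if_false]
    rw [norm_sub_sq_real, norm_sub_sq_real, norm_smul, mul_pow, h1, h1, real_inner_smul_right,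
      inner_sub_left, huv, hwI hv, real_inner_comm, hwK hu, ← real_inner_self_eq_norm_sq w, hww,
      Real.norm_eq_abs, sq_abs, hs]
    ring
  have hpK {u v} (huv : u ≠ v) (hu : u ∉ I) (hv : v ∉ I) : ‖p u - p v‖ ^ 2 = 2 := by
    simp only [p, hu, hv, if_false, sub_sub_sub_cancel_right]
    rw [norm_sub_sq_real, h1, h1, h3 u v (hG'.mpr ⟨huv, Or.inl hu⟩)]
    norm_num
  have hpinj : Function.Injective p := by
    intro u v huv
    by_contra hne
    have h0 : ‖p u - p v‖ ^ 2 ≠ 2 := by simp [huv]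
    by_cases hu : u ∈ I <;> by_cases hv : v ∈ I
    · simp only [p, hu, hv, if_true] at huv
      exact hne (h2 (smul_right_injective _ hs0 huv))
    · rw [norm_sub_rev] at h0
      exact h0 (hpKI hv hu)
    · exact h0 (hpKI hu hv)
    · exact h0 (hpK hne hu hv)
  have : Fact (Module.finrank ℝ (EuclideanSpace ℝ (Fin (d + 1))) = d + 1) :=
    ⟨finrank_euclideanSpace_fin⟩
  let b := OrthonormalBasis.fromOrthogonalSpanSingleton (𝕜 := ℝ) d hw0
  let q : V → EuclideanSpace ℝ (Fin d) := fun v => b.repr ⟨p v, hp v⟩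
  have hq (u v) : ‖q u - q v‖ = ‖p u - p v‖ := by
    simp only [q]
    rw [← map_sub, LinearIsometryEquiv.norm_map]
    rfl
  refine ⟨fun v => (√2)⁻¹ • q v, fun u v huv => hpinj ?_, fun u v huv => dist_inv_sqrt_two_smul ?_⟩
  · have := smul_right_injective _ (by positivity) huv
    rw [← sub_eq_zero, ← norm_eq_zero, ← hq, this, sub_self, norm_zero]
  · rw [hq]
    by_cases hu : u ∈ I <;> by_cases hv : v ∈ I
    · exact absurd huv (hI hu hv huv.ne)
    · rw [norm_sub_rev]
      exact hpKI hv hu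
    · exact hpKI hu hv
    · exact hpK huv.ne hu hv

namespace OrthRep

variable {V : Type*} [DecidableEq V] {G : SimpleGraph V} {S T X : Finset V} {d : ℕ}

theorem of_isIndepSet (hX : G.IsIndepSet X) : OrthRep G X 2 := by
  classical
  have h := (empty G 2).union_generic (T := X) fun t ht => by
    rw [card_eq_zero.mpr]
    refine filter_eq_empty_iff.mpr fun w hw htw => ?_
    rw [empty_union] at hw
    exact hX ht hw htw.ne htw
  rwa [empty_union] at h

theorem union_card_le_two (h : OrthRep G S d) (hT : G.IsIndepSet T) (hcard : #T ≤ 2) :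
    OrthRep G (S ∪ T) (d + 1) := by
  rcases T.eq_empty_or_nonempty with rfl | ⟨v, hv⟩
  · simpa using h.mono_dim (Nat.le_succ d)
  · obtain ⟨u, hu⟩ : ∃ u, T ⊆ {u, v} ∧ ¬ G.Adj u v := by
      rcases (T.erase v).eq_empty_or_nonempty with h0 | ⟨u, hu⟩
      · refine ⟨v, fun w hw => ?_, G.irrefl⟩
        by_contra hwv
        have hwT : w ∈ T.erase v :=
          mem_erase.mpr ⟨fun h => hwv (by simp [h]), hw⟩
        simp [h0] at hwT
      · rw [mem_erase] at hu
        refine ⟨u, ?_, hT hu.2 hv hu.1⟩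
        refine (eq_of_subset_of_card_le (s := {u, v}) ?_ ?_).ge
        · simp [insert_subset_iff, hu.2, hv]
        · rwa [card_pair hu.1]
    refine (h.insert_pair hu.2).mono fun w hw => ?_
    have := @hu.1 w
    simp only [mem_union, mem_insert, mem_singleton] at *
    tauto

theorem insert_isIndepSet [DecidableRel G.Adj] (hX : G.IsIndepSet X) {u : V} (huX : u ∉ X)
    (hu : #{x ∈ X | G.Adj u x} ≤ 2) : OrthRep G (insert u X) 2 := by
  have h1 := ((empty G 0).insert_single u).union_card_le_two
    (T := {x ∈ X | G.Adj u x}) (hX.mono (coe_subset.mpr (filter_subset _ _))) hu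
  have h2 := h1.union_generic (T := {x ∈ X | ¬ G.Adj u x}) fun t ht => by
    rw [mem_filter] at ht
    rw [card_eq_zero.mpr]
    refine filter_eq_empty_iff.mpr fun w hw htw => ?_
    simp only [mem_union, mem_filter, mem_insert, notMem_empty, or_false] at hw
    rcases hw with (rfl | hw) | hw
    · exact ht.2 htw.symm
    · exact hX ht.1 hw.1 htw.ne htw
    · exact hX ht.1 hw.1 htw.ne htw
  refine h2.mono fun w hw => ?_
  simp only [mem_union, mem_filter, mem_insert, notMem_empty, or_false] at hw ⊢
  tauto

end OrthRep

/-- All cliques and independent sets contained in `S` have at most `m` vertices. -/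
def HomBound {V : Type*} (G : SimpleGraph V) (S : Finset V) (m : ℕ) : Prop :=
  ∀ T ⊆ S, G.IsIndepSet T ∨ G.IsClique T → #T ≤ m

theorem HomBound.compl {V : Type*} {G : SimpleGraph V} {S : Finset V} {m : ℕ}
    (h : HomBound G S m) : HomBound Gᶜ S m := fun T hT hT' => h T hT (by
  rw [SimpleGraph.isIndepSet_compl, SimpleGraph.isClique_compl] at hT'
  exact hT'.symm)

/-- `X` is an independent subset of `S` that is not smaller than any clique or independent
subset of `S`. -/
structure MaxHom {V : Type*} (G : SimpleGraph V) (S X : Finset V) : Prop where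
  subset : X ⊆ S
  indep : G.IsIndepSet X
  bound : HomBound G S #X

namespace MaxHom

variable {V : Type*} {G : SimpleGraph V} {S X : Finset V}

theorem not_isClique (h : MaxHom G S X) {T : Finset V} (hT : T ⊆ S) (hcard : #X < #T) :
    ¬ G.IsClique T := fun hc => hcard.not_ge (h.bound T hT (Or.inr hc))

theorem exists_compl_adj (h : MaxHom G S X) {T : Finset V} (hT : T ⊆ S) (hcard : #X < #T) :
    ∃ a ∈ T, ∃ b ∈ T, Gᶜ.Adj a b := by
  by_contra! hc
  refine h.not_isClique hT hcard fun a ha b hb hab => ?_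
  have := hc a ha b hb
  rw [SimpleGraph.compl_adj] at this
  tauto

variable [DecidableEq V] [DecidableRel G.Adj] {F : Finset V} {d : ℕ}

theorem hall (h : MaxHom G S X) (hF : F ⊆ S) (hFX : Disjoint F X) (hFG : G.IsIndepSet F) :
    #F ≤ #(F.biUnion fun a => {x ∈ X | G.Adj a x}) := by
  set N := F.biUnion fun a => {x ∈ X | G.Adj a x} with hN
  have hNX : N ⊆ X := biUnion_subset.mpr fun a _ => filter_subset _ _
  have hnot {a x} (ha : a ∈ F) (hx : x ∈ X \ N) : ¬ G.Adj a x := fun hax => by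
    rw [mem_sdiff] at hx
    exact hx.2 (mem_biUnion.mpr ⟨a, ha, by simp [hx.1, hax]⟩)
  have h1 : G.IsIndepSet ((X \ N) ∪ F : Finset V) := by
    intro a ha b hb hab
    rw [mem_coe, mem_union] at ha hb
    rcases ha with ha | ha <;> rcases hb with hb | hb
    · exact h.indep (mem_sdiff.mp ha).1 (mem_sdiff.mp hb).1 hab
    · exact fun h' => hnot hb ha h'.symm
    · exact hnot ha hb
    · exact hFG ha hb hab
  have h2 := h.bound _ (union_subset (sdiff_subset.trans h.subset) hF) (Or.inl h1)
  rw [card_union_of_disjoint (hFX.symm.mono_left sdiff_subset), card_sdiff_of_subset hNX] at h2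
  have := card_le_card hNX
  omega

theorem one_le_card (h : MaxHom G S X) {r : V} (hr : r ∈ S \ X) : 1 ≤ #{x ∈ X | G.Adj r x} := by
  rw [mem_sdiff] at hr
  simpa using h.hall (F := {r}) (by simpa using hr.1) (by simpa using hr.2) (by simp)

end MaxHom

section Hall

variable {V : Type*} [DecidableEq V] {G : SimpleGraph V} [DecidableRel G.Adj] {S X F : Finset V}
  {d : ℕ}

theorem exists_injOn_of_hall
    (hF : ∀ s ⊆ F, #s ≤ #(s.biUnion fun a => {x ∈ X | G.Adj a x})) :
    ∃ g : V → V, Set.InjOn g F ∧ (∀ a ∈ F, g a ∈ X) ∧ ∀ a ∈ F, G.Adj a (g a) := by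
  obtain ⟨g, hg, hg'⟩ := (all_card_le_biUnion_card_iff_exists_injective
    fun a : F => {x ∈ X | G.Adj a x}).mp fun s => by
      have := hF (s.map (Function.Embedding.subtype _)) fun v hv => by
        simp only [mem_map, Function.Embedding.subtype_apply] at hv
        obtain ⟨w, -, rfl⟩ := hv
        exact w.2
      rw [card_map] at this
      refine this.trans (card_le_card fun v hv => ?_)
      simpa using hv
  refine ⟨fun v => if hv : v ∈ F then g ⟨v, hv⟩ else v, fun a ha b hb hab => ?_,
    fun a ha => ?_, fun a ha => ?_⟩
  · simp only [mem_coe] at ha hb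
    simp only [ha, hb, dif_pos] at hab
    exact congrArg Subtype.val (hg hab)
  · simpa [ha] using (mem_filter.mp (hg' ⟨a, ha⟩)).1
  · simpa [ha] using (mem_filter.mp (hg' ⟨a, ha⟩)).2

theorem OrthRep.compl_of_hall
    (hF : ∀ s ⊆ F, #s ≤ #(s.biUnion fun a => {x ∈ X | G.Adj a x})) : OrthRep Gᶜ (X ∪ F) #X := by
  obtain ⟨g, h1, h2, h3⟩ := exists_injOn_of_hall hF
  exact .of_matching X F g h1 h2 fun a ha h => (G.compl_adj _ _ |>.mp h).2 (h3 a ha)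

/-- The vertices outside `X ∪ F` are represented generically. -/
theorem OrthRep.compl_extend (h : OrthRep Gᶜ (X ∪ F) d) (hX : X ⊆ S) (hF : F ⊆ S)
    (hB : ∀ t ∈ S \ X, t ∉ F → ∃ B : Finset V, (∀ w ∈ S \ X, Gᶜ.Adj t w → w ∈ B) ∧
      #B + #X + 2 ≤ d + #{x ∈ X | G.Adj t x}) : OrthRep Gᶜ S d := by
  have h1 := h.union_generic (T := S \ (X ∪ F)) fun t ht => by
    simp only [mem_sdiff, mem_union, not_or] at ht
    obtain ⟨B, hB1, hB2⟩ := hB t (mem_sdiff.mpr ⟨ht.1, ht.2.1⟩) ht.2.2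
    rw [union_sdiff_of_subset (union_subset hX hF)]
    have h2 : {w ∈ S | Gᶜ.Adj t w} ⊆ B ∪ {x ∈ X | ¬ G.Adj t x} := fun w hw => by
      simp only [mem_filter, mem_union] at hw ⊢
      by_cases hwX : w ∈ X
      · exact Or.inr ⟨hwX, (G.compl_adj _ _ |>.mp hw.2).2⟩
      · exact Or.inl (hB1 w (mem_sdiff.mpr ⟨hw.1, hwX⟩) hw.2)
    have h3 := (card_le_card h2).trans (card_union_le _ _)
    have h4 := card_filter_add_card_filter_not (s := X) (fun x => G.Adj t x)
    omega
  rwa [union_sdiff_of_subset (union_subset hX hF)] at h1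

end Hall

namespace MaxHom

variable {V : Type*} [DecidableEq V] {G : SimpleGraph V} [DecidableRel G.Adj] {S X F : Finset V}
  {d : ℕ}

theorem hall_subset (h : MaxHom G S X) (hF : F ⊆ S \ X) (hFG : G.IsIndepSet F) :
    ∀ s ⊆ F, #s ≤ #(s.biUnion fun a => {x ∈ X | G.Adj a x}) := fun _ hs =>
  h.hall ((hs.trans hF).trans sdiff_subset) (disjoint_sdiff_self_left.mono_left (hs.trans hF))
    (hFG.mono hs)

theorem orthRep_compl (h : MaxHom G S X) (hF : F ⊆ S \ X) (hFG : G.IsIndepSet F) :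
    OrthRep Gᶜ (X ∪ F) #X :=
  .compl_of_hall (h.hall_subset hF hFG)

theorem exists_matching (h : MaxHom G S X) {a b : V} (ha : a ∈ S \ X) (hb : b ∈ S \ X)
    (hab : Gᶜ.Adj a b) : ∃ x ∈ X, ∃ y ∈ X, x ≠ y ∧ G.Adj a x ∧ G.Adj b y := by
  rw [SimpleGraph.compl_adj] at hab
  obtain ⟨g, h1, h2, h3⟩ := exists_injOn_of_hall (h.hall_subset (F := {a, b})
    (by simp [insert_subset_iff, ha, hb]) (by
      simp [SimpleGraph.IsIndepSet, Set.pairwise_insert, hab, G.adj_comm b a]))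
  exact ⟨g a, h2 a (by simp), g b, h2 b (by simp), fun h => hab.1 (h1 (by simp) (by simp) h),
    h3 a (by simp), h3 b (by simp)⟩

theorem orthRep_compl_pair_or (h : MaxHom G S X) {a b : V} (ha : a ∈ S \ X) (hb : b ∈ S \ X)
    (hab : a ≠ b) : OrthRep Gᶜ (X ∪ {a, b}) #X ∨
      G.Adj a b ∧ ∃ x ∈ X, ∀ z ∈ X, (G.Adj a z ↔ z = x) ∧ (G.Adj b z ↔ z = x) := by
  by_cases hxy : ∃ x ∈ X, ∃ y ∈ X, x ≠ y ∧ G.Adj a x ∧ G.Adj b y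
  · obtain ⟨x, hx, y, hy, hne, hax, hby⟩ := hxy
    left
    refine .of_matching X {a, b} (fun v => if v = a then x else y) ?_ ?_ ?_
    · intro u hu v hv huv
      simp only [coe_insert, coe_singleton, Set.mem_insert_iff, Set.mem_singleton_iff] at hu hv
      grind
    · intro v _
      by_cases hv : v = a <;> simp [hv, hx, hy]
    · intro v hv
      simp only [mem_insert, mem_singleton] at hv
      rw [SimpleGraph.compl_adj]
      grind
  · right
    refine ⟨?_, ?_⟩
    · by_contra hG
      exact hxy (h.exists_matching ha hb (by simp [hab, hG]))
    · obtain ⟨x, hx⟩ := card_pos.mp (h.one_le_card ha)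
      obtain ⟨y, hy⟩ := card_pos.mp (h.one_le_card hb)
      rw [mem_filter] at hx hy
      refine ⟨x, hx.1, fun z hz => ?_⟩
      push Not at hxy
      grind

end MaxHom

theorem SimpleGraph.isIndepSet_pair {V : Type*} [DecidableEq V] {G : SimpleGraph V} {a b : V}
    (hab : ¬ G.Adj a b) : G.IsIndepSet ({a, b} : Finset V) := by
  intro u hu v hv huv
  simp only [coe_insert, coe_singleton, Set.mem_insert_iff, Set.mem_singleton_iff] at hu hv
  grind [SimpleGraph.adj_comm]

theorem SimpleGraph.isIndepSet_triple {V : Type*} [DecidableEq V] {G : SimpleGraph V} {a b c : V}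
    (hab : ¬ G.Adj a b) (hac : ¬ G.Adj a c) (hbc : ¬ G.Adj b c) :
    G.IsIndepSet ({a, b, c} : Finset V) := by
  intro u hu v hv huv
  simp only [coe_insert, coe_singleton, Set.mem_insert_iff, Set.mem_singleton_iff] at hu hv
  grind [SimpleGraph.adj_comm]

namespace MaxHom

variable {V : Type*} [DecidableEq V] {G : SimpleGraph V} {S X : Finset V}

theorem orthRep_of_two_disjoint_pairs (h : MaxHom G S X) (hS : #S = 2 * #X) {a b c e : V}
    (hR : {a, b, c, e} ⊆ S \ X) (hcard : #{a, b, c, e} = 4) (hab : ¬ G.Adj a b)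
    (hce : ¬ G.Adj c e) : OrthRep G S #X := by
  refine (((OrthRep.of_isIndepSet h.indep).insert_pair hce).insert_pair hab).extend
    (e := 4) ?_ ?_
  · have := h.subset
    simp only [insert_subset_iff, singleton_subset_iff, mem_sdiff] at hR
    simp only [insert_subset_iff]
    tauto
  · have : insert a (insert b (insert c (insert e X))) = {a, b, c, e} ∪ X := by grind
    rw [this, card_union_of_disjoint (disjoint_sdiff_self_left.mono_left hR)]
    omega

variable [DecidableRel G.Adj]

theorem orthRep_of_one_pair (h : MaxHom G S X) (hS : #S = 2 * #X) {a b : V}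
    (ha : a ∈ S \ X) (hb : b ∈ S \ X) (hab : Gᶜ.Adj a b)
    (hno : ∀ a ∈ S \ X, ∀ b ∈ S \ X, ∀ c ∈ S \ X, ∀ e ∈ S \ X, Gᶜ.Adj a b → Gᶜ.Adj c e →
      c = a ∨ c = b ∨ e = a ∨ e = b) :
    OrthRep G S #X ∨ OrthRep Gᶜ S #X := by
  by_cases hu : ∃ u ∈ S \ X, u ≠ a ∧ u ≠ b ∧ #{x ∈ X | G.Adj u x} ≤ 2
  · obtain ⟨u, huR, hua, hub, hu⟩ := hu
    left
    rw [mem_sdiff] at ha hb huR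
    refine ((OrthRep.insert_isIndepSet h.indep huR.2 hu).insert_pair
      hab.2).extend (e := 3) ?_ ?_
    · have := h.subset
      grind
    · have := hab.ne
      rw [card_insert_of_notMem (by grind), card_insert_of_notMem (by grind),
        card_insert_of_notMem huR.2]
      omega
  push Not at hu
  right
  by_cases hu2 : ∃ u ∈ S \ X, Gᶜ.Adj u a ∧ Gᶜ.Adj u b
  · obtain ⟨u, huR, hua, hub⟩ := hu2
    have hF : {a, b, u} ⊆ S \ X := by simp [insert_subset_iff, ha, hb, huR]
    refine (h.orthRep_compl hF (SimpleGraph.isIndepSet_triple hab.2 hua.symm.2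
      hub.symm.2)).compl_extend h.subset (hF.trans sdiff_subset)
      fun t ht htF => ⟨∅, fun w hw htw => ?_, ?_⟩
    · have h1 := hno a ha b hb t ht w hw hab htw
      have h2 := hno t ht a ha u huR b hb
      have h3 := hno t ht b hb u huR a ha
      grind [SimpleGraph.irrefl]
    · have := hu t ht (by grind) (by grind)
      simp
      omega
  · push Not at hu2
    have hF : {a, b} ⊆ S \ X := by simp [insert_subset_iff, ha, hb]
    refine (h.orthRep_compl hF (SimpleGraph.isIndepSet_pair hab.2)).compl_extend h.subset
      (hF.trans sdiff_subset)
      fun t ht htF => ⟨if Gᶜ.Adj t a then {a} else {b}, fun w hw htw => ?_, ?_⟩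
    · have h1 := hno a ha b hb t ht w hw hab htw
      have h2 := hu2 t ht
      grind
    · have := hu t ht (by grind) (by grind)
      have : #(if Gᶜ.Adj t a then {a} else {b} : Finset V) ≤ 1 := by split_ifs <;> simp
      omega

/-- If two vertices outside `X` have the same unique neighbour `x` in `X`, then they can be taken
together with a non-neighbour of `x` to start a representation of `G`. -/
theorem orthRep_of_common_neighbor (h : MaxHom G S X) (hS : #S = 2 * #X)
    (hR : G.IsClique (S \ X : Finset V)) {y y' x : V} (hy : y ∈ S \ X) (hy' : y' ∈ S \ X)
    (hyy' : y ≠ y') (hx : x ∈ X) (hN : ∀ z ∈ X, G.Adj y z ↔ z = x)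
    (hN' : ∀ z ∈ X, G.Adj y' z ↔ z = x) : OrthRep G S #X := by
  have hcard : #(S \ X) = #X := by
    rw [card_sdiff_of_subset h.subset]
    omega
  have hxS := h.subset hx
  obtain ⟨z, hz, hxz⟩ : ∃ z ∈ S \ X, ¬ G.Adj x z := by
    by_contra! hc
    refine h.not_isClique (T := insert x (S \ X)) ?_ ?_ ?_
    · exact insert_subset hxS sdiff_subset
    · rw [card_insert_of_notMem (by simp [hx])]
      omega
    · rw [coe_insert]
      exact hR.insert fun b hb _ => hc b hb
  have h1 : OrthRep G ({y, y'} ∪ X.erase x) 2 :=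
    (((OrthRep.empty G 0).insert_single y').insert_single y).union_generic fun t ht => by
      rw [card_eq_zero.mpr]
      refine filter_eq_empty_iff.mpr fun w hw htw => ?_
      rw [mem_erase] at ht
      simp only [mem_union, mem_insert, notMem_empty, or_false, mem_erase] at hw
      rcases hw with (rfl | rfl) | hw
      · exact ht.1 ((hN t ht.2).mp htw.symm)
      · exact ht.1 ((hN' t ht.2).mp htw.symm)
      · exact h.indep ht.2 hw.2 htw.ne htw
  have hzy : z ≠ y := by
    rintro rfl
    exact hxz ((hN x hx).mpr rfl).symm
  have hzy' : z ≠ y' := by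
    rintro rfl
    exact hxz ((hN' x hx).mpr rfl).symm
  have h2 : insert x (insert z ({y, y'} ∪ X.erase x)) = {z, y, y'} ∪ X := by grind
  have h3 := h1.insert_pair hxz
  rw [h2] at h3
  have h4 : {z, y, y'} ⊆ S \ X := by simp [insert_subset_iff, hz, hy, hy']
  refine h3.extend (union_subset (h4.trans sdiff_subset) h.subset) ?_
  rw [card_union_of_disjoint (disjoint_sdiff_self_left.mono_left h4),
    card_eq_three.mpr ⟨z, y, y', hzy, hzy', hyy', rfl⟩]
  omega

theorem orthRep_of_isClique (h : MaxHom G S X) (hS : #S = 2 * #X)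
    (hR : G.IsClique (S \ X : Finset V)) : OrthRep G S #X ∨ OrthRep Gᶜ S #X := by
  by_cases hy : ∃ y ∈ S \ X, ∃ y' ∈ S \ X, y ≠ y' ∧
      ∃ x ∈ X, ∀ z ∈ X, (G.Adj y z ↔ z = x) ∧ (G.Adj y' z ↔ z = x)
  · obtain ⟨y, hy, y', hy', hne, x, hx, hN⟩ := hy
    exact Or.inl (h.orthRep_of_common_neighbor hS hR hy hy' hne hx (fun z hz => (hN z hz).1)
      fun z hz => (hN z hz).2)
  right
  push Not at hy
  set F := {r ∈ S \ X | #{x ∈ X | G.Adj r x} = 1} with hF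
  have hg (r : V) : ∃ x, r ∈ F → x ∈ X ∧ ∀ z ∈ X, G.Adj r z ↔ z = x := by
    by_cases hr : r ∈ F
    · rw [hF, mem_filter, card_eq_one] at hr
      obtain ⟨-, x, hx⟩ := hr
      simp only [Finset.ext_iff, mem_filter, mem_singleton] at hx
      exact ⟨x, fun _ => by grind⟩
    · exact ⟨r, fun h => absurd h hr⟩
  choose g hg using hg
  refine (OrthRep.of_matching X F g ?_ (fun a ha => (hg a ha).1) ?_).compl_extend h.subset
    ((filter_subset _ _).trans sdiff_subset) fun t ht htF => ⟨∅, fun w hw htw => ?_, ?_⟩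
  · intro a ha b hb hab
    by_contra hne
    obtain ⟨z, hz, hz'⟩ := hy a (mem_filter.mp ha).1 b (mem_filter.mp hb).1 hne (g a) (hg a ha).1
    have := (hg a ha).2 z hz
    have := (hg b hb).2 z hz
    grind
  · intro a ha hadj
    exact hadj.2 (((hg a ha).2 _ (hg a ha).1).mpr rfl)
  · exact absurd (hR ht hw htw.ne) htw.2
  · have := h.one_le_card ht
    simp only [hF, mem_filter, ht, true_and] at htF
    rw [card_empty]
    omega

theorem orthRep_or_of_card_eq (h : MaxHom G S X) (hS : #S = 2 * #X) :
    OrthRep G S #X ∨ OrthRep Gᶜ S #X := by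
  by_cases h2 : ∃ a ∈ S \ X, ∃ b ∈ S \ X, ∃ c ∈ S \ X, ∃ e ∈ S \ X, Gᶜ.Adj a b ∧ Gᶜ.Adj c e ∧
      c ≠ a ∧ c ≠ b ∧ e ≠ a ∧ e ≠ b
  · obtain ⟨a, ha, b, hb, c, hc, e, he, hab, hce, hca, hcb, hea, heb⟩ := h2
    refine Or.inl (h.orthRep_of_two_disjoint_pairs hS (a := a) (b := b) (c := c) (e := e)
      ?_ ?_ hab.2 hce.2)
    · simp [insert_subset_iff, ha, hb, hc, he]
    · have := hab.ne
      have := hce.ne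
      rw [card_insert_of_notMem (by grind), card_eq_three.mpr
        ⟨b, c, e, hcb.symm, heb.symm, hce.ne, rfl⟩]
  by_cases h1 : ∃ a ∈ S \ X, ∃ b ∈ S \ X, Gᶜ.Adj a b
  · obtain ⟨a, ha, b, hb, hab⟩ := h1
    refine h.orthRep_of_one_pair hS ha hb hab fun a ha b hb c hc e he hab hce => ?_
    by_contra! hne
    exact h2 ⟨a, ha, b, hb, c, hc, e, he, hab, hce, hne⟩
  · refine h.orthRep_of_isClique hS fun a ha b hb hab => ?_
    by_contra hadj
    exact h1 ⟨a, ha, b, hb, hab, hadj⟩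

end MaxHom

/-- `ab` and `ce` are two disjoint edges of the complement of `G` inside `R`. -/
structure DisjointNonedges {V : Type*} (G : SimpleGraph V) (R : Finset V) (a b c e : V) :
    Prop where
  mem₁ : a ∈ R
  mem₂ : b ∈ R
  mem₃ : c ∈ R
  mem₄ : e ∈ R
  adj₁₂ : Gᶜ.Adj a b
  adj₃₄ : Gᶜ.Adj c e
  ne₁₃ : a ≠ c
  ne₁₄ : a ≠ e
  ne₂₃ : b ≠ c
  ne₂₄ : b ≠ e

namespace DisjointNonedges

variable {V : Type*} {G : SimpleGraph V} {R : Finset V} {a b c e : V}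

theorem swap (h : DisjointNonedges G R a b c e) : DisjointNonedges G R c e a b :=
  ⟨h.3, h.4, h.1, h.2, h.6, h.5, h.7.symm, h.9.symm, h.8.symm, h.10.symm⟩

theorem swap_left (h : DisjointNonedges G R a b c e) : DisjointNonedges G R b a c e :=
  ⟨h.2, h.1, h.3, h.4, h.5.symm, h.6, h.9, h.10, h.7, h.8⟩

theorem swap_right (h : DisjointNonedges G R a b c e) : DisjointNonedges G R a b e c :=
  ⟨h.1, h.2, h.4, h.3, h.5, h.6.symm, h.8, h.7, h.10, h.9⟩

variable [DecidableEq V]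

theorem subset (h : DisjointNonedges G R a b c e) : {a, b, c, e} ⊆ R := by
  simp [insert_subset_iff, h.1, h.2, h.3, h.4]

theorem card_eq (h : DisjointNonedges G R a b c e) : #{a, b, c, e} = 4 := by
  have h1 := h.adj₁₂.ne
  rw [card_insert_of_notMem (by simp [h1, h.ne₁₃, h.ne₁₄]), card_eq_three.mpr
    ⟨b, c, e, h.ne₂₃, h.ne₂₄, h.adj₃₄.ne, rfl⟩]

end DisjointNonedges

namespace MaxHom

variable {V : Type*} [DecidableEq V] {G : SimpleGraph V} {S X : Finset V} {a b c e u : V}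

theorem orthRep_of_three_disjoint_pairs (h : MaxHom G S X) (hS : #S = 2 * (#X + 1))
    (hP : DisjointNonedges G (S \ X) a b c e) {p q : V} (hp : p ∈ S \ X) (hq : q ∈ S \ X)
    (hpq : Gᶜ.Adj p q) (hpP : p ∉ ({a, b, c, e} : Finset V))
    (hqP : q ∉ ({a, b, c, e} : Finset V)) : OrthRep G S (#X + 1) := by
  have h1 := ((((OrthRep.of_isIndepSet h.indep).insert_pair hP.adj₃₄.2).insert_pair
    hP.adj₁₂.2).insert_pair hpq.2)
  have h2 : insert p (insert q (insert a (insert b (insert c (insert e X))))) =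
    insert p (insert q {a, b, c, e}) ∪ X := by grind
  rw [h2] at h1
  have h3 : insert p (insert q {a, b, c, e}) ⊆ S \ X :=
    insert_subset hp (insert_subset hq hP.subset)
  refine h1.extend (union_subset (h3.trans sdiff_subset) h.subset) ?_
  rw [card_union_of_disjoint (disjoint_sdiff_self_left.mono_left h3),
    card_insert_of_notMem (by simpa [hpq.ne] using hpP), card_insert_of_notMem hqP, hP.card_eq]
  omega

variable [DecidableRel G.Adj]

theorem orthRep_of_card_le_two (h : MaxHom G S X) (hS : #S = 2 * (#X + 1))
    (hP : DisjointNonedges G (S \ X) a b c e) (hu : u ∈ S \ X)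
    (huP : u ∉ ({a, b, c, e} : Finset V)) (huX : #{x ∈ X | G.Adj u x} ≤ 2) :
    OrthRep G S (#X + 1) := by
  have h1 := ((OrthRep.insert_isIndepSet h.indep (mem_sdiff.mp hu).2 huX).insert_pair
    hP.adj₃₄.2).insert_pair hP.adj₁₂.2
  have h2 : insert a (insert b (insert c (insert e (insert u X)))) =
    insert u {a, b, c, e} ∪ X := by grind
  rw [h2] at h1
  have h3 : insert u {a, b, c, e} ⊆ S \ X := insert_subset hu hP.subset
  refine h1.extend (union_subset (h3.trans sdiff_subset) h.subset) ?_
  rw [card_union_of_disjoint (disjoint_sdiff_self_left.mono_left h3),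
    card_insert_of_notMem huP, hP.card_eq]
  omega

theorem orthRep_compl_of_adj_three (h : MaxHom G S X)
    (hno : ∀ a b c e, DisjointNonedges G (S \ X) a b c e → ∀ p ∈ S \ X, ∀ q ∈ S \ X,
      Gᶜ.Adj p q → p ∈ ({a, b, c, e} : Finset V) ∨ q ∈ ({a, b, c, e} : Finset V))
    (hN : ∀ a b c e, DisjointNonedges G (S \ X) a b c e → ∀ u ∈ S \ X,
      u ∉ ({a, b, c, e} : Finset V) → 3 ≤ #{x ∈ X | G.Adj u x})
    (hP : DisjointNonedges G (S \ X) a b c e) (hu : u ∈ S \ X)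
    (huP : u ∉ ({a, b, c, e} : Finset V)) (hua : Gᶜ.Adj u a) (hub : Gᶜ.Adj u b)
    (huc : Gᶜ.Adj u c) : OrthRep Gᶜ S (#X + 1) := by
  obtain ⟨ha, hb, hc, he, hab, hce, hac, hae, hbc, hbe⟩ := id hP
  have hue : u ≠ e := by
    rintro rfl
    simp at huP
  have hP1 : DisjointNonedges G (S \ X) u a c e :=
    ⟨hu, ha, hc, he, hua, hce, huc.ne, hue, hac, hae⟩
  have hP2 : DisjointNonedges G (S \ X) u b c e :=
    ⟨hu, hb, hc, he, hub, hce, huc.ne, hue, hbc, hbe⟩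
  have hP3 : DisjointNonedges G (S \ X) a b u c :=
    ⟨ha, hb, hu, hc, hab, huc, hua.ne', hac, hub.ne', hbc⟩
  have hF : {a, b, c, e, u} ⊆ S \ X := by simp [insert_subset_iff, ha, hb, hc, he, hu]
  have hFN : ∀ v ∈ ({a, b, c, e, u} : Finset V), v ≠ c → 3 ≤ #{x ∈ X | G.Adj v x} := by
    intro v hv hvc
    simp only [mem_insert, mem_singleton] at hv
    have := hab.ne
    have := hce.ne
    rcases hv with rfl | rfl | rfl | rfl | rfl
    · exact hN _ _ _ _ hP2 _ ha (by simp_all [eq_comm])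
    · exact hN _ _ _ _ hP1 _ hb (by simp_all [eq_comm])
    · exact absurd rfl hvc
    · exact hN _ _ _ _ hP3 _ he (by simp_all [eq_comm])
    · exact hN _ _ _ _ hP _ hu huP
  suffices hrep : OrthRep Gᶜ (X ∪ {a, b, c, e, u}) (#X + 1) by
    refine hrep.compl_extend h.subset (hF.trans sdiff_subset) fun t ht htF =>
      ⟨{c}, fun w hw htw => ?_, ?_⟩
    · have h0 := hno _ _ _ _ hP t ht w hw htw
      have h1 := hno _ _ _ _ hP1 t ht w hw htw
      have h2 := hno _ _ _ _ hP2 t ht w hw htw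
      have h3 := hno _ _ _ _ hP3 t ht w hw htw
      simp only [mem_insert, mem_singleton] at h0 h1 h2 h3 htF ⊢
      have := hab.ne
      grind
    · have := hN _ _ _ _ hP t ht (by grind)
      rw [card_singleton]
      omega
  by_cases hI : G.IsIndepSet ({a, b, c, e, u} : Finset V)
  · exact (h.orthRep_compl hF hI).mono_dim (Nat.le_succ _)
  · obtain ⟨p, hp, q, hq, hpq⟩ : ∃ p ∈ ({a, b, c, e, u} : Finset V),
        ∃ q ∈ ({a, b, c, e, u} : Finset V), G.Adj p q := by
      by_contra! hc
      exact hI fun p hp q hq _ => hc p hp q hq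
    have hpqF : {p, q} ⊆ ({a, b, c, e, u} : Finset V) := by
      simp only [insert_subset_iff, hp, singleton_subset_iff, hq, and_self]
    have h1 : OrthRep Gᶜ (X ∪ ({a, b, c, e, u} \ {p, q})) #X := by
      refine .compl_of_hall fun s hs => ?_
      rcases s.eq_empty_or_nonempty with rfl | ⟨v, hv⟩
      · simp
      have hcard : #s ≤ 3 := by
        refine (card_le_card hs).trans ?_
        rw [card_sdiff_of_subset hpqF, card_pair hpq.ne]
        have : #{a, b, c, e, u} ≤ 5 := card_le_five
        omega
      have hmem (w) (hw : w ∈ s) : w ∈ ({a, b, c, e, u} : Finset V) :=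
        sdiff_subset (hs hw)
      by_cases hsc : s ⊆ {c}
      · refine (card_le_card hsc).trans ?_
        rw [card_singleton]
        have h2 := h.one_le_card (hF (hmem v hv))
        exact h2.trans (card_le_card (subset_biUnion_of_mem
          (fun a => {x ∈ X | G.Adj a x}) hv))
      · obtain ⟨w, hw, hwc⟩ := not_subset.mp hsc
        rw [mem_singleton] at hwc
        exact (hcard.trans (hFN w (hmem w hw) hwc)).trans (card_le_card (subset_biUnion_of_mem
          (fun a => {x ∈ X | G.Adj a x}) hw))
    refine (h1.insert_pair (u := p) (v := q) fun h' => h'.2 hpq).mono fun w hw => ?_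
    rw [mem_insert, mem_insert, or_iff_not_imp_left, or_iff_not_imp_left]
    refine fun hwp hwq => mem_union.mpr ((mem_union.mp hw).imp_right fun hwF => ?_)
    exact mem_sdiff.mpr ⟨hwF, by simp [hwp, hwq]⟩

end MaxHom

theorem three_le_card_filter {α : Type*} [DecidableEq α] {p : α → Prop} [DecidablePred p]
    {a b c e : α} (h : 3 ≤ #{w ∈ ({a, b, c, e} : Finset α) | p w}) :
    (p a ∧ p b ∧ p c) ∨ (p a ∧ p b ∧ p e) ∨ (p a ∧ p c ∧ p e) ∨ (p b ∧ p c ∧ p e) := by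
  by_contra hp
  obtain ⟨x, y, hxy⟩ : ∃ x y : α, {w ∈ ({a, b, c, e} : Finset α) | p w} ⊆ {x, y} := by
    have hp' : (¬ p a ∧ ¬ p b) ∨ (¬ p a ∧ ¬ p c) ∨ (¬ p a ∧ ¬ p e) ∨ (¬ p b ∧ ¬ p c) ∨
        (¬ p b ∧ ¬ p e) ∨ (¬ p c ∧ ¬ p e) := by tauto
    rcases hp' with h' | h' | h' | h' | h' | h'
    · exact ⟨c, e, by grind⟩
    · exact ⟨b, e, by grind⟩
    · exact ⟨b, c, by grind⟩
    · exact ⟨a, e, by grind⟩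
    · exact ⟨a, c, by grind⟩
    · exact ⟨a, b, by grind⟩
  have := (card_le_card hxy).trans card_le_two
  omega

namespace MaxHom

variable {V : Type*} [DecidableEq V] {G : SimpleGraph V} [DecidableRel G.Adj] {S X : Finset V}
  {a b c e : V}

theorem orthRep_or_of_adj (h : MaxHom G S X) (hS : #S = 2 * (#X + 1))
    (hP : DisjointNonedges G (S \ X) a b c e) (hac : G.Adj a c) :
    OrthRep G S (#X + 1) ∨ OrthRep Gᶜ (X ∪ {a, b, c, e}) (#X + 1) := by
  rcases h.orthRep_compl_pair_or hP.mem₂ hP.mem₄ hP.ne₂₄ with hbe | ⟨hbe, x, hx, hxN⟩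
  · refine Or.inr ((hbe.insert_pair (u := a) (v := c) fun h' => h'.2 hac).mono ?_)
    grind
  rcases h.orthRep_compl_pair_or hP.mem₁ hP.mem₃ hP.ne₁₃ with hac' | ⟨-, y, hy, hyN⟩
  · refine Or.inr ((hac'.insert_pair (u := b) (v := e) fun h' => h'.2 hbe).mono ?_)
    grind
  left
  have hxy : x ≠ y := by
    obtain ⟨p, hp, q, hq, hpq, hap, hbq⟩ := h.exists_matching hP.mem₁ hP.mem₂ hP.adj₁₂
    have h1 := (hyN p hp).1.mp hap
    have h2 := (hxN q hq).1.mp hbq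
    exact fun h' => hpq (by rw [h1, h2, h'])
  have h1 : OrthRep G (insert a (insert b (insert x (insert y ∅))) ∪ X \ {x, y}) 2 := by
    refine (((OrthRep.empty G 0).insert_pair (h.indep hx hy hxy)).insert_pair
      hP.adj₁₂.2).union_generic fun t ht => ?_
    rw [mem_sdiff, mem_insert, mem_singleton, not_or] at ht
    rw [card_eq_zero.mpr]
    refine filter_eq_empty_iff.mpr fun w hw htw => ?_
    have hX {z} (hz : z ∈ X) (htz : G.Adj t z) : False := h.indep ht.1 hz htz.ne htz
    simp only [mem_union, mem_insert, notMem_empty, or_false, mem_sdiff] at hw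
    rcases hw with (rfl | rfl | rfl | rfl) | hw
    · exact ht.2.2 ((hyN t ht.1).1.mp htw.symm)
    · exact ht.2.1 ((hxN t ht.1).1.mp htw.symm)
    · exact hX hx htw
    · exact hX hy htw
    · exact hX hw.1 htw
  have h2 := h1.insert_pair hP.adj₃₄.2
  have h3 : insert c (insert e (insert a (insert b (insert x (insert y ∅))) ∪ X \ {x, y})) =
      {a, b, c, e} ∪ X := by
    ext w
    simp only [mem_union, mem_insert, notMem_empty, or_false, mem_sdiff, mem_singleton]
    grind
  rw [h3] at h2
  refine h2.extend (union_subset (hP.subset.trans sdiff_subset) h.subset) ?_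
  rw [card_union_of_disjoint (disjoint_sdiff_self_left.mono_left hP.subset), hP.card_eq]
  omega

theorem orthRep_or_of_disjointNonedges (h : MaxHom G S X) (hS : #S = 2 * (#X + 1))
    (hP : DisjointNonedges G (S \ X) a b c e) :
    OrthRep G S (#X + 1) ∨ OrthRep Gᶜ S (#X + 1) := by
  by_cases hG : OrthRep G S (#X + 1)
  · exact Or.inl hG
  right
  have hno (a b c e) (hP : DisjointNonedges G (S \ X) a b c e) (p) (hp : p ∈ S \ X) (q)
      (hq : q ∈ S \ X) (hpq : Gᶜ.Adj p q) :
      p ∈ ({a, b, c, e} : Finset V) ∨ q ∈ ({a, b, c, e} : Finset V) := by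
    by_contra! hpqP
    exact hG (h.orthRep_of_three_disjoint_pairs hS hP hp hq hpq hpqP.1 hpqP.2)
  have hN (a b c e) (hP : DisjointNonedges G (S \ X) a b c e) (u) (hu : u ∈ S \ X)
      (huP : u ∉ ({a, b, c, e} : Finset V)) : 3 ≤ #{x ∈ X | G.Adj u x} := by
    by_contra! hlt
    exact hG (h.orthRep_of_card_le_two hS hP hu huP (Nat.le_of_lt_succ hlt))
  have hbad {a b c e u : V} := h.orthRep_compl_of_adj_three (a := a) (b := b) (c := c) (e := e)
    (u := u) hno hN
  have hperm {a' b' c' e' : V} (h' : ({a', b', c', e'} : Finset V) = {a, b, c, e}) {u : V}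
      (hu : u ∉ ({a, b, c, e} : Finset V)) : u ∉ ({a', b', c', e'} : Finset V) := h' ▸ hu
  have hs1 : ({c, e, a, b} : Finset V) = {a, b, c, e} := by
    ext; simp only [mem_insert, mem_singleton, or_comm, or_left_comm]
  have hs2 : ({a, b, e, c} : Finset V) = {a, b, c, e} := by
    ext; simp only [mem_insert, mem_singleton, or_comm]
  have hs3 : ({c, e, b, a} : Finset V) = {a, b, c, e} := by
    ext; simp only [mem_insert, mem_singleton, or_comm, or_left_comm]
  have hs4 : ({b, a, c, e} : Finset V) = {a, b, c, e} := by
    ext; simp only [mem_insert, mem_singleton, or_left_comm]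
  have hs5 : ({b, a, e, c} : Finset V) = {a, b, c, e} := by
    ext; simp only [mem_insert, mem_singleton, or_comm, or_left_comm]
  by_cases hcard : ∃ u ∈ S \ X, u ∉ ({a, b, c, e} : Finset V) ∧
      3 ≤ #{w ∈ ({a, b, c, e} : Finset V) | Gᶜ.Adj u w}
  · obtain ⟨u, hu, huP, hcard⟩ := hcard
    have hcases : (Gᶜ.Adj u a ∧ Gᶜ.Adj u b ∧ Gᶜ.Adj u c) ∨ (Gᶜ.Adj u a ∧ Gᶜ.Adj u b ∧ Gᶜ.Adj u e) ∨
        (Gᶜ.Adj u c ∧ Gᶜ.Adj u e ∧ Gᶜ.Adj u a) ∨ (Gᶜ.Adj u c ∧ Gᶜ.Adj u e ∧ Gᶜ.Adj u b) := by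
      have := three_le_card_filter hcard
      tauto
    rcases hcases with ⟨h1, h2, h3⟩ | ⟨h1, h2, h3⟩ | ⟨h1, h2, h3⟩ | ⟨h1, h2, h3⟩
    · exact hbad hP hu huP h1 h2 h3
    · exact hbad hP.swap_right hu (hperm hs2 huP) h1 h2 h3
    · exact hbad hP.swap hu (hperm hs1 huP) h1 h2 h3
    · exact hbad hP.swap.swap_right hu (hperm hs3 huP) h1 h2 h3
  push Not at hcard
  suffices hrep : OrthRep Gᶜ (X ∪ {a, b, c, e}) (#X + 1) by
    refine hrep.compl_extend h.subset (hP.subset.trans sdiff_subset) fun t ht htF =>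
      ⟨{w ∈ ({a, b, c, e} : Finset V) | Gᶜ.Adj t w}, fun w hw htw => ?_, ?_⟩
    · exact mem_filter.mpr ⟨(hno a b c e hP t ht w hw htw).resolve_left htF, htw⟩
    · have := hcard t ht htF
      have := hN a b c e hP t ht htF
      omega
  by_cases hac : G.Adj a c
  · exact (h.orthRep_or_of_adj hS hP hac).resolve_left hG
  by_cases hae : G.Adj a e
  · have := (h.orthRep_or_of_adj hS hP.swap_right hae).resolve_left hG
    rwa [hs2] at this
  by_cases hbc : G.Adj b c
  · have := (h.orthRep_or_of_adj hS hP.swap_left hbc).resolve_left hG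
    rwa [hs4] at this
  by_cases hbe : G.Adj b e
  · have := (h.orthRep_or_of_adj hS hP.swap_left.swap_right hbe).resolve_left hG
    rwa [hs5] at this
  refine (h.orthRep_compl hP.subset ?_).mono_dim (Nat.le_succ _)
  have hab := hP.adj₁₂.2
  have hce := hP.adj₃₄.2
  intro u hu v hv huv
  simp only [coe_insert, coe_singleton, Set.mem_insert_iff, Set.mem_singleton_iff] at hu hv
  grind [SimpleGraph.adj_comm]

theorem orthRep_or_of_card_eq_add_one (h : MaxHom G S X) (hS : #S = 2 * (#X + 1)) :
    OrthRep G S (#X + 1) ∨ OrthRep Gᶜ S (#X + 1) := by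
  by_cases h2 : ∃ a b c e, DisjointNonedges G (S \ X) a b c e
  · obtain ⟨a, b, c, e, hP⟩ := h2
    exact h.orthRep_or_of_disjointNonedges hS hP
  right
  have hno {a b c e} (ha : a ∈ S \ X) (hb : b ∈ S \ X) (hc : c ∈ S \ X) (he : e ∈ S \ X)
      (hab : Gᶜ.Adj a b) (hce : Gᶜ.Adj c e) : a = c ∨ a = e ∨ b = c ∨ b = e := by
    by_contra! hne
    exact h2 ⟨a, b, c, e, ha, hb, hc, he, hab, hce, hne.1, hne.2.1, hne.2.2.1, hne.2.2.2⟩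
  have hcard : #(S \ X) = #X + 2 := by
    rw [card_sdiff_of_subset h.subset]
    omega
  obtain ⟨a, ha, b, hb, hab⟩ := h.exists_compl_adj (T := S \ X) sdiff_subset (by omega)
  have hne {a b} (ha : a ∈ S \ X) (hb : b ∈ S \ X) (hab : Gᶜ.Adj a b) :
      ∃ w ∈ S \ X, w ≠ a ∧ Gᶜ.Adj b w := by
    obtain ⟨p, hp, q, hq, hpq⟩ := h.exists_compl_adj (T := (S \ X).erase a)
      ((erase_subset _ _).trans sdiff_subset) (by rw [card_erase_of_mem ha]; omega)
    rw [mem_erase] at hp hq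
    rcases hno ha hb hp.2 hq.2 hab hpq with rfl | rfl | rfl | rfl
    · exact absurd rfl hp.1
    · exact absurd rfl hq.1
    · exact ⟨q, hq.2, hq.1, hpq⟩
    · exact ⟨p, hp.2, hp.1, hpq.symm⟩
  obtain ⟨w, hw, hwa, hbw⟩ := hne ha hb hab
  have haw : Gᶜ.Adj a w := by
    obtain ⟨w', hw', hwb', haw'⟩ := hne hb ha hab.symm
    rcases hno ha hw' hb hw haw' hbw with rfl | rfl | rfl | rfl
    · exact absurd rfl hab.ne
    · exact absurd rfl hwa
    · exact absurd rfl hwb'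
    · exact haw'
  have hF : {a, b, w} ⊆ S \ X := by simp [insert_subset_iff, ha, hb, hw]
  refine ((h.orthRep_compl hF (SimpleGraph.isIndepSet_triple hab.2 haw.2 hbw.2)).mono_dim
    (Nat.le_succ _)).compl_extend h.subset (hF.trans sdiff_subset) fun t ht htF =>
      ⟨∅, fun v hv htv => ?_, ?_⟩
  · have h1 := hno ht hv ha hb htv hab
    have h2 := hno ht hv ha hw htv haw
    have h3 := hno ht hv hb hw htv hbw
    have := hab.ne
    have := haw.ne
    have := hbw.ne
    grind
  · have := h.one_le_card ht
    rw [card_empty]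
    omega

end MaxHom

section Sphere

variable {V : Type*} [DecidableEq V] {G : SimpleGraph V} {S X : Finset V} {d : ℕ}

theorem MaxHom.orthRep_or_of_add_two_le (h : MaxHom G S X) (hS : #S = 2 * (d + 2))
    (hX : #X ≤ d)
    (ih : ∀ S' ⊆ S, #S' = 2 * d → OrthRep G S' d ∨ OrthRep Gᶜ S' d) :
    OrthRep G S (d + 2) ∨ OrthRep Gᶜ S (d + 2) := by
  classical
  obtain ⟨r, hr, r', hr', hrr'⟩ := h.exists_compl_adj (T := S \ X) sdiff_subset (by
    rw [card_sdiff_of_subset h.subset]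
    omega)
  obtain ⟨x, hx, x', hx', hxx', hrx, hrx'⟩ := h.exists_matching hr hr' hrr'
  have hW : {r, r', x, x'} ⊆ S := by
    simp [insert_subset_iff, (mem_sdiff.mp hr).1, (mem_sdiff.mp hr').1, h.subset hx, h.subset hx']
  have hcard : #{r, r', x, x'} = 4 := by
    have h1 : r ≠ x' := fun h' => (mem_sdiff.mp hr).2 (h' ▸ hx')
    have h2 : r' ≠ x := fun h' => (mem_sdiff.mp hr').2 (h' ▸ hx)
    rw [card_insert_of_notMem (by simp [hrr'.ne, hrx.ne, h1]), card_eq_three.mpr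
      ⟨r', x, x', h2, hrx'.ne, hxx', rfl⟩]
  have hmem {w} (hw : w ∈ S) : w ∈ insert r (insert r' (insert x (insert x'
      (S \ {r, r', x, x'})))) := by
    simp only [mem_insert, mem_sdiff, hw, mem_singleton]
    tauto
  rcases ih (S \ {r, r', x, x'}) sdiff_subset (by
    rw [card_sdiff_of_subset hW, hcard]
    omega) with hG | hG
  · exact Or.inl (((hG.insert_pair (h.indep hx hx' hxx')).insert_pair hrr'.2).mono
      fun w hw => hmem hw)
  · refine Or.inr (((hG.insert_pair (u := r') (v := x') fun h' => h'.2 hrx').insert_pair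
      (u := r) (v := x) fun h' => h'.2 hrx).mono fun w hw => ?_)
    have := hmem hw
    simp only [mem_insert] at this ⊢
    tauto

theorem exists_maxHom_or_compl (G : SimpleGraph V) (S : Finset V) :
    ∃ X, MaxHom G S X ∨ MaxHom Gᶜ S X := by
  classical
  obtain ⟨X, hX, hmax⟩ := exists_max_image
    (S.powerset.filter fun T : Finset V => G.IsIndepSet T ∨ G.IsClique T) card
    ⟨∅, by simp [SimpleGraph.IsClique]⟩
  simp only [mem_filter, mem_powerset] at hX hmax
  have hb : HomBound G S #X := fun T hT hT' => hmax T ⟨hT, hT'⟩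
  exact ⟨X, hX.2.imp (fun h => ⟨hX.1, h, hb⟩) fun h =>
    ⟨hX.1, (SimpleGraph.isIndepSet_compl _).mpr h, hb.compl⟩⟩

/-- If `S` has `2 * d` vertices and contains no clique or independent set of more than `d`
vertices, then `G` or its complement has an orthogonal representation of `S` in dimension `d`. -/
theorem HomBound.orthRep_or (h : HomBound G S d) (hS : #S = 2 * d) :
    OrthRep G S d ∨ OrthRep Gᶜ S d := by
  classical
  induction d using Nat.strong_induction_on generalizing S with
  | _ d ih =>
    have key {G' : SimpleGraph V} {X : Finset V} (hb : HomBound G' S d) (hX : MaxHom G' S X)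
      (ih : ∀ S' ⊆ S, ∀ d' < d, #S' = 2 * d' → HomBound G' S' d' →
        OrthRep G' S' d' ∨ OrthRep G'ᶜ S' d') : OrthRep G' S d ∨ OrthRep G'ᶜ S d := by
      have hXd := hb X hX.subset (Or.inl hX.indep)
      obtain h0 | h1 | ⟨k, rfl, hk⟩ : d = #X ∨ d = #X + 1 ∨ ∃ k, d = k + 2 ∧ #X ≤ k := by
        by_cases h2 : #X + 2 ≤ d
        · exact Or.inr (Or.inr ⟨d - 2, by omega, by omega⟩)
        · omega
      · subst h0
        exact hX.orthRep_or_of_card_eq hS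
      · subst h1
        exact hX.orthRep_or_of_card_eq_add_one hS
      · exact hX.orthRep_or_of_add_two_le hS hk fun S' hS' hcard => ih S' hS' k (by omega) hcard
          fun T hT hT' => (hX.bound T (hT.trans hS') hT').trans hk
    obtain ⟨X, hX | hX⟩ := exists_maxHom_or_compl G S
    · exact key h hX fun S' _ d' hd' hcard hb => ih d' hd' hb hcard
    · have := key h.compl hX fun S' _ d' hd' hcard hb => by
        have := ih d' hd' (by simpa using hb.compl) hcard
        rw [compl_compl]
        exact this.symm
      rw [compl_compl] at this
      exact this.symm

end Sphere

theorem GraphRealizable.comap {V W : Type*} {G : SimpleGraph V} {G' : SimpleGraph W} {d : ℕ}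
    (h : GraphRealizable G' d) (φ : V ↪ W) (hφ : ∀ u v, G.Adj u v → G'.Adj (φ u) (φ v)) :
    GraphRealizable G d := by
  obtain ⟨f, hf, hd⟩ := h
  exact ⟨f ∘ φ, hf.comp φ.injective, fun u v huv => hd _ _ (hφ u v huv)⟩

theorem graphRealizable_or_compl_of_card_eq {V : Type*} [Fintype V] {d : ℕ} (G : SimpleGraph V)
    (hcard : Fintype.card V = 2 * d) : GraphRealizable G d ∨ GraphRealizable Gᶜ d := by
  classical
  by_cases hb : HomBound G univ d
  · exact (hb.orthRep_or (by rwa [card_univ])).imp OrthRep.graphRealizable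
      OrthRep.graphRealizable
  · simp only [HomBound, not_forall, not_le] at hb
    obtain ⟨T, -, hT, hdT⟩ := hb
    have hd : #Tᶜ + 1 ≤ d := by
      have := card_le_univ T
      rw [card_compl]
      omega
    exact hT.imp (graphRealizable_of_isIndepSet · hd) fun hT =>
      graphRealizable_of_isIndepSet ((SimpleGraph.isIndepSet_compl _).mpr hT) hd

theorem stmt_6 {V : Type*} [Fintype V] (d : ℕ) (hd : 1 ≤ d)
    (G : SimpleGraph V) (hcard : Fintype.card V ≤ 2 * d) :
    GraphRealizable G d ∨ GraphRealizable Gᶜ d := by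
  let φ : V ↪ V ⊕ Fin (2 * d - Fintype.card V) := Function.Embedding.inl
  have hφ (u v : V) : (G.map φ).Adj (φ u) (φ v) ↔ G.Adj u v := SimpleGraph.map_adj_apply
  refine (graphRealizable_or_compl_of_card_eq (d := d) (G.map φ) ?_).imp
    (fun h => h.comap φ fun u v huv => (hφ u v).mpr huv)
    (fun h => h.comap φ fun u v huv => ⟨φ.injective.ne huv.ne, fun h' => huv.2 ((hφ u v).mp h')⟩)
  rw [Fintype.card_sum, Fintype.card_fin]
  omega
end

section
/- Let G be a finite simple graph with maximum degree at most 2. Then there is an injective map f from the vertices of G to EuclideanSpace ℝ (Fin 3) with ‖f v‖ = 1/√2 for every vertex v and dist (f u) (f v) = 1 whenever u and v are adjacent in G, such that additionally: (1) there are no 3 distinct vertices a, b, c and a vertex w of G with dist (f w) (f a) = dist (f w) (f b) = dist (f w) (f c) = 1; and (2) whenever a, b, c, e are 4 distinct vertices whose images under f lie on a common circle, the set {a, b, c, e} can be written as {p, q} ∪ {r, s} where f p = −f q and f r = −f s, the vertices p and q are the two non-adjacent (opposite) vertices of a 4-cycle of G, and r and s are the two non-adjacent (opposite) vertices of a different 4-cycle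 of G. -/
/-- `{p, q}` is the pair of opposite (non-adjacent) vertices of a 4-cycle of `G` whose other
two (opposite) vertices are `x` and `y`: the four vertices are distinct and
`p x q y` is a cycle in `G`. -/
def OppPairIn4Cycle {V : Type*} (G : SimpleGraph V) (p q x y : V) : Prop :=
  p ≠ q ∧ p ≠ x ∧ p ≠ y ∧ q ≠ x ∧ q ≠ y ∧ x ≠ y ∧
    G.Adj p x ∧ G.Adj x q ∧ G.Adj q y ∧ G.Adj y p

section SphereGeometry

open Matrix Filter Topology

/-- Six times the signed volume of the tetrahedron with vertices `p`, `q`, `r`, `s`. -/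
def tetraVol (p q r s : Fin 3 → ℝ) : ℝ := (q - p) ⬝ᵥ (r - p) ⨯₃ (s - p)

/-- A finite set of unit vectors, closed under negation, in which no three pairwise non-parallel
vectors are linearly dependent and no four pairwise non-parallel vectors are coplanar. -/
structure GeneralPosition (S : Set (Fin 3 → ℝ)) : Prop where
  finite : S.Finite
  neg_mem : ∀ p ∈ S, -p ∈ S
  unit : ∀ p ∈ S, p ⬝ᵥ p = 1
  triple : ∀ p ∈ S, ∀ q ∈ S, ∀ r ∈ S, p ⨯₃ q ≠ 0 → p ⨯₃ r ≠ 0 → q ⨯₃ r ≠ 0 →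
    p ⬝ᵥ q ⨯₃ r ≠ 0
  quadruple : ∀ p ∈ S, ∀ q ∈ S, ∀ r ∈ S, ∀ s ∈ S,
    p ⨯₃ q ≠ 0 → p ⨯₃ r ≠ 0 → p ⨯₃ s ≠ 0 → q ⨯₃ r ≠ 0 → q ⨯₃ s ≠ 0 → r ⨯₃ s ≠ 0 →
    tetraVol p q r s ≠ 0

lemma tetraVol_rotate (p q r s : Fin 3 → ℝ) : tetraVol p q r s = -tetraVol q r s p := by
  simp only [tetraVol, cross_apply, vec3_dotProduct, Pi.sub_apply, cons_val]
  ring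

lemma tetraVol_neg (p q r s : Fin 3 → ℝ) :
    tetraVol (-p) (-q) (-r) (-s) = -tetraVol p q r s := by
  simp only [tetraVol, cross_apply, vec3_dotProduct, Pi.sub_apply, Pi.neg_apply, cons_val]
  ring

lemma tetraVol_eq (p q r s : Fin 3 → ℝ) :
    tetraVol p q r s = (q - p) ⨯₃ (r - p) ⬝ᵥ s - p ⬝ᵥ q ⨯₃ r := by
  simp only [tetraVol, cross_apply, vec3_dotProduct, Pi.sub_apply, cons_val]
  ring

lemma tetraVol_eq' (p q r s : Fin 3 → ℝ) :
    tetraVol p q r s = (q - p) ⬝ᵥ r ⨯₃ s + p ⨯₃ q ⬝ᵥ (s - r) := by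
  simp only [tetraVol, cross_apply, vec3_dotProduct, Pi.sub_apply, cons_val]
  ring

lemma cross_eq_zero_comm {p q : Fin 3 → ℝ} : p ⨯₃ q = 0 ↔ q ⨯₃ p = 0 := by
  rw [← cross_anticomm, neg_eq_zero]

lemma dotProduct_self_pos_of_ne {v : Fin 3 → ℝ} (hv : v ≠ 0) : 0 < v ⬝ᵥ v := by
  have h0 : 0 ≤ v ⬝ᵥ v := by
    rw [vec3_dotProduct]
    exact add_nonneg (add_nonneg (mul_self_nonneg _) (mul_self_nonneg _)) (mul_self_nonneg _)
  exact lt_of_le_of_ne h0 fun h ↦ hv (dotProduct_self_eq_zero.1 h.symm)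

lemma eq_smul_of_cross_eq_zero {v n : Fin 3 → ℝ} (hn : n ⬝ᵥ n = 1) (h : v ⨯₃ n = 0) :
    v = (v ⬝ᵥ n) • n := by
  have h0 := congrFun h 0
  have h1 := congrFun h 1
  have h2 := congrFun h 2
  simp only [cross_apply, cons_val, Pi.zero_apply] at h0 h1 h2
  rw [vec3_dotProduct] at hn
  ext i
  fin_cases i <;> simp [vec3_dotProduct] 
  · linear_combination (-v 0) * hn + n 1 * h2 - n 2 * h1
  · linear_combination (-v 1) * hn - n 0 * h2 + n 2 * h0
  · linear_combination (-v 2) * hn + n 0 * h1 - n 1 * h0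

lemma eq_or_eq_neg_of_cross_eq_zero {p q : Fin 3 → ℝ} (hp : p ⬝ᵥ p = 1) (hq : q ⬝ᵥ q = 1)
    (h : p ⨯₃ q = 0) : p = q ∨ p = -q := by
  have h1 := eq_smul_of_cross_eq_zero hq h
  have h2 : (p ⬝ᵥ q) * (p ⬝ᵥ q) = 1 := by
    rw [h1, smul_dotProduct, dotProduct_smul, hq] at hp
    simpa using hp
  rcases mul_self_eq_one_iff.1 h2 with h | h <;> rw [h] at h1
  · left; simpa using h1
  · right; simpa using h1

lemma cross_ne_zero_of_dotProduct_ne {p x : Fin 3 → ℝ} (hp : p ⬝ᵥ p = 1) (hx : x ⬝ᵥ x = 1)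
    (h1 : p ⬝ᵥ x ≠ 1) (h2 : -p ⬝ᵥ x ≠ 1) : p ⨯₃ x ≠ 0 := by
  intro h
  rcases eq_or_eq_neg_of_cross_eq_zero hp hx h with rfl | rfl
  · exact h1 hx
  · simp [hx] at h2

/-- `GeneralPosition` after adjoining a line spanned by a new unit vector. -/
lemma GeneralPosition.insert_pair {S : Set (Fin 3 → ℝ)} (hS : GeneralPosition S) {x : Fin 3 → ℝ}
    (hx : x ⬝ᵥ x = 1)
    (h3 : ∀ p ∈ S, ∀ q ∈ S, p ⨯₃ q ≠ 0 → p ⨯₃ q ⬝ᵥ x ≠ 0)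
    (h4 : ∀ p ∈ S, ∀ q ∈ S, ∀ r ∈ S, p ⨯₃ q ≠ 0 → p ⨯₃ r ≠ 0 → q ⨯₃ r ≠ 0 →
      tetraVol p q r x ≠ 0) :
    GeneralPosition (insert x (insert (-x) S)) := by
  have key : ∀ p ∈ (insert x (insert (-x) S) : Set (Fin 3 → ℝ)), (p = x ∨ p = -x) ∨ p ∈ S := by
    intro p hp
    simpa [or_assoc] using hp
  have par : ∀ p q : Fin 3 → ℝ, (p = x ∨ p = -x) → (q = x ∨ q = -x) → p ⨯₃ q = 0 := by
    rintro p q (rfl | rfl) (rfl | rfl) <;> simp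
  have h3' : ∀ y : Fin 3 → ℝ, (y = x ∨ y = -x) → ∀ p ∈ S, ∀ q ∈ S, p ⨯₃ q ≠ 0 →
      y ⬝ᵥ p ⨯₃ q ≠ 0 := by
    rintro y (rfl | rfl) p hp q hq hpq
    · rw [dotProduct_comm]; exact h3 p hp q hq hpq
    · rw [neg_dotProduct, dotProduct_comm]; exact neg_ne_zero.2 (h3 p hp q hq hpq)
  have h4' : ∀ y : Fin 3 → ℝ, (y = x ∨ y = -x) → ∀ p ∈ S, ∀ q ∈ S, ∀ r ∈ S, p ⨯₃ q ≠ 0 →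
      p ⨯₃ r ≠ 0 → q ⨯₃ r ≠ 0 → tetraVol p q r y ≠ 0 := by
    rintro y (rfl | rfl) p hp q hq r hr hpq hpr hqr
    · exact h4 p hp q hq r hr hpq hpr hqr
    · have := h4 (-p) (hS.neg_mem p hp) (-q) (hS.neg_mem q hq) (-r) (hS.neg_mem r hr)
        (by simpa using hpq) (by simpa using hpr) (by simpa using hqr)
      rw [← neg_neg x, tetraVol_neg, neg_ne_zero] at this
      exact this
  constructor
  · exact (hS.finite.insert _).insert _
  · intro p hp
    rcases key p hp with (rfl | rfl) | h
    · simp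
    · simp
    · simp [hS.neg_mem p h]
  · intro p hp
    rcases key p hp with (rfl | rfl) | h
    · exact hx
    · simpa using hx
    · exact hS.unit p h
  · intro p hp q hq r hr hpq hpr hqr
    rcases key p hp with hp | hp <;> rcases key q hq with hq | hq <;>
      rcases key r hr with hr | hr
    any_goals first
      | exact absurd (par _ _ hp hq) hpq
      | exact absurd (par _ _ hp hr) hpr
      | exact absurd (par _ _ hq hr) hqr
      | skip
    · exact h3' p hp q hq r hr hqr
    · rw [triple_product_permutation]
      exact h3' q hq r hr p hp (mt cross_eq_zero_comm.1 hpr)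
    · rw [← triple_product_permutation]
      exact h3' r hr p hp q hq hpq
    · exact hS.triple p hp q hq r hr hpq hpr hqr
  · intro p hp q hq r hr s hs hpq hpr hps hqr hqs hrs
    have c := @cross_eq_zero_comm
    rcases key p hp with hp | hp <;> rcases key q hq with hq | hq <;>
      rcases key r hr with hr | hr <;> rcases key s hs with hs | hs
    any_goals first
      | exact absurd (par _ _ hp hq) hpq
      | exact absurd (par _ _ hp hr) hpr
      | exact absurd (par _ _ hp hs) hps
      | exact absurd (par _ _ hq hr) hqr
      | exact absurd (par _ _ hq hs) hqs
      | exact absurd (par _ _ hr hs) hrs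
      | skip
    · rw [tetraVol_rotate, neg_ne_zero]
      exact h4' p hp q hq r hr s hs hqr hqs hrs
    · rw [tetraVol_rotate, tetraVol_rotate, neg_neg]
      exact h4' q hq r hr s hs p hp hrs (mt c.1 hpr) (mt c.1 hps)
    · rw [tetraVol_rotate, tetraVol_rotate, tetraVol_rotate, neg_neg, neg_ne_zero]
      exact h4' r hr s hs p hp q hq (mt c.1 hps) (mt c.1 hqs) hpq
    · exact h4' s hs p hp q hq r hr hpq hpr hqr
    · exact hS.quadruple p hp q hq r hr s hs hpq hpr hps hqr hqs hrs

lemma eventually_ne_of_analytic {F : ℝ → ℝ} (hF : AnalyticOnNhd ℝ F Set.univ) {t : ℝ}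
    (ht : F t ≠ 0) : ∀ᶠ s in 𝓝[≠] (0 : ℝ), F s ≠ 0 := by
  by_contra h
  have h0 : ∃ᶠ s in 𝓝[≠] (0 : ℝ), F s = 0 := by simpa using not_eventually.1 h
  exact ht (hF.eqOn_zero_of_preconnected_of_frequently_eq_zero isPreconnected_univ
    (Set.mem_univ _) h0 (Set.mem_univ t))

/-- A curve in `ℝ³` with real-analytic coordinates. -/
def AnalyticCurve (x : ℝ → Fin 3 → ℝ) : Prop :=
  ∀ i, AnalyticOnNhd ℝ (fun t ↦ x t i) Set.univ

lemma analyticCurve_const (v : Fin 3 → ℝ) : AnalyticCurve fun _ ↦ v :=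
  fun _ ↦ analyticOnNhd_const

lemma AnalyticCurve.sub {x y : ℝ → Fin 3 → ℝ} (hx : AnalyticCurve x) (hy : AnalyticCurve y) :
    AnalyticCurve fun t ↦ x t - y t :=
  fun i ↦ (hx i).sub (hy i)

lemma AnalyticCurve.smul {a : ℝ → ℝ} {x : ℝ → Fin 3 → ℝ} (ha : AnalyticOnNhd ℝ a Set.univ)
    (hx : AnalyticCurve x) : AnalyticCurve fun t ↦ a t • x t :=
  fun i ↦ ha.mul (hx i)

lemma AnalyticCurve.dotProduct {x y : ℝ → Fin 3 → ℝ} (hx : AnalyticCurve x)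
    (hy : AnalyticCurve y) : AnalyticOnNhd ℝ (fun t ↦ x t ⬝ᵥ y t) Set.univ := by
  simp only [vec3_dotProduct]
  exact (((hx 0).mul (hy 0)).add ((hx 1).mul (hy 1))).add ((hx 2).mul (hy 2))

lemma AnalyticCurve.cross {x y : ℝ → Fin 3 → ℝ} (hx : AnalyticCurve x) (hy : AnalyticCurve y) :
    AnalyticCurve fun t ↦ x t ⨯₃ y t := by
  intro i
  fin_cases i
  · exact ((hx 1).mul (hy 2)).sub ((hx 2).mul (hy 1))
  · exact ((hx 2).mul (hy 0)).sub ((hx 0).mul (hy 2))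
  · exact ((hx 0).mul (hy 1)).sub ((hx 1).mul (hy 0))

lemma AnalyticCurve.tetraVol {x y z w : ℝ → Fin 3 → ℝ} (hx : AnalyticCurve x)
    (hy : AnalyticCurve y) (hz : AnalyticCurve z) (hw : AnalyticCurve w) :
    AnalyticOnNhd ℝ (fun t ↦ tetraVol (x t) (y t) (z t) (w t)) Set.univ :=
  (hy.sub hx).dotProduct ((hz.sub hx).cross (hw.sub hx))

/-- A generic point of a curve on the unit sphere can be adjoined to a set in general position,
provided that no affine plane of the relevant kind contains the whole curve. The predicate `Q`
describes the normals of the planes through the origin that do not contain the curve. -/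
lemma GeneralPosition.eventually_insert {S : Set (Fin 3 → ℝ)} (hS : GeneralPosition S)
    {x : ℝ → Fin 3 → ℝ} (hx : AnalyticCurve x) (hunit : ∀ t, x t ⬝ᵥ x t = 1)
    (Q : (Fin 3 → ℝ) → Prop) (hQ : ∀ α β, Q α ∨ β ≠ 0 → ∃ t, α ⬝ᵥ x t ≠ β)
    (hSQ : ∀ p ∈ S, ∀ q ∈ S, p ⨯₃ q ≠ 0 → Q (p ⨯₃ q)) :
    ∀ᶠ t in 𝓝[≠] (0 : ℝ), (∀ p ∈ S, p ⬝ᵥ x t ≠ 1) ∧ (∀ p ∈ S, Q p → p ⬝ᵥ x t ≠ 0) ∧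
      GeneralPosition (insert (x t) (insert (-x t) S)) := by
  have ev : ∀ α β, Q α ∨ β ≠ 0 → ∀ᶠ t in 𝓝[≠] (0 : ℝ), α ⬝ᵥ x t ≠ β := by
    intro α β h
    obtain ⟨t, ht⟩ := hQ α β h
    have := eventually_ne_of_analytic
      (((analyticCurve_const α).dotProduct hx).sub (analyticOnNhd_const (v := β)))
      (t := t) (sub_ne_zero.2 ht)
    filter_upwards [this] with s hs
    exact sub_ne_zero.1 hs
  have e1 : ∀ᶠ t in 𝓝[≠] (0 : ℝ), ∀ p ∈ S, p ⬝ᵥ x t ≠ 1 :=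
    (eventually_all_finite hS.finite).2 fun p _ ↦ ev p 1 (Or.inr one_ne_zero)
  have e2 : ∀ᶠ t in 𝓝[≠] (0 : ℝ), ∀ p ∈ S, Q p → p ⬝ᵥ x t ≠ 0 :=
    (eventually_all_finite hS.finite).2 fun p _ ↦ by
      by_cases h : Q p
      · simpa [h] using ev p 0 (Or.inl h)
      · simp [h]
  have e3 : ∀ᶠ t in 𝓝[≠] (0 : ℝ), ∀ p ∈ S, ∀ q ∈ S, p ⨯₃ q ≠ 0 → p ⨯₃ q ⬝ᵥ x t ≠ 0 :=
    (eventually_all_finite hS.finite).2 fun p hp ↦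
      (eventually_all_finite hS.finite).2 fun q hq ↦
        eventually_imp_distrib_left.2 fun h ↦ ev _ 0 (Or.inl (hSQ p hp q hq h))
  have e4 : ∀ᶠ t in 𝓝[≠] (0 : ℝ), ∀ p ∈ S, ∀ q ∈ S, ∀ r ∈ S, p ⨯₃ q ≠ 0 → p ⨯₃ r ≠ 0 →
      q ⨯₃ r ≠ 0 → tetraVol p q r (x t) ≠ 0 :=
    (eventually_all_finite hS.finite).2 fun p hp ↦
      (eventually_all_finite hS.finite).2 fun q hq ↦
        (eventually_all_finite hS.finite).2 fun r hr ↦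
          eventually_imp_distrib_left.2 fun h ↦ eventually_imp_distrib_left.2 fun h' ↦
            eventually_imp_distrib_left.2 fun h'' ↦ by
              filter_upwards [ev ((q - p) ⨯₃ (r - p)) (p ⬝ᵥ q ⨯₃ r)
                (Or.inr (hS.triple p hp q hq r hr h h' h''))] with t ht
              rw [tetraVol_eq]
              exact sub_ne_zero.2 ht
  filter_upwards [e1, e2, e3, e4] with t h1 h2 h3 h4
  exact ⟨h1, h2, hS.insert_pair (hunit t) h3 h4⟩

lemma exists_orthogonal_unit (n : Fin 3 → ℝ) :
    ∃ u : Fin 3 → ℝ, u ⬝ᵥ u = 1 ∧ n ⬝ᵥ u = 0 := by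
  have : ∃ v : Fin 3 → ℝ, v ≠ 0 ∧ n ⬝ᵥ v = 0 := by
    by_cases h : n 0 = 0
    · refine ⟨![1, 0, 0], fun h' ↦ by simpa using congrFun h' 0, ?_⟩
      simp only [vec3_dotProduct, cons_val, h]
      ring
    · refine ⟨![-n 1, n 0, 0], fun h' ↦ h (by simpa using congrFun h' 1), ?_⟩
      simp only [vec3_dotProduct, cons_val]
      ring
  obtain ⟨v, hv, hnv⟩ := this
  have hpos := dotProduct_self_pos_of_ne hv
  refine ⟨(√(v ⬝ᵥ v))⁻¹ • v, ?_, by simp [hnv]⟩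
  have := Real.mul_self_sqrt hpos.le
  have := (Real.sqrt_pos.2 hpos).ne'
  simp only [smul_dotProduct, dotProduct_smul, smul_eq_mul]
  field_simp
  linarith

/-- An analytic parametrization of the great circle orthogonal to a unit vector `n`. -/
lemma exists_great_circle {n : Fin 3 → ℝ} (hn : n ⬝ᵥ n = 1) :
    ∃ x : ℝ → Fin 3 → ℝ, AnalyticCurve x ∧ (∀ t, x t ⬝ᵥ x t = 1) ∧ (∀ t, n ⬝ᵥ x t = 0) ∧
      (∀ t, x (t + Real.pi) = -x t) ∧
      (∀ α, α ⨯₃ n ≠ 0 → ∃ t, α ⬝ᵥ x t ≠ 0) ∧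
      (∀ v y, v ≠ 0 → n ⬝ᵥ y ≠ 0 → y ⨯₃ n ≠ 0 → ∃ t, v ⬝ᵥ y ≠ (v ⬝ᵥ x t) * (x t ⬝ᵥ y)) := by
  obtain ⟨u, hu, hnu⟩ := exists_orthogonal_unit n
  set w := n ⨯₃ u with hw
  have hww : w ⬝ᵥ w = 1 := by
    rw [hw, cross_dot_cross, hn, hu, hnu, dotProduct_comm u n, hnu]; norm_num
  have huw : u ⬝ᵥ w = 0 := by simp [hw]
  have hnw : n ⬝ᵥ w = 0 := by simp [hw]
  have span : ∀ α : Fin 3 → ℝ, α ⬝ᵥ u = 0 → α ⬝ᵥ w = 0 → α ⨯₃ n = 0 := by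
    intro α h1 h2
    have e : (α ⨯₃ n) ⬝ᵥ (α ⨯₃ n) = (α ⬝ᵥ u) ^ 2 + (α ⬝ᵥ w) ^ 2 := by
      have c0 : α ⨯₃ n ⨯₃ w = (α ⬝ᵥ w) • n - (n ⬝ᵥ w) • α := cross_cross_eq_smul_sub_smul _ _ _
      have c1 : α ⨯₃ n ⨯₃ w = 0 := by rw [c0, h2, hnw]; simp
      have c2 : α ⨯₃ n ⬝ᵥ w = 0 := by rw [hw, cross_dot_cross, hnu, h1]; ring
      have c3 := cross_dot_cross (α ⨯₃ n) w (α ⨯₃ n) w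
      rw [c1, c2, hww] at c3
      simp only [dotProduct_zero, mul_one, zero_mul, sub_zero] at c3
      rw [← c3, h1, h2]; ring
    rw [h1, h2] at e
    exact dotProduct_self_eq_zero.1 (by simpa using e)
  have hdot : ∀ (α : Fin 3 → ℝ) t, α ⬝ᵥ (Real.cos t • u + Real.sin t • w) =
      Real.cos t * (α ⬝ᵥ u) + Real.sin t * (α ⬝ᵥ w) := by
    intro α t
    simp [dotProduct_add]
  refine ⟨fun t ↦ Real.cos t • u + Real.sin t • w, ?_, ?_, ?_, ?_, ?_, ?_⟩
  · intro i
    exact (Real.analyticOnNhd_cos.mul analyticOnNhd_const).add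
      (Real.analyticOnNhd_sin.mul analyticOnNhd_const)
  · intro t
    rw [hdot]
    simp only [add_dotProduct, smul_dotProduct, hu, hww, huw, dotProduct_comm w u, smul_eq_mul]
    linear_combination Real.cos_sq_add_sin_sq t
  · intro t
    rw [hdot, hnu, hnw]; ring
  · intro t
    simp only [Real.cos_add_pi, Real.sin_add_pi, neg_smul, neg_add]
  · intro α hα
    by_contra! h
    refine hα (span α ?_ ?_)
    · simpa using h 0
    · simpa using h (Real.pi / 2)
  · intro v y hv hny hyn
    by_contra! h
    have h' : ∀ t, v ⬝ᵥ y = (Real.cos t * (v ⬝ᵥ u) + Real.sin t * (v ⬝ᵥ w)) *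
        (Real.cos t * (y ⬝ᵥ u) + Real.sin t * (y ⬝ᵥ w)) := by
      intro t
      rw [h t, hdot, dotProduct_comm _ y, hdot]
    have h0 := h' 0
    have h1 := h' (Real.pi / 2)
    have h2 := h' (Real.pi / 4)
    simp only [Real.cos_zero, Real.sin_zero, Real.cos_pi_div_two,
      Real.sin_pi_div_two, Real.cos_pi_div_four, Real.sin_pi_div_four] at h0 h1 h2
    have hs : √2 * √2 = (2 : ℝ) := Real.mul_self_sqrt (by norm_num)
    have h3 : (v ⬝ᵥ u) * (y ⬝ᵥ w) + (v ⬝ᵥ w) * (y ⬝ᵥ u) = 0 := by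
      linear_combination (-2) * h2 + h0 + h1 -
        (v ⬝ᵥ u + v ⬝ᵥ w) * (y ⬝ᵥ u + y ⬝ᵥ w) / 2 * hs
    set K := v ⬝ᵥ y
    have hK : K * ((y ⬝ᵥ u) ^ 2 + (y ⬝ᵥ w) ^ 2) = 0 := by
      linear_combination (y ⬝ᵥ w) ^ 2 * h0 + (y ⬝ᵥ u) ^ 2 * h1 + (y ⬝ᵥ u) * (y ⬝ᵥ w) * h3
    have hy : (y ⬝ᵥ u) ^ 2 + (y ⬝ᵥ w) ^ 2 ≠ 0 := by
      intro h
      refine hyn (span y ?_ ?_) <;> nlinarith [sq_nonneg (y ⬝ᵥ u), sq_nonneg (y ⬝ᵥ w)]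
    have hK0 : K = 0 := (mul_eq_zero.1 hK).resolve_right hy
    have hvu : v ⬝ᵥ u * ((y ⬝ᵥ u) ^ 2 + (y ⬝ᵥ w) ^ 2) = 0 := by
      linear_combination (-(y ⬝ᵥ u)) * h0 + (y ⬝ᵥ w) * h3 + (y ⬝ᵥ u) * h1
    have hvw : v ⬝ᵥ w * ((y ⬝ᵥ u) ^ 2 + (y ⬝ᵥ w) ^ 2) = 0 := by
      linear_combination (y ⬝ᵥ w) * h0 + (y ⬝ᵥ u) * h3 - (y ⬝ᵥ w) * h1
    have hvn := eq_smul_of_cross_eq_zero hn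
      (span v ((mul_eq_zero.1 hvu).resolve_right hy) ((mul_eq_zero.1 hvw).resolve_right hy))
    have hK' : (v ⬝ᵥ n) * (n ⬝ᵥ y) = 0 := by
      have : v ⬝ᵥ y = 0 := hK0
      rwa [hvn, smul_dotProduct, smul_eq_mul] at this
    rw [(mul_eq_zero.1 hK').resolve_right hny, zero_smul] at hvn
    exact hv hvn

/-- A generic point of the unit sphere can be adjoined to a set in general position. -/
lemma GeneralPosition.exists_insert {S : Set (Fin 3 → ℝ)} (hS : GeneralPosition S) :
    ∃ x : Fin 3 → ℝ, x ⬝ᵥ x = 1 ∧ (∀ p ∈ S, p ⬝ᵥ x ≠ 1) ∧ (∀ p ∈ S, p ⬝ᵥ x ≠ 0) ∧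
      GeneralPosition (insert x (insert (-x) S)) := by
  let x : ℝ → Fin 3 → ℝ := fun t ↦ ![Real.cos t * Real.cos t, Real.cos t * Real.sin t, Real.sin t]
  have hx : AnalyticCurve x := by
    intro i
    fin_cases i
    · exact Real.analyticOnNhd_cos.mul Real.analyticOnNhd_cos
    · exact Real.analyticOnNhd_cos.mul Real.analyticOnNhd_sin
    · exact Real.analyticOnNhd_sin
  have hunit : ∀ t, x t ⬝ᵥ x t = 1 := by
    intro t
    simp only [x, vec3_dotProduct, cons_val]
    linear_combination (Real.cos t ^ 2 + 1) * Real.cos_sq_add_sin_sq t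
  have hQ : ∀ (α : Fin 3 → ℝ) (β : ℝ), α ≠ 0 ∨ β ≠ 0 → ∃ t, α ⬝ᵥ x t ≠ β := by
    intro α β h
    by_contra! h'
    have h0 := h' 0
    have h1 := h' (Real.pi / 2)
    have h2 := h' (-(Real.pi / 2))
    have h3 := h' (Real.pi / 4)
    simp only [x, vec3_dotProduct, cons_val] at h0 h1 h2 h3
    simp at h0 h1 h2 h3
    have hβ : β = 0 := by linarith
    have hs : √2 * √2 = (2 : ℝ) := Real.mul_self_sqrt (by norm_num)
    have ha0 : α 0 = 0 := by linarith
    have ha2 : α 2 = 0 := by linarith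
    have ha1 : α 1 = 0 := by
      rw [ha0, ha2, hβ] at h3
      linear_combination 2 * h3 - α 1 / 2 * hs
    rcases h with h | h
    · refine h (funext fun i ↦ ?_)
      fin_cases i <;> assumption
    · exact h hβ
  obtain ⟨t, h1, h2, h3⟩ := (hS.eventually_insert hx hunit (fun α ↦ α ≠ 0) hQ
    fun _ _ _ _ h ↦ h).exists
  refine ⟨x t, hunit t, h1, fun p hp ↦ h2 p hp ?_, h3⟩
  rintro rfl
  simpa using hS.unit 0 hp

lemma cross_cross_ne_zero {p q n : Fin 3 → ℝ} (hpq : p ⨯₃ q ≠ 0)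
    (h : p ⬝ᵥ n = 0 → q ⬝ᵥ n = 0 → False) : p ⨯₃ q ⨯₃ n ≠ 0 := by
  intro h0
  rw [cross_cross_eq_smul_sub_smul] at h0
  have h1 : (p ⬝ᵥ n) • (p ⨯₃ q) = 0 := by
    simpa using congrArg (p ⨯₃ ·) h0
  have h2 : (q ⬝ᵥ n) • (p ⨯₃ q) = 0 := by
    have := congrArg (· ⨯₃ q) h0
    simpa using this
  exact h ((smul_eq_zero.1 h1).resolve_right hpq) ((smul_eq_zero.1 h2).resolve_right hpq)

/-- A generic point of the great circle orthogonal to `n` can be adjoined to a set in general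
position, provided that no two lines of that set are orthogonal to `n`. -/
lemma GeneralPosition.exists_insert_orthogonal {S : Set (Fin 3 → ℝ)} (hS : GeneralPosition S)
    {n : Fin 3 → ℝ} (hn : n ∈ S)
    (hperp : ∀ p ∈ S, ∀ q ∈ S, p ⨯₃ q ≠ 0 → p ⬝ᵥ n = 0 → q ⬝ᵥ n = 0 → False) :
    ∃ x : Fin 3 → ℝ, x ⬝ᵥ x = 1 ∧ n ⬝ᵥ x = 0 ∧ (∀ p ∈ S, p ⬝ᵥ x ≠ 1) ∧
      (∀ p ∈ S, p ⨯₃ n ≠ 0 → p ⬝ᵥ x ≠ 0) ∧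
      GeneralPosition (insert x (insert (-x) S)) := by
  obtain ⟨x, hx, hunit, hnx, hπ, hc, -⟩ := exists_great_circle (hS.unit n hn)
  have hQ : ∀ (α : Fin 3 → ℝ) (β : ℝ), α ⨯₃ n ≠ 0 ∨ β ≠ 0 → ∃ t, α ⬝ᵥ x t ≠ β := by
    intro α β h
    by_cases hβ : β = 0
    · subst hβ
      exact hc α (h.resolve_right fun h ↦ h rfl)
    · by_contra! h'
      have h1 := h' (0 + Real.pi)
      rw [hπ, dotProduct_neg, h' 0] at h1
      exact hβ (by linarith)
  obtain ⟨t, h1, h2, h3⟩ := (hS.eventually_insert hx hunit (fun α ↦ α ⨯₃ n ≠ 0) hQ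
    fun p hp q hq h ↦ cross_cross_ne_zero h (hperp p hp q hq h)).exists
  exact ⟨x t, hunit t, hnx t, h1, h2, h3⟩

lemma tetraVol_swap (p q r s : Fin 3 → ℝ) : tetraVol p q r s = -tetraVol p r q s := by
  simp only [tetraVol, cross_apply, vec3_dotProduct, Pi.sub_apply, cons_val]
  ring

/-- Adjoining two lines spanned by unit vectors `x` and `m`, when each of them can be adjoined
separately. -/
lemma GeneralPosition.insert_two_pairs {S : Set (Fin 3 → ℝ)} (hS : GeneralPosition S)
    {x m : Fin 3 → ℝ} (hm : m ⬝ᵥ m = 1)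
    (hSx : GeneralPosition (insert x (insert (-x) S)))
    (hSm : GeneralPosition (insert m (insert (-m) S)))
    (hpm : ∀ p ∈ S, p ⨯₃ m ≠ 0)
    (h3 : ∀ p ∈ S, p ⬝ᵥ x ⨯₃ m ≠ 0)
    (h4 : ∀ p ∈ S, ∀ q ∈ S, p ⨯₃ q ≠ 0 → tetraVol p q x m ≠ 0 ∧ tetraVol p q x (-m) ≠ 0) :
    GeneralPosition (insert m (insert (-m) (insert x (insert (-x) S)))) := by
  have key : ∀ p ∈ (insert x (insert (-x) S) : Set (Fin 3 → ℝ)), (p = x ∨ p = -x) ∨ p ∈ S := by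
    intro p hp
    simpa [or_assoc] using hp
  have par : ∀ p q : Fin 3 → ℝ, (p = x ∨ p = -x) → (q = x ∨ q = -x) → p ⨯₃ q = 0 := by
    rintro p q (rfl | rfl) (rfl | rfl) <;> simp
  have memS : ∀ p ∈ S, p ∈ insert m (insert (-m) S) := fun p hp ↦ Or.inr (Or.inr hp)
  have memm : m ∈ insert m (insert (-m) S) := Or.inl rfl
  have h3' : ∀ y, (y = x ∨ y = -x) → ∀ p ∈ S, p ⬝ᵥ y ⨯₃ m ≠ 0 := by
    rintro y (rfl | rfl) p hp
    · exact h3 p hp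
    · rw [map_neg, LinearMap.neg_apply, dotProduct_neg, neg_ne_zero]
      exact h3 p hp
  have h4' : ∀ y, (y = x ∨ y = -x) → ∀ p ∈ S, ∀ q ∈ S, p ⨯₃ q ≠ 0 → tetraVol p q y m ≠ 0 := by
    rintro y (rfl | rfl) p hp q hq hpq
    · exact (h4 p hp q hq hpq).1
    · have := (h4 (-p) (hS.neg_mem p hp) (-q) (hS.neg_mem q hq) (by simpa using hpq)).2
      rw [← neg_neg x, tetraVol_neg, neg_ne_zero] at this
      exact this
  refine hSx.insert_pair hm ?_ ?_
  · intro p hp q hq hpq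
    rcases key p hp with hp | hp <;> rcases key q hq with hq | hq
    · exact absurd (par _ _ hp hq) hpq
    · rw [dotProduct_comm, triple_product_permutation, triple_product_permutation,
        ← cross_anticomm, dotProduct_neg, neg_ne_zero]
      exact h3' p hp q hq
    · rw [dotProduct_comm, triple_product_permutation]
      exact h3' q hq p hp
    · rw [dotProduct_comm, triple_product_permutation]
      exact hSm.triple p (memS p hp) q (memS q hq) m memm hpq (hpm p hp) (hpm q hq)
  · intro p hp q hq r hr hpq hpr hqr
    rcases key p hp with hp | hp <;> rcases key q hq with hq | hq <;>
      rcases key r hr with hr | hr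
    any_goals first
      | exact absurd (par _ _ hp hq) hpq
      | exact absurd (par _ _ hp hr) hpr
      | exact absurd (par _ _ hq hr) hqr
      | skip
    · have e : tetraVol p q r m = tetraVol q r p m := by
        simp only [tetraVol, cross_apply, vec3_dotProduct, Pi.sub_apply, cons_val]
        ring
      rw [e]
      exact h4' p hp q hq r hr hqr
    · rw [tetraVol_swap, neg_ne_zero]
      exact h4' q hq p hp r hr hpr
    · exact h4' r hr p hp q hq hpq
    · exact hSm.quadruple p (memS p hp) q (memS q hq) r (memS r hr) m memm hpq hpr (hpm p hp)
        hqr (hpm q hq) (hpm r hr)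

/-- Two orthogonal generic unit vectors `x ⟂ n` and `m ⟂ y` can be adjoined to a set in general
position containing `n` and `y`. -/
lemma GeneralPosition.exists_insert_two {S : Set (Fin 3 → ℝ)} (hS : GeneralPosition S)
    {n y : Fin 3 → ℝ} (hn : n ∈ S) (hy : y ∈ S)
    (hny : n ⬝ᵥ y ≠ 0)
    (hcase : (y = n ∧ ∀ p ∈ S, p ⬝ᵥ n ≠ 0) ∨ y ⨯₃ n ≠ 0)
    (hpn : ∀ p ∈ S, ∀ q ∈ S, p ⨯₃ q ≠ 0 → p ⬝ᵥ n = 0 → q ⬝ᵥ n = 0 → False)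
    (hpy : ∀ p ∈ S, ∀ q ∈ S, p ⨯₃ q ≠ 0 → p ⬝ᵥ y = 0 → q ⬝ᵥ y = 0 → False) :
    ∃ x m : Fin 3 → ℝ, x ⬝ᵥ x = 1 ∧ m ⬝ᵥ m = 1 ∧ n ⬝ᵥ x = 0 ∧ y ⬝ᵥ m = 0 ∧ x ⬝ᵥ m = 0 ∧
      (∀ p ∈ S, p ⬝ᵥ x ≠ 1) ∧ (∀ p ∈ S, p ⨯₃ n ≠ 0 → p ⬝ᵥ x ≠ 0) ∧
      (∀ p ∈ S, p ⬝ᵥ m ≠ 1) ∧ (∀ p ∈ S, p ⨯₃ y ≠ 0 → p ⬝ᵥ m ≠ 0) ∧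
      GeneralPosition (insert x (insert (-x) S)) ∧
      GeneralPosition (insert m (insert (-m) (insert x (insert (-x) S)))) := by
  have hnn := hS.unit n hn
  have hyy := hS.unit y hy
  have hyn : y ⬝ᵥ n ≠ 0 := by rwa [dotProduct_comm]
  obtain ⟨x, hx, hxx, hnx, hxπ, hc, hv⟩ := exists_great_circle hnn
  have hz : ∀ t, 0 < (x t ⨯₃ y) ⬝ᵥ (x t ⨯₃ y) := by
    intro t
    refine dotProduct_self_pos_of_ne fun h ↦ ?_
    have h1 := hnx t
    rcases eq_or_eq_neg_of_cross_eq_zero (hxx t) hyy h with h | h <;> rw [h] at h1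
    · exact hny h1
    · exact hny (by simpa using h1)
  obtain ⟨ρ, hρ⟩ : ∃ ρ : ℝ → ℝ, ρ = fun t ↦ (√((x t ⨯₃ y) ⬝ᵥ (x t ⨯₃ y)))⁻¹ := ⟨_, rfl⟩
  have hρ0 : ∀ t, ρ t ≠ 0 := fun t ↦ by
    rw [hρ]; exact inv_ne_zero (Real.sqrt_pos.2 (hz t)).ne'
  have hcurve : AnalyticCurve fun t ↦ x t ⨯₃ y := hx.cross (analyticCurve_const y)
  have hρan : AnalyticOnNhd ℝ ρ Set.univ := by
    intro t _
    rw [hρ]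
    refine AnalyticAt.inv ?_ (Real.sqrt_pos.2 (hz t)).ne'
    exact AnalyticAt.fun_comp (Real.contDiffAt_sqrt (hz t).ne').analyticAt
      (hcurve.dotProduct hcurve t (Set.mem_univ t))
  obtain ⟨m, hm⟩ : ∃ m : ℝ → Fin 3 → ℝ, m = fun t ↦ ρ t • x t ⨯₃ y := ⟨_, rfl⟩
  have hmt : ∀ t, m t = ρ t • x t ⨯₃ y := fun t ↦ by rw [hm]
  have hman : AnalyticCurve m := by
    rw [hm]; exact hcurve.smul hρan
  have hmm : ∀ t, m t ⬝ᵥ m t = 1 := by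
    intro t
    have h1 := Real.mul_self_sqrt (hz t).le
    have h2 := (Real.sqrt_pos.2 (hz t)).ne'
    rw [hmt, hρ]
    simp only [smul_dotProduct, dotProduct_smul, smul_eq_mul]
    field_simp
    linarith
  have hmπ : ∀ t, m (t + Real.pi) = -m t := by
    intro t
    rw [hmt, hmt, hρ]
    simp only [hxπ, map_neg, LinearMap.neg_apply, neg_dotProduct, dotProduct_neg, neg_neg,
      smul_neg]
  have hxm : ∀ t, x t ⬝ᵥ m t = 0 := fun t ↦ by rw [hmt]; simp
  have hym : ∀ t, y ⬝ᵥ m t = 0 := fun t ↦ by rw [hmt]; simp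
  have hdotm : ∀ α t, α ⬝ᵥ m t = ρ t * (y ⨯₃ α ⬝ᵥ x t) := by
    intro α t
    rw [hmt, dotProduct_smul, smul_eq_mul, triple_product_permutation, dotProduct_comm]
  have hxQ : ∀ (α : Fin 3 → ℝ) (β : ℝ), α ⨯₃ n ≠ 0 ∨ β ≠ 0 → ∃ t, α ⬝ᵥ x t ≠ β := by
    intro α β h
    by_cases hβ : β = 0
    · subst hβ
      exact hc α (h.resolve_right fun h ↦ h rfl)
    · by_contra! h'
      have h1 := h' (0 + Real.pi)
      rw [hxπ, dotProduct_neg, h' 0] at h1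
      exact hβ (by linarith)
  have hmQ : ∀ (α : Fin 3 → ℝ) (β : ℝ), y ⨯₃ α ⨯₃ n ≠ 0 ∨ β ≠ 0 → ∃ t, α ⬝ᵥ m t ≠ β := by
    intro α β h
    by_cases hβ : β = 0
    · subst hβ
      obtain ⟨t, ht⟩ := hc _ (h.resolve_right fun h ↦ h rfl)
      exact ⟨t, by rw [hdotm]; exact mul_ne_zero (hρ0 t) ht⟩
    · by_contra! h'
      have h1 := h' (0 + Real.pi)
      rw [hmπ, dotProduct_neg, h' 0] at h1
      exact hβ (by linarith)
  have hmSQ : ∀ p ∈ S, ∀ q ∈ S, p ⨯₃ q ≠ 0 → y ⨯₃ (p ⨯₃ q) ⨯₃ n ≠ 0 := by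
    intro p hp q hq hpq h
    have h1 := eq_smul_of_cross_eq_zero hnn h
    have h2 : y ⨯₃ (p ⨯₃ q) ⬝ᵥ n = 0 := by
      have := congrArg (y ⬝ᵥ ·) h1
      simp only [dot_self_cross, dotProduct_smul, smul_eq_mul] at this
      exact (mul_eq_zero.1 this.symm).resolve_right hyn
    rw [h2, zero_smul] at h1
    exact cross_cross_ne_zero hpq (hpy p hp q hq hpq) (cross_eq_zero_comm.1 h1)
  have hmS0 : ∀ p, p ⨯₃ y ≠ 0 → y ⨯₃ p ⨯₃ n ≠ 0 := fun p h ↦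
    cross_cross_ne_zero (mt cross_eq_zero_comm.1 h) fun h _ ↦ hyn h
  -- the double cross product `x × m` is not contained in any relevant plane
  have hxmv : ∀ v : Fin 3 → ℝ, v ≠ 0 → (y = n → v ⬝ᵥ n ≠ 0) → ∃ t, v ⬝ᵥ x t ⨯₃ m t ≠ 0 := by
    intro v hv0 hvn
    have e : ∀ t, v ⬝ᵥ x t ⨯₃ m t = ρ t * ((v ⬝ᵥ x t) * (x t ⬝ᵥ y) - v ⬝ᵥ y) := by
      intro t
      rw [hmt, map_smul, dotProduct_smul, smul_eq_mul, cross_cross_eq_smul_sub_smul', hxx]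
      simp only [dotProduct_sub, dotProduct_smul, smul_eq_mul]
      ring
    rcases hcase with ⟨rfl, -⟩ | h
    · refine ⟨0, ?_⟩
      rw [e, dotProduct_comm (x 0) y, hnx, mul_zero, zero_sub]
      exact mul_ne_zero (hρ0 0) (neg_ne_zero.2 (hvn rfl))
    · obtain ⟨t, ht⟩ := hv v y hv0 hny h
      exact ⟨t, by rw [e]; exact mul_ne_zero (hρ0 t) (sub_ne_zero.2 ht.symm)⟩
  have hvol : ∀ p ∈ S, ∀ q ∈ S, p ⨯₃ q ≠ 0 → ∀ ε : ℝ, ε ≠ 0 →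
      ∃ t, tetraVol p q (x t) (ε • m t) ≠ 0 := by
    intro p hp q hq hpq ε hε
    by_contra! h
    have odd : ∀ t, (q - p) ⬝ᵥ x t ⨯₃ m t = 0 ∧ p ⨯₃ q ⬝ᵥ (ε • m t - x t) = 0 := by
      intro t
      have h1 := h t
      have h2 := h (t + Real.pi)
      rw [hxπ, hmπ] at h2
      rw [tetraVol_eq'] at h1 h2
      simp only [map_smul, map_neg, LinearMap.neg_apply, dotProduct_smul, dotProduct_sub,
        dotProduct_neg, smul_neg, neg_neg, smul_eq_mul] at h1 h2 ⊢
      constructor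
      · have : ε * ((q - p) ⬝ᵥ x t ⨯₃ m t) = 0 := by linarith
        exact (mul_eq_zero.1 this).resolve_left hε
      · linarith
    have hqp : q - p ≠ 0 := by
      intro h0
      rw [sub_eq_zero.1 h0] at hpq
      exact hpq (cross_self p)
    by_cases hyeq : y = n
    · subst hyeq
      set α := p ⨯₃ q
      have hρ1 : ∀ t, ρ t = 1 := by
        intro t
        simp [hρ, cross_dot_cross, hxx, hyy, hnx]
      obtain ⟨t, ht⟩ := hc (ε • (y ⨯₃ α) - α) (by
        intro h0
        have h1 : (α ⨯₃ y) ⬝ᵥ (α ⨯₃ y) = 0 := by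
          have h2 := congrArg (· ⬝ᵥ α ⨯₃ y) h0
          simp only [map_sub, map_smul, LinearMap.sub_apply, LinearMap.smul_apply,
            sub_dotProduct, smul_dotProduct, cross_dot_cross, zero_dotProduct, smul_eq_mul,
            dot_self_cross, dotProduct_comm (y ⨯₃ α)] at h2 ⊢
          simp only [dot_cross_self, dotProduct_comm α y] at h2 ⊢
          linarith
        exact cross_cross_ne_zero hpq (hpy p hp q hq hpq) (dotProduct_self_eq_zero.1 h1))
      apply ht
      have h3 := (odd t).2
      rw [dotProduct_sub, dotProduct_smul, hdotm, hρ1, one_mul] at h3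
      rw [sub_dotProduct, smul_dotProduct]
      exact h3
    · obtain ⟨t, ht⟩ := hxmv (q - p) hqp fun h ↦ absurd h hyeq
      exact ht (odd t).1
  have hS0 : ∀ p ∈ S, p ≠ 0 := by
    rintro p hp rfl
    simpa using hS.unit 0 hp
  have ev1 := hS.eventually_insert hx hxx (fun α ↦ α ⨯₃ n ≠ 0) hxQ
    fun p hp q hq h ↦ cross_cross_ne_zero h (hpn p hp q hq h)
  have ev2 := hS.eventually_insert hman hmm (fun α ↦ y ⨯₃ α ⨯₃ n ≠ 0) hmQ hmSQ
  have ev3 : ∀ᶠ t in 𝓝[≠] (0 : ℝ), ∀ p ∈ S, p ⬝ᵥ x t ⨯₃ m t ≠ 0 := by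
    refine (eventually_all_finite hS.finite).2 fun p hp ↦ ?_
    obtain ⟨t, ht⟩ := hxmv p (hS0 p hp) fun hyeq ↦ by
      rcases hcase with ⟨-, h⟩ | h
      · exact h p hp
      · rw [hyeq] at h; exact absurd (cross_self n) h
    exact eventually_ne_of_analytic ((analyticCurve_const p).dotProduct (hx.cross hman)) ht
  have ev4 : ∀ ε : ℝ, ε ≠ 0 → ∀ᶠ t in 𝓝[≠] (0 : ℝ), ∀ p ∈ S, ∀ q ∈ S, p ⨯₃ q ≠ 0 →
      tetraVol p q (x t) (ε • m t) ≠ 0 := by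
    intro ε hε
    refine (eventually_all_finite hS.finite).2 fun p hp ↦
      (eventually_all_finite hS.finite).2 fun q hq ↦ eventually_imp_distrib_left.2 fun hpq ↦ ?_
    obtain ⟨t, ht⟩ := hvol p hp q hq hpq ε hε
    exact eventually_ne_of_analytic ((analyticCurve_const p).tetraVol (analyticCurve_const q) hx
      (hman.smul (analyticOnNhd_const (v := ε)))) ht
  obtain ⟨t, ⟨a1, a2, a3⟩, ⟨b1, b2, b3⟩, c, d, d'⟩ :=
    (ev1.and (ev2.and (ev3.and ((ev4 1 one_ne_zero).and (ev4 (-1) (by norm_num)))))).exists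
  refine ⟨x t, m t, hxx t, hmm t, hnx t, hym t, hxm t, a1, a2, b1,
    fun p hp h ↦ b2 p hp (hmS0 p h), a3, ?_⟩
  refine hS.insert_two_pairs (hmm t) a3 b3 ?_ c fun p hp q hq hpq ↦ ⟨?_, ?_⟩
  · intro p hp
    exact cross_ne_zero_of_dotProduct_ne (hS.unit p hp) (hmm t) (b1 p hp)
      (b1 (-p) (hS.neg_mem p hp))
  · simpa using d p hp q hq hpq
  · simpa using d' p hp q hq hpq

end SphereGeometry

section GraphEmbedding

open Matrix

variable {V : Type*} {G : SimpleGraph V}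

/-- The unit vectors spanning the lines through the images of the vertices in `W`. -/
def lineSet (W : Finset V) (f : V → Fin 3 → ℝ) : Set (Fin 3 → ℝ) :=
  {p | ∃ v ∈ W, p = f v ∨ p = -f v}

/-- An orthogonal representation by unit vectors of the subgraph of `G` induced on `W` that is as
generic as possible: two vectors are orthogonal only for adjacent vertices, and two vectors are
parallel only if they are antipodal and come from opposite vertices of a 4-cycle. -/
structure GenericOn (G : SimpleGraph V) (W : Finset V) (f : V → Fin 3 → ℝ) : Prop where
  general : GeneralPosition (lineSet W f)
  orth : ∀ a ∈ W, ∀ b ∈ W, f a ⬝ᵥ f b = 0 ↔ G.Adj a b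
  parallel : ∀ a ∈ W, ∀ b ∈ W, a ≠ b → f a ⨯₃ f b = 0 →
    f a = -f b ∧ ∃ x ∈ W, ∃ y ∈ W, OppPairIn4Cycle G a b x y ∧ f x ⨯₃ f y ≠ 0

lemma mem_lineSet {W : Finset V} {f : V → Fin 3 → ℝ} {v : V} (hv : v ∈ W) : f v ∈ lineSet W f :=
  ⟨v, hv, Or.inl rfl⟩

lemma neg_mem_lineSet {W : Finset V} {f : V → Fin 3 → ℝ} {v : V} (hv : v ∈ W) :
    -f v ∈ lineSet W f :=
  ⟨v, hv, Or.inr rfl⟩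

lemma GenericOn.unit {W : Finset V} {f : V → Fin 3 → ℝ} (h : GenericOn G W f) {v : V}
    (hv : v ∈ W) : f v ⬝ᵥ f v = 1 :=
  h.general.unit _ (mem_lineSet hv)

lemma OppPairIn4Cycle.symm {p q x y : V} (h : OppPairIn4Cycle G p q x y) :
    OppPairIn4Cycle G q p x y := by
  obtain ⟨h1, h2, h3, h4, h5, h6, a1, a2, a3, a4⟩ := h
  exact ⟨h1.symm, h4, h5, h2, h3, h6, a2.symm, a1.symm, a4.symm, a3.symm⟩

lemma update_of_mem [DecidableEq V] {W : Finset V} {f : V → Fin 3 → ℝ} {v a : V} (hv : v ∉ W)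
    (x : Fin 3 → ℝ) (ha : a ∈ W) : Function.update f v x a = f a :=
  Function.update_of_ne (by rintro rfl; exact hv ha) _ _

lemma lineSet_insert_update [DecidableEq V] {W : Finset V} {f : V → Fin 3 → ℝ} {v : V}
    (hv : v ∉ W) (x : Fin 3 → ℝ) :
    lineSet (insert v W) (Function.update f v x) = insert x (insert (-x) (lineSet W f)) := by
  ext p
  simp only [lineSet, Finset.mem_insert, exists_eq_or_imp, Function.update_self,
    Set.mem_ofPred_eq, Set.mem_insert_iff, or_assoc]
  refine or_congr Iff.rfl (or_congr Iff.rfl (exists_congr fun a ↦ and_congr_right fun ha ↦ ?_))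
  rw [update_of_mem hv x ha]

lemma GenericOn.insert [DecidableEq V] {W : Finset V} {f : V → Fin 3 → ℝ} (h : GenericOn G W f)
    {v : V} (hv : v ∉ W) {x : Fin 3 → ℝ} (hx : x ⬝ᵥ x = 1)
    (horth : ∀ a ∈ W, f a ⬝ᵥ x = 0 ↔ G.Adj a v)
    (hne : ∀ p ∈ lineSet W f, p ⬝ᵥ x ≠ 1)
    (hgen : GeneralPosition (Insert.insert x (Insert.insert (-x) (lineSet W f)))) :
    GenericOn G (Insert.insert v W) (Function.update f v x) := by
  have hpar : ∀ a ∈ W, f a ⨯₃ x ≠ 0 := fun a ha ↦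
    cross_ne_zero_of_dotProduct_ne (h.unit ha) hx (hne _ (mem_lineSet ha))
      (hne _ (neg_mem_lineSet ha))
  refine ⟨by rwa [lineSet_insert_update hv], ?_, ?_⟩
  · intro a ha b hb
    rcases Finset.mem_insert.1 ha with rfl | ha' <;> rcases Finset.mem_insert.1 hb with rfl | hb'
    · simp [hx]
    · rw [Function.update_self, update_of_mem hv x hb', dotProduct_comm, horth b hb', G.adj_comm]
    · rw [Function.update_self, update_of_mem hv x ha', horth a ha']
    · rw [update_of_mem hv x ha', update_of_mem hv x hb', h.orth a ha' b hb']
  · intro a ha b hb hab h0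
    rcases Finset.mem_insert.1 ha with rfl | ha' <;> rcases Finset.mem_insert.1 hb with rfl | hb'
    · exact absurd rfl hab
    · rw [Function.update_self, update_of_mem hv x hb'] at h0
      exact absurd (cross_eq_zero_comm.1 h0) (hpar b hb')
    · rw [Function.update_self, update_of_mem hv x ha'] at h0
      exact absurd h0 (hpar a ha')
    · rw [update_of_mem hv x ha', update_of_mem hv x hb'] at h0 ⊢
      obtain ⟨h1, u, hu, w, hw, h2, h3⟩ := h.parallel a ha' b hb' hab h0
      refine ⟨h1, u, Finset.mem_insert_of_mem hu, w, Finset.mem_insert_of_mem hw, h2, ?_⟩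
      rwa [update_of_mem hv x hu, update_of_mem hv x hw]

/-- If `n` has at most one neighbour in `W`, then no two lines of a generic representation on `W`
are orthogonal to the vector of `n`. -/
lemma GenericOn.not_two_orthogonal {W : Finset V} {f : V → Fin 3 → ℝ} (h : GenericOn G W f)
    {n : V} (hn : n ∈ W) (huniq : ∀ a ∈ W, ∀ b ∈ W, G.Adj n a → G.Adj n b → a = b) :
    ∀ p ∈ lineSet W f, ∀ q ∈ lineSet W f, p ⨯₃ q ≠ 0 → p ⬝ᵥ f n = 0 → q ⬝ᵥ f n = 0 → False := by
  have key : ∀ p ∈ lineSet W f, p ⬝ᵥ f n = 0 → ∃ a ∈ W, G.Adj n a ∧ (p = f a ∨ p = -f a) := by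
    rintro p ⟨a, ha, hpa⟩ h0
    refine ⟨a, ha, ((h.orth a ha n hn).1 ?_).symm, hpa⟩
    rcases hpa with rfl | rfl
    · exact h0
    · simpa using h0
  intro p hp q hq hpq hp0 hq0
  obtain ⟨a, ha, hna, hpa⟩ := key p hp hp0
  obtain ⟨b, hb, hnb, hqb⟩ := key q hq hq0
  obtain rfl := huniq a ha b hb hna hnb
  rcases hpa with rfl | rfl <;> rcases hqb with rfl | rfl <;> simp at hpq

lemma GenericOn.orth_iff_of_unique {W : Finset V} {f : V → Fin 3 → ℝ} {n v : V} {x : Fin 3 → ℝ}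
    (hnv : G.Adj n v) (huniq : ∀ a ∈ W, G.Adj a v → a = n)
    (hpar : ∀ a ∈ W, a ≠ n → f a ⨯₃ f n ≠ 0) (hnx : f n ⬝ᵥ x = 0)
    (hx : ∀ p ∈ lineSet W f, p ⨯₃ f n ≠ 0 → p ⬝ᵥ x ≠ 0) :
    ∀ a ∈ W, f a ⬝ᵥ x = 0 ↔ G.Adj a v := by
  intro a ha
  constructor
  · intro h0
    by_contra hav
    have han : a ≠ n := by rintro rfl; exact hav hnv
    exact hx _ (mem_lineSet ha) (hpar a ha han) h0
  · intro h0
    rwa [huniq a ha h0]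

/-- In a graph of maximum degree at most `2`, one of two opposite vertices of a 4-cycle can be
represented by the antipode of the vector of the other one. -/
lemma GenericOn.insert_opposite [DecidableEq V]
    (hdeg : ∀ v a b c : V, G.Adj v a → G.Adj v b → a ≠ b → G.Adj v c → c = a ∨ c = b)
    {W : Finset V} {f : V → Fin 3 → ℝ} (h : GenericOn G W f) {p q x y : V} (hq : q ∉ W)
    (hp : p ∈ W) (hx : x ∈ W) (hy : y ∈ W) (hc : OppPairIn4Cycle G p q x y) :
    GenericOn G (Insert.insert q W) (Function.update f q (-f p)) := by
  obtain ⟨hpq, hpx, hpy, hqx, hqy, hxy, a1, a2, a3, a4⟩ := id hc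
  have hset : lineSet (Insert.insert q W) (Function.update f q (-f p)) = lineSet W f := by
    rw [lineSet_insert_update hq, neg_neg, Set.insert_eq_of_mem, Set.insert_eq_of_mem]
    · exact mem_lineSet hp
    · exact Or.inr (neg_mem_lineSet hp)
  have hadj : ∀ a, G.Adj a p ↔ G.Adj a q := by
    intro a
    constructor
    · intro h0
      rcases hdeg p x y a a1 a4.symm hxy h0.symm with rfl | rfl
      · exact a2
      · exact a3.symm
    · intro h0
      rcases hdeg q x y a a2.symm a3 hxy h0.symm with rfl | rfl
      · exact a1.symm
      · exact a4
  have hxy0 : f x ⨯₃ f y ≠ 0 := by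
    intro h0
    obtain ⟨-, u, hu, w, hw, ⟨-, -, -, -, -, huw, b1, b2, b3, b4⟩, -⟩ := h.parallel x hx y hy hxy h0
    rcases hdeg x p q u a1.symm a2 hpq b1 with rfl | rfl
    · rcases hdeg x u q w a1.symm a2 hpq b4.symm with rfl | rfl
      · exact huw rfl
      · exact hq hw
    · exact hq hu
  have hp_par : ∀ a ∈ W, f a ⨯₃ f p = 0 → a = p := by
    intro a ha h0
    by_contra hap
    obtain ⟨-, u, hu, w, hw, ⟨-, -, -, -, -, huw, b1, b2, b3, b4⟩, -⟩ := h.parallel a ha p hp hap h0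
    have hau : G.Adj u q := (hadj u).1 b2
    rcases hdeg u p q a b2 hau hpq b1.symm with rfl | rfl
    · exact hap rfl
    · exact hq ha
  have hcyc : -f p = -f p ∧ ∃ u ∈ Insert.insert q W, ∃ w ∈ Insert.insert q W,
      OppPairIn4Cycle G p q u w ∧ Function.update f q (-f p) u ⨯₃ Function.update f q (-f p) w ≠ 0 :=
    ⟨rfl, x, Finset.mem_insert_of_mem hx, y, Finset.mem_insert_of_mem hy, hc, by
      rwa [update_of_mem hq _ hx, update_of_mem hq _ hy]⟩
  refine ⟨by rw [hset]; exact h.general, ?_, ?_⟩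
  · intro a ha b hb
    rcases Finset.mem_insert.1 ha with rfl | ha' <;> rcases Finset.mem_insert.1 hb with rfl | hb'
    · simp [h.unit hp]
    · rw [Function.update_self, update_of_mem hq _ hb', neg_dotProduct, neg_eq_zero,
        h.orth p hp b hb', G.adj_comm, hadj, G.adj_comm]
    · rw [Function.update_self, update_of_mem hq _ ha', dotProduct_neg, neg_eq_zero,
        h.orth a ha' p hp, hadj]
    · rw [update_of_mem hq _ ha', update_of_mem hq _ hb', h.orth a ha' b hb']
  · intro a ha b hb hab h0
    rcases Finset.mem_insert.1 ha with rfl | ha' <;> rcases Finset.mem_insert.1 hb with rfl | hb'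
    · exact absurd rfl hab
    · rw [Function.update_self, update_of_mem hq _ hb'] at h0 ⊢
      obtain rfl := hp_par b hb' (cross_eq_zero_comm.1 (by
        rwa [map_neg, LinearMap.neg_apply, neg_eq_zero] at h0))
      obtain ⟨-, u, hu, w, hw, h1, h2⟩ := hcyc
      exact ⟨rfl, u, hu, w, hw, h1.symm, h2⟩
    · rw [Function.update_self, update_of_mem hq _ ha'] at h0 ⊢
      obtain rfl := hp_par a ha' (by
        rwa [map_neg, neg_eq_zero] at h0)
      exact ⟨(neg_neg _).symm, hcyc.2⟩
    · rw [update_of_mem hq _ ha', update_of_mem hq _ hb'] at h0 ⊢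
      obtain ⟨h1, u, hu, w, hw, h2, h3⟩ := h.parallel a ha' b hb' hab h0
      refine ⟨h1, u, Finset.mem_insert_of_mem hu, w, Finset.mem_insert_of_mem hw, h2, ?_⟩
      rwa [update_of_mem hq _ hu, update_of_mem hq _ hw]

theorem exists_genericOn
    (hdeg : ∀ v a b c : V, G.Adj v a → G.Adj v b → a ≠ b → G.Adj v c → c = a ∨ c = b)
    (W : Finset V) : ∃ f : V → Fin 3 → ℝ, GenericOn G W f := by
  classical
  induction W using Finset.strongInduction with
  | H W ih =>
  rcases W.eq_empty_or_nonempty with rfl | ⟨v₀, hv₀⟩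
  · refine ⟨0, ⟨?_, by simp, by simp⟩⟩
    have : lineSet (∅ : Finset V) 0 = ∅ := by simp [lineSet]
    rw [this]
    exact ⟨Set.finite_empty, by simp, by simp, by simp, by simp⟩
  by_cases h4 : ∃ p ∈ W, ∃ q ∈ W, ∃ x ∈ W, ∃ y ∈ W, OppPairIn4Cycle G p q x y
  · obtain ⟨p, hp, q, hq, x, hx, y, hy, hc⟩ := h4
    obtain ⟨hpq, -, -, hqx, hqy, -⟩ := id hc
    obtain ⟨f, hf⟩ := ih _ (Finset.erase_ssubset hq)
    have := hf.insert_opposite hdeg (Finset.notMem_erase q W) (Finset.mem_erase.2 ⟨hpq, hp⟩)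
      (Finset.mem_erase.2 ⟨hqx.symm, hx⟩) (Finset.mem_erase.2 ⟨hqy.symm, hy⟩) hc
    rw [Finset.insert_erase hq] at this
    exact ⟨_, this⟩
  have hpar : ∀ {U : Finset V} {f : V → Fin 3 → ℝ}, U ⊆ W → GenericOn G U f →
      ∀ a ∈ U, ∀ b ∈ U, a ≠ b → f a ⨯₃ f b ≠ 0 := by
    intro U f hU hf a ha b hb hab h0
    obtain ⟨-, x, hx, y, hy, hc, -⟩ := hf.parallel a ha b hb hab h0
    exact h4 ⟨a, hU ha, b, hU hb, x, hU hx, y, hU hy, hc⟩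
  by_cases hiso : ∃ v ∈ W, ∀ a ∈ W, ¬ G.Adj a v
  · obtain ⟨v, hv, hva⟩ := hiso
    obtain ⟨f, hf⟩ := ih _ (Finset.erase_ssubset hv)
    obtain ⟨x, hx, h1, h2, h3⟩ := hf.general.exists_insert
    have := hf.insert (Finset.notMem_erase v W) hx (fun a ha ↦ iff_of_false
      (h2 _ (mem_lineSet ha)) (hva a (Finset.mem_of_mem_erase ha))) h1 h3
    rw [Finset.insert_erase hv] at this
    exact ⟨_, this⟩
  by_cases hleaf : ∃ v ∈ W, ∃ n ∈ W, G.Adj n v ∧ ∀ a ∈ W, G.Adj a v → a = n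
  · obtain ⟨v, hv, n, hn, hnv, huniq⟩ := hleaf
    obtain ⟨f, hf⟩ := ih _ (Finset.erase_ssubset hv)
    have hn' : n ∈ W.erase v := Finset.mem_erase.2 ⟨hnv.ne, hn⟩
    obtain ⟨x, hx, hnx, h1, h2, h3⟩ := hf.general.exists_insert_orthogonal (mem_lineSet hn')
      (hf.not_two_orthogonal hn' fun a ha b hb hna hnb ↦ by
        by_contra hab
        rcases hdeg n a b v hna hnb hab hnv with rfl | rfl
        · exact Finset.notMem_erase _ _ ha
        · exact Finset.notMem_erase _ _ hb)
    have := hf.insert (Finset.notMem_erase v W) hx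
      (GenericOn.orth_iff_of_unique hnv (fun a ha ↦ huniq a (Finset.mem_of_mem_erase ha))
        (fun a ha ↦ hpar (Finset.erase_subset _ _) hf a ha n hn') hnx h2) h1 h3
    rw [Finset.insert_erase hv] at this
    exact ⟨_, this⟩
  push Not at hiso hleaf
  obtain ⟨n, hn, hnv⟩ := hiso v₀ hv₀
  obtain ⟨m, hm, hmv, hmn⟩ := hleaf v₀ hv₀ n hn hnv
  obtain ⟨y, hy, hym, hyv⟩ := hleaf m hm v₀ hv₀ hmv.symm
  set U := (W.erase m).erase v₀ with hU
  have hUW : U ⊆ W := (Finset.erase_subset _ _).trans (Finset.erase_subset _ _)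
  have hv₀' : v₀ ∈ W.erase m := Finset.mem_erase.2 ⟨hmv.ne', hv₀⟩
  have hmU : m ∉ U := fun h ↦ Finset.notMem_erase m W (Finset.mem_of_mem_erase h)
  have hvU : v₀ ∉ U := Finset.notMem_erase _ _
  have hnU : n ∈ U := Finset.mem_erase.2 ⟨hnv.ne, Finset.mem_erase.2 ⟨hmn.symm, hn⟩⟩
  have hyU : y ∈ U := Finset.mem_erase.2 ⟨hyv, Finset.mem_erase.2 ⟨hym.ne, hy⟩⟩
  obtain ⟨f, hf⟩ := ih U
    ((Finset.erase_ssubset hv₀').trans (Finset.erase_ssubset hm))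
  have hvuniq : ∀ a ∈ U, G.Adj a v₀ → a = n := by
    intro a ha hav
    rcases hdeg v₀ n m a hnv.symm hmv.symm hmn.symm hav.symm with h | rfl
    · exact h
    · exact absurd ha hmU
  have hmuniq : ∀ a ∈ U, G.Adj a m → a = y := by
    intro a ha ham
    rcases hdeg m y v₀ a hym.symm hmv hyv ham.symm with h | rfl
    · exact h
    · exact absurd ha hvU
  have hny : ¬ G.Adj n y := fun h ↦
    h4 ⟨n, hn, m, hm, v₀, hv₀, y, hy, hmn.symm, hnv.ne, h.ne, hmv.ne, hym.ne', hyv.symm, hnv,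
      hmv.symm, hym.symm, h.symm⟩
  obtain ⟨x, w, hx, hw, hnx, hyw, hxw, a1, a2, b1, b2, g1, g2⟩ :=
    hf.general.exists_insert_two (mem_lineSet hnU) (mem_lineSet hyU)
      (fun h ↦ hny ((hf.orth n hnU y hyU).1 h))
      (by
        by_cases hyn : y = n
        · subst hyn
          refine Or.inl ⟨rfl, ?_⟩
          have key : ∀ a ∈ U, f a ⬝ᵥ f y ≠ 0 := by
            intro a ha h0
            have h1 := (hf.orth a ha y hyU).1 h0
            rcases hdeg y v₀ m a hnv hym hmv.ne' h1.symm with rfl | rfl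
            · exact hvU ha
            · exact hmU ha
          rintro p ⟨a, ha, rfl | rfl⟩
          · exact key a ha
          · simpa using key a ha
        · exact Or.inr (hpar hUW hf y hyU n hnU hyn))
      (hf.not_two_orthogonal hnU fun a ha b hb hna hnb ↦ by
        by_contra hab
        rcases hdeg n a b v₀ hna hnb hab hnv with rfl | rfl
        · exact hvU ha
        · exact hvU hb)
      (hf.not_two_orthogonal hyU fun a ha b hb hna hnb ↦ by
        by_contra hab
        rcases hdeg y a b m hna hnb hab hym with rfl | rfl
        · exact hmU ha
        · exact hmU hb)
  have hf1 := hf.insert hvU hx (GenericOn.orth_iff_of_unique hnv hvuniq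
    (fun a ha ↦ hpar hUW hf a ha n hnU) hnx a2) a1 g1
  have hmU' : m ∉ insert v₀ U := by
    rw [hU, Finset.insert_erase hv₀']
    exact Finset.notMem_erase _ _
  have horth := GenericOn.orth_iff_of_unique hym hmuniq
    (fun a ha ↦ hpar hUW hf a ha y hyU) hyw b2
  have hf2 := hf1.insert hmU' hw
    (by
      intro a ha
      rcases Finset.mem_insert.1 ha with rfl | ha
      · rw [Function.update_self]
        exact iff_of_true hxw hmv.symm
      · rw [update_of_mem hvU _ ha]
        exact horth a ha)
    (by
      rw [lineSet_insert_update hvU]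
      rintro p (rfl | rfl | hp)
      · simp [hxw]
      · simp [hxw]
      · exact b1 p hp)
    (by rwa [lineSet_insert_update hvU])
  rw [hU, Finset.insert_erase hv₀', Finset.insert_erase hm] at hf2
  exact ⟨_, hf2⟩

lemma tetraVol_smul (c : ℝ) (p q r s : Fin 3 → ℝ) :
    tetraVol (c • p) (c • q) (c • r) (c • s) = c ^ 3 * tetraVol p q r s := by
  simp only [tetraVol, cross_apply, vec3_dotProduct, Pi.sub_apply, Pi.smul_apply, smul_eq_mul,
    cons_val]
  ring

lemma tetraVol_eq_zero_of_coplanar {a b c e : EuclideanSpace ℝ (Fin 3)}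
    (h : Coplanar ℝ ({a, b, c, e} : Set (EuclideanSpace ℝ (Fin 3)))) :
    tetraVol a.ofLp b.ofLp c.ofLp e.ofLp = 0 := by
  by_contra h0
  rw [tetraVol, triple_product_eq_det] at h0
  have hli := linearIndependent_rows_of_det_ne_zero h0
  have hli' := hli.map' (WithLp.linearEquiv 2 ℝ (Fin 3 → ℝ)).symm.toLinearMap
    (LinearEquiv.ker _)
  have hle : Submodule.span ℝ (Set.range
      ((WithLp.linearEquiv 2 ℝ (Fin 3 → ℝ)).symm.toLinearMap ∘
        fun i ↦ (![b.ofLp - a.ofLp, c.ofLp - a.ofLp, e.ofLp - a.ofLp] : Fin 3 → Fin 3 → ℝ) i)) ≤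
      vectorSpan ℝ ({a, b, c, e} : Set (EuclideanSpace ℝ (Fin 3))) := by
    rw [Submodule.span_le]
    rintro _ ⟨i, rfl⟩
    fin_cases i
    · exact vsub_mem_vectorSpan ℝ (p₁ := b) (p₂ := a) (by simp) (by simp)
    · exact vsub_mem_vectorSpan ℝ (p₁ := c) (p₂ := a) (by simp) (by simp)
    · exact vsub_mem_vectorSpan ℝ (p₁ := e) (p₂ := a) (by simp) (by simp)
  have h1 := Submodule.finrank_mono hle
  have h3 := finrank_span_eq_card hli'
  rw [Fintype.card_fin] at h3
  have h2 := coplanar_iff_finrank_le_two.1 h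
  exact absurd (h3.symm.le.trans (h1.trans h2)) (by norm_num)

/-- Two antipodal pairs of vertices that are opposite in two different 4-cycles and together
make up the set `{a, b, c, e}`. -/
def IsOppositePairs (G : SimpleGraph V) (f : V → Fin 3 → ℝ) (a b c e : V) : Prop :=
  ∃ p q r s : V, ({a, b, c, e} : Set V) = {p, q, r, s} ∧ f p = -f q ∧ f r = -f s ∧
    ∃ x y x' y' : V, OppPairIn4Cycle G p q x y ∧ OppPairIn4Cycle G r s x' y' ∧
      ({p, x, q, y} : Set V) ≠ {r, x', s, y'}

lemma GenericOn.isOppositePairs_of_cross_eq_zero {W : Finset V} {f : V → Fin 3 → ℝ}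
    (h : GenericOn G W f) {a b c e : V} (ha : a ∈ W) (hb : b ∈ W) (hc : c ∈ W) (he : e ∈ W)
    (hab : a ≠ b) (hac : a ≠ c) (hae : a ≠ e) (hbc : b ≠ c) (hbe : b ≠ e) (hce : c ≠ e)
    (hpar : f a ⨯₃ f b = 0) (hvol : tetraVol (f a) (f b) (f c) (f e) = 0) :
    IsOppositePairs G f a b c e := by
  obtain ⟨hfab, x, hx, y, hy, hcyc, hxy⟩ := h.parallel a ha b hb hab hpar
  have hnot : ∀ d ∈ W, a ≠ d → b ≠ d → f a ⨯₃ f d ≠ 0 := by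
    intro d hd had hbd h0
    have h1 := (h.parallel a ha d hd had h0).1
    have h2 : f b = f d := by rw [← neg_inj, ← hfab, h1]
    have h3 := (h.parallel b hb d hd hbd (by rw [h2, cross_self])).1
    have h4 := h.unit hb
    have h5 : f b ⬝ᵥ f d = 1 := by rw [← h2, h4]
    have h6 : f b ⬝ᵥ f d = -1 := by
      nth_rewrite 1 [h3]
      rw [neg_dotProduct, h.unit hd]
    linarith
  have hdet : f a ⬝ᵥ f c ⨯₃ f e = 0 := by
    have hfb : f b = -f a := by rw [hfab, neg_neg]
    rw [hfb] at hvol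
    have e1 : tetraVol (f a) (-f a) (f c) (f e) = -2 * (f a ⬝ᵥ f c ⨯₃ f e) := by
      simp only [tetraVol, cross_apply, vec3_dotProduct, Pi.sub_apply, Pi.neg_apply, cons_val]
      ring
    linarith
  have hce0 : f c ⨯₃ f e = 0 := by
    by_contra h0
    exact h.general.triple _ (mem_lineSet ha) _ (mem_lineSet hc) _ (mem_lineSet he)
      (hnot c hc hac hbc) (hnot e he hae hbe) h0 hdet
  obtain ⟨hfce, x', hx', y', hy', hcyc', -⟩ := h.parallel c hc e he hce hce0
  refine ⟨a, b, c, e, rfl, hfab, hfce, x, y, x', y', hcyc, hcyc', fun hset ↦ ?_⟩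
  have hcm : c ∈ ({a, x, b, y} : Set V) := hset ▸ by simp
  have hem : e ∈ ({a, x, b, y} : Set V) := hset ▸ by simp
  have hcm' : c = x ∨ c = y := by
    simp only [Set.mem_insert_iff, Set.mem_singleton_iff] at hcm
    tauto
  have hem' : e = x ∨ e = y := by
    simp only [Set.mem_insert_iff, Set.mem_singleton_iff] at hem
    tauto
  rcases hcm' with rfl | rfl <;> rcases hem' with rfl | rfl
  · exact hce rfl
  · exact hxy hce0
  · exact hxy (cross_eq_zero_comm.1 hce0)
  · exact hce rfl

lemma IsOppositePairs.congr {f : V → Fin 3 → ℝ} {a b c e a' b' c' e' : V}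
    (h : IsOppositePairs G f a b c e) (hs : ({a', b', c', e'} : Set V) = {a, b, c, e}) :
    IsOppositePairs G f a' b' c' e' := by
  rwa [IsOppositePairs, hs]

lemma GenericOn.isOppositePairs {W : Finset V} {f : V → Fin 3 → ℝ}
    (h : GenericOn G W f) {a b c e : V} (ha : a ∈ W) (hb : b ∈ W) (hc : c ∈ W) (he : e ∈ W)
    (hab : a ≠ b) (hac : a ≠ c) (hae : a ≠ e) (hbc : b ≠ c) (hbe : b ≠ e) (hce : c ≠ e)
    (hvol : tetraVol (f a) (f b) (f c) (f e) = 0) : IsOppositePairs G f a b c e := by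
  have hr : ∀ p q r s : Fin 3 → ℝ, tetraVol p q r s = 0 → tetraVol q r s p = 0 := fun p q r s h ↦ by
    rwa [tetraVol_rotate, neg_eq_zero] at h
  have hs : ∀ p q r s : Fin 3 → ℝ, tetraVol p q r s = 0 → tetraVol p r q s = 0 := fun p q r s h ↦ by
    rwa [tetraVol_swap, neg_eq_zero] at h
  by_cases h1 : f a ⨯₃ f b = 0
  · exact h.isOppositePairs_of_cross_eq_zero ha hb hc he hab hac hae hbc hbe hce h1 hvol
  by_cases h2 : f a ⨯₃ f c = 0
  · refine (h.isOppositePairs_of_cross_eq_zero ha hc hb he hac hab hae hbc.symm hce hbe h2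
      (hs _ _ _ _ hvol)).congr ?_
    ext; simp only [Set.mem_insert_iff, Set.mem_singleton_iff]; tauto
  by_cases h3 : f a ⨯₃ f e = 0
  · refine (h.isOppositePairs_of_cross_eq_zero he ha hb hc hae.symm hbe.symm hce.symm hab hac hbc
      (cross_eq_zero_comm.1 h3) (hr _ _ _ _ (hr _ _ _ _ (hr _ _ _ _ hvol)))).congr ?_
    ext; simp only [Set.mem_insert_iff, Set.mem_singleton_iff]; tauto
  by_cases h4 : f b ⨯₃ f c = 0
  · refine (h.isOppositePairs_of_cross_eq_zero hb hc he ha hbc hbe hab.symm hce hac.symm hae.symm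
      h4 (hr _ _ _ _ hvol)).congr ?_
    ext; simp only [Set.mem_insert_iff, Set.mem_singleton_iff]; tauto
  by_cases h5 : f b ⨯₃ f e = 0
  · refine (h.isOppositePairs_of_cross_eq_zero hb he hc ha hbe hbc hab.symm hce.symm hae.symm
      hac.symm h5 (hs _ _ _ _ (hr _ _ _ _ hvol))).congr ?_
    ext; simp only [Set.mem_insert_iff, Set.mem_singleton_iff]; tauto
  by_cases h6 : f c ⨯₃ f e = 0
  · refine (h.isOppositePairs_of_cross_eq_zero hc he ha hb hce hac.symm hbc.symm hae.symm hbe.symm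
      hab h6 (hr _ _ _ _ (hr _ _ _ _ hvol))).congr ?_
    ext; simp only [Set.mem_insert_iff, Set.mem_singleton_iff]; tauto
  exact absurd hvol (h.general.quadruple _ (mem_lineSet ha) _ (mem_lineSet hb) _ (mem_lineSet hc)
    _ (mem_lineSet he) h1 h2 h3 h4 h5 h6)

lemma dist_toLp_eq_one_iff {u v : Fin 3 → ℝ} (hu : u ⬝ᵥ u = 1) (hv : v ⬝ᵥ v = 1) :
    dist (WithLp.toLp 2 ((1 / √2) • u)) (WithLp.toLp 2 ((1 / √2) • v)) = 1 ↔ u ⬝ᵥ v = 0 := by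
  have hs : (1 / √2) ^ 2 = (1 / 2 : ℝ) := by
    rw [div_pow, Real.sq_sqrt (by norm_num)]; norm_num
  have e : (dist (WithLp.toLp 2 ((1 / √2) • u)) (WithLp.toLp 2 ((1 / √2) • v))) ^ 2 =
      1 - u ⬝ᵥ v := by
    rw [EuclideanSpace.dist_eq, Real.sq_sqrt (Finset.sum_nonneg fun _ _ ↦ sq_nonneg _)]
    simp only [Fin.sum_univ_three, Real.dist_eq, sq_abs, Pi.smul_apply, smul_eq_mul]
    rw [vec3_dotProduct] at hu hv ⊢
    linear_combination (1 / 2 : ℝ) * (hu + hv) +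
      ((u 0 - v 0) ^ 2 + (u 1 - v 1) ^ 2 + (u 2 - v 2) ^ 2) * hs
  rw [← pow_eq_one_iff_of_nonneg dist_nonneg two_ne_zero, e]
  constructor <;> intro h <;> linarith

end GraphEmbedding

theorem stmt_11 {V : Type*} [Fintype V] (G : SimpleGraph V) [DecidableRel G.Adj]
    (hdeg : ∀ v : V, G.degree v ≤ 2) :
    ∃ f : V → EuclideanSpace ℝ (Fin 3),
      Function.Injective f ∧
      (∀ v : V, ‖f v‖ = 1 / Real.sqrt 2) ∧
      (∀ u v : V, G.Adj u v → dist (f u) (f v) = 1) ∧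
      -- (1) no vertex is at distance 1 from three distinct vertices
      (¬ ∃ a b c w : V, a ≠ b ∧ a ≠ c ∧ b ≠ c ∧
        dist (f w) (f a) = 1 ∧ dist (f w) (f b) = 1 ∧ dist (f w) (f c) = 1) ∧
      -- (2) no 4 vertices lie on a circle, except two antipodal pairs coming from
      -- two distinct 4-cycles
      (∀ a b c e : V, a ≠ b → a ≠ c → a ≠ e → b ≠ c → b ≠ e → c ≠ e →
        EuclideanGeometry.Concyclic ({f a, f b, f c, f e} : Set (EuclideanSpace ℝ (Fin 3))) →
        ∃ p q r s : V, ({a, b, c, e} : Set V) = {p, q, r, s} ∧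
          f p = -f q ∧ f r = -f s ∧
          ∃ x y x' y' : V,
            OppPairIn4Cycle G p q x y ∧ OppPairIn4Cycle G r s x' y' ∧
            ({p, x, q, y} : Set V) ≠ {r, x', s, y'}) := by
  classical
  have hdeg' : ∀ v a b c : V, G.Adj v a → G.Adj v b → a ≠ b → G.Adj v c → c = a ∨ c = b := by
    intro v a b c ha hb hab hc
    by_contra! h
    have hsub : ({a, b, c} : Finset V) ⊆ G.neighborFinset v := by
      intro w hw
      simp only [Finset.mem_insert, Finset.mem_singleton] at hw
      rw [SimpleGraph.mem_neighborFinset]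
      rcases hw with rfl | rfl | rfl <;> assumption
    have h1 := Finset.card_le_card hsub
    rw [Finset.card_eq_three.2 ⟨a, b, c, hab, h.1.symm, h.2.symm, rfl⟩,
      SimpleGraph.card_neighborFinset_eq_degree] at h1
    exact absurd (hdeg v) (by omega)
  obtain ⟨f, hf⟩ := exists_genericOn hdeg' Finset.univ
  have hunit : ∀ v, f v ⬝ᵥ f v = 1 := fun v ↦ hf.unit (Finset.mem_univ v)
  have hs0 : (1 / √2 : ℝ) ≠ 0 := by positivity
  have hdist : ∀ u v, dist (WithLp.toLp 2 ((1 / √2) • f u)) (WithLp.toLp 2 ((1 / √2) • f v)) = 1 ↔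
      G.Adj u v := fun u v ↦
    (dist_toLp_eq_one_iff (hunit u) (hunit v)).trans
      (hf.orth u (Finset.mem_univ u) v (Finset.mem_univ v))
  refine ⟨fun v ↦ WithLp.toLp 2 ((1 / √2) • f v), ?_, ?_, fun u v ↦ (hdist u v).2, ?_, ?_⟩
  · intro a b hab
    by_contra hne
    have h1 : f a = f b := smul_right_injective _ hs0 (WithLp.toLp_injective 2 hab)
    have h2 := (hf.parallel a (Finset.mem_univ a) b (Finset.mem_univ b) hne
      (by rw [h1, cross_self])).1
    have h3 : f b = -f b := h1 ▸ h2
    have h4 : f b = 0 := self_eq_neg.1 h3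
    have h5 := hunit b
    simp [h4] at h5
  · intro v
    change ‖WithLp.toLp 2 ((1 / √2) • f v)‖ = 1 / √2
    rw [WithLp.toLp_smul, norm_smul, EuclideanSpace.norm_eq]
    have h1 := hunit v
    rw [Matrix.vec3_dotProduct] at h1
    have h2 : ∑ i, ‖(WithLp.toLp 2 (f v)).ofLp i‖ ^ 2 = 1 := by
      simpa only [Fin.sum_univ_three, Real.norm_eq_abs, sq_abs, sq (f v _)] using h1
    rw [h2, Real.sqrt_one, mul_one, Real.norm_of_nonneg (by positivity)]
  · rintro ⟨a, b, c, w, hab, hac, hbc, h1, h2, h3⟩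
    rcases hdeg' w a b c ((hdist w a).1 h1) ((hdist w b).1 h2) hab ((hdist w c).1 h3) with h | h
    · exact hac h.symm
    · exact hbc h.symm
  · intro a b c e hab hac hae hbc hbe hce hcon
    have hvol := tetraVol_eq_zero_of_coplanar hcon.2
    simp only [tetraVol_smul] at hvol
    obtain ⟨p, q, r, s, h1, h2, h3, h4⟩ := hf.isOppositePairs (Finset.mem_univ a)
      (Finset.mem_univ b) (Finset.mem_univ c) (Finset.mem_univ e) hab hac hae hbc hbe hce
      ((mul_eq_zero.1 hvol).resolve_left (pow_ne_zero 3 hs0))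
    refine ⟨p, q, r, s, h1, ?_, ?_, h4⟩
    · simp [h2]
    · simp [h3]
end

section
/- Let H be a finite simple graph that is either a cycle of length n for some n ≥ 3 with n ≠ 4, or a path with at least 4 edges. Then the vertex set of H can be partitioned into two disjoint sets A and B such that: (1) every vertex of B has degree 2 in H and has exactly one neighbour in B (so the induced subgraph H[B] is a perfect matching on B); and (2) for every subset W' of B that is independent in H and maximal with respect to inclusion among independent subsets of B, every connected component of the induced subgraph H[A ∪ W'] has at most 4 vertices. -/
/-- If the vertices of a graph are labelled by (a subset `dom` of) the integers so that adjacency is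
consecutiveness, then a vertex lying strictly between two labels `a < b` which are both missing
from `K` has its component of `H[K]` contained in the vertices labelled strictly between them. -/
lemma ncard_reachable_induce_le {V : Type*} (H : SimpleGraph V) (x : ℤ → V) (dom : ℤ → Prop)
    (hadj : ∀ i, dom i → ∀ v, H.Adj (x i) v → ∃ j, dom j ∧ (j = i - 1 ∨ j = i + 1) ∧ v = x j)
    (K : Set V) (a b i : ℤ) (ha : dom a → x a ∉ K) (hb : dom b → x b ∉ K) (hi : dom i)
    (hai : a < i) (hib : i < b) (hab : b ≤ a + 5) (v : K) (hv : x i = v) :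
    {u : K | (H.induce K).Reachable u v}.ncard ≤ 4 := by
  classical
  have key : ∀ u : K, (H.induce K).Reachable v u → ∃ j, dom j ∧ a < j ∧ j < b ∧ x j = u := by
    intro u hu
    rw [SimpleGraph.reachable_iff_reflTransGen] at hu
    induction hu with
    | refl => exact ⟨i, hi, hai, hib, hv⟩
    | @tail p q _ h ih =>
      obtain ⟨j, hj, haj, hjb, hjp⟩ := ih
      have h' : H.Adj (x j) q := by rw [hjp]; exact h
      obtain ⟨k, hk, hkj, hqk⟩ := hadj j hj _ h'
      have hqK : x k ∈ K := hqk ▸ q.2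
      have h1 : k ≠ a := by rintro rfl; exact ha hk hqK
      have h2 : k ≠ b := by rintro rfl; exact hb hk hqK
      exact ⟨k, hk, by omega, by omega, hqk.symm⟩
  have hsub : Subtype.val '' {u : K | (H.induce K).Reachable u v} ⊆
      ((Finset.Ioo a b).image x : Finset V) := by
    rintro _ ⟨u, hu, rfl⟩
    obtain ⟨j, -, haj, hjb, hj⟩ := key u hu.symm
    simp only [Finset.coe_image, Set.mem_image, Finset.coe_Ioo, Set.mem_Ioo]
    exact ⟨j, ⟨haj, hjb⟩, hj⟩
  rw [← Set.ncard_image_of_injective _ Subtype.val_injective]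
  refine (Set.ncard_le_ncard hsub (Finset.finite_toSet _)).trans ?_
  rw [Set.ncard_coe_finset]
  refine Finset.card_image_le.trans ?_
  rw [Int.card_Ioo]
  omega

/-- A sufficient criterion for the partition to exist, in terms of a labelling of the vertices by
integers and of the set `s` of labels at which a pair of consecutive vertices of `B` starts. -/
lemma exists_partition_of_labelling {V : Type*} (H : SimpleGraph V) (x : ℤ → V)
    (dom s : ℤ → Prop) (hsurj : ∀ v, ∃ i, dom i ∧ x i = v)
    (hadj : ∀ i, dom i → ∀ v,
      H.Adj (x i) v ↔ ∃ j, dom j ∧ (j = i - 1 ∨ j = i + 1) ∧ v = x j)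
    (hne : ∀ i, dom (i - 1) → dom (i + 1) → x (i - 1) ≠ x (i + 1))
    (hs : ∀ i j, dom i → dom j → x i = x j → (s i ↔ s j) ∧ (s (i - 1) ↔ s (j - 1)))
    (hsdom : ∀ i, s i → dom (i - 1) ∧ dom i ∧ dom (i + 1) ∧ dom (i + 2))
    (hsep : ∀ i, s i → ¬ s (i + 1) ∧ ¬ s (i + 2))
    (hgap : ∀ rem : ℤ → Prop, (∀ i, ¬ dom i → rem i) →
      (∀ i j, dom i → dom j → x i = x j → rem i → rem j) →
      (∀ i, s i → rem i ∨ rem (i + 1)) →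
      ∀ i, ¬ rem i → ∃ a b, a < i ∧ i < b ∧ b ≤ a + 5 ∧ rem a ∧ rem b) :
    ∃ A B : Set V, A ∪ B = Set.univ ∧ Disjoint A B ∧
      (∀ v ∈ B, (H.neighborSet v).ncard = 2 ∧ (H.neighborSet v ∩ B).ncard = 1) ∧
      (∀ W' : Set V, W' ⊆ B → W'.Pairwise (fun u v => ¬ H.Adj u v) →
        (∀ W'' : Set V, W' ⊆ W'' → W'' ⊆ B → W''.Pairwise (fun u v => ¬ H.Adj u v) →
          W'' = W') →
        ∀ v : ↑(A ∪ W'),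
          {u : ↑(A ∪ W') | (H.induce (A ∪ W')).Reachable u v}.ncard ≤ 4) := by
  set B : Set V := {v | ∃ i, dom i ∧ x i = v ∧ (s i ∨ s (i - 1))} with hB
  have hmem : ∀ i, dom i → (x i ∈ B ↔ s i ∨ s (i - 1)) := by
    intro i hi
    constructor
    · rintro ⟨j, hj, hji, h⟩
      obtain ⟨h1, h2⟩ := hs j i hj hi hji
      rwa [← h1, ← h2]
    · exact fun h => ⟨i, hi, rfl, h⟩
  have hstep : ∀ i, s i ∨ s (i - 1) → dom (i - 1) ∧ dom i ∧ dom (i + 1) := by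
    rintro i (h | h)
    · have := hsdom i h
      tauto
    · have := hsdom (i - 1) h
      rw [show i - 1 + 1 = i by ring, show i - 1 + 2 = i + 1 by ring] at this
      tauto
  refine ⟨Bᶜ, B, Set.compl_union_self B, disjoint_compl_left, ?_, ?_⟩
  · rintro _ ⟨i, hi, rfl, hsi⟩
    obtain ⟨hm, -, hp⟩ := hstep i hsi
    have hN : H.neighborSet (x i) = {x (i - 1), x (i + 1)} := by
      ext v
      simp only [SimpleGraph.mem_neighborSet, hadj i hi, Set.mem_insert_iff, Set.mem_singleton_iff]
      constructor
      · rintro ⟨j, -, rfl | rfl, h⟩ <;> simp [h]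
      · rintro (h | h)
        · exact ⟨_, hm, .inl rfl, h⟩
        · exact ⟨_, hp, .inr rfl, h⟩
    have hmB := hmem _ hm
    have hpB := hmem _ hp
    rw [show i - 1 - 1 = i - 2 by ring] at hmB
    rw [show i + 1 - 1 = i by ring] at hpB
    refine ⟨by rw [hN, Set.ncard_pair (hne i hm hp)], ?_⟩
    rw [hN, Set.ncard_eq_one]
    rcases hsi with h | h
    · refine ⟨x (i + 1), ?_⟩
      have h1 : x (i - 1) ∉ B := by
        rw [hmB]
        rintro (h' | h')
        · exact (hsep _ h').1 (by simpa using h)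
        · exact (hsep _ h').2 (by simpa using h)
      have h2 : x (i + 1) ∈ B := hpB.2 (.inr h)
      rw [Set.insert_inter_of_notMem h1, Set.inter_eq_left.2 (Set.singleton_subset_iff.2 h2)]
    · refine ⟨x (i - 1), ?_⟩
      obtain ⟨h3, h4⟩ := hsep _ h
      rw [show i - 1 + 1 = i by ring] at h3
      rw [show i - 1 + 2 = i + 1 by ring] at h4
      have h1 : x (i + 1) ∉ B := by
        rw [hpB]
        tauto
      have h2 : x (i - 1) ∈ B := hmB.2 (.inl h)
      rw [Set.pair_comm, Set.insert_inter_of_notMem h1,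
        Set.inter_eq_left.2 (Set.singleton_subset_iff.2 h2)]
  · intro W' hW'B hW' _ v
    obtain ⟨i, hi, hiv⟩ := hsurj v
    obtain ⟨a, b, hai, hib, hab, ha, hb⟩ := hgap (fun i => dom i → x i ∉ Bᶜ ∪ W')
      (fun i h h' => absurd h' h) (fun i j h1 h2 h3 h4 _ => h3 ▸ h4 h1) (by
        intro j hj
        obtain ⟨-, h1, h2, -⟩ := hsdom j hj
        by_contra! hcon
        obtain ⟨⟨-, h3⟩, -, h4⟩ := hcon
        have h5 : x j ∈ B := (hmem j h1).2 (.inl hj)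
        have h6 : x (j + 1) ∈ B := (hmem _ h2).2 (.inr (by simpa using hj))
        have h7 : x j ∈ W' := h3.resolve_left (fun h => h h5)
        have h8 : x (j + 1) ∈ W' := h4.resolve_left (fun h => h h6)
        have h9 : H.Adj (x j) (x (j + 1)) := (hadj j h1 _).2 ⟨_, h2, .inr rfl, rfl⟩
        exact hW' h7 h8 h9.ne h9) i (fun h => h hi (hiv ▸ v.2))
    exact ncard_reachable_induce_le H x dom (fun i hi v => (hadj i hi v).1) _ a b i ha hb hi
      hai hib hab v hiv

/-- A finite connected 2-regular graph is a periodic sequence of vertices. -/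
lemma exists_periodic_labelling {V : Type*} [Finite V] (H : SimpleGraph V) (hc : H.Connected)
    (hdeg : ∀ v, (H.neighborSet v).ncard = 2) :
    ∃ (N : ℤ) (x : ℤ → V), 3 ≤ N ∧ (∀ v, ∃ i, x i = v) ∧ (∀ i j, x i = x j ↔ i % N = j % N) ∧
      (∀ i, x (i - 1) ≠ x (i + 1)) ∧
      ∀ i v, H.Adj (x i) v ↔ ∃ j, (j = i - 1 ∨ j = i + 1) ∧ v = x j := by
  classical
  obtain ⟨v₀⟩ := hc.nonempty
  have hcyc : H.IsCycles := fun v _ => hdeg v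
  obtain ⟨p, hp, hverts⟩ := hcyc.exists_cycle_toSubgraph_verts_eq_connectedComponentSupp
    (v := v₀) (c := H.connectedComponentMk v₀) rfl
    (Set.nonempty_of_ncard_ne_zero (by rw [hdeg]; norm_num))
  have hlen := hp.three_le_length
  have hinj := hp.getVert_injOn'
  have hmod : ∀ i : ℤ, 0 ≤ i % (p.length : ℤ) ∧ i % (p.length : ℤ) < p.length := fun i =>
    ⟨Int.emod_nonneg _ (by omega), Int.emod_lt_of_pos _ (by omega)⟩
  set x : ℤ → V := fun i => p.getVert (i % (p.length : ℤ)).toNat with hx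
  have hxx : ∀ i j, x i = x j ↔ i % (p.length : ℤ) = j % (p.length : ℤ) := by
    intro i j
    have h1 := hmod i
    have h2 := hmod j
    refine ⟨fun h => ?_, fun h => by simp [hx, h]⟩
    have := hinj (x₁ := (i % (p.length : ℤ)).toNat) (x₂ := (j % (p.length : ℤ)).toNat)
      (by simp only [Set.mem_ofPred_eq]; omega) (by simp only [Set.mem_ofPred_eq]; omega) h
    omega
  have hne : ∀ i, x (i - 1) ≠ x (i + 1) := by
    intro i h
    rw [hxx, Int.emod_eq_emod_iff_emod_sub_eq_zero, ← Int.dvd_iff_emod_eq_zero,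
      ← dvd_neg, show -(i - 1 - (i + 1)) = 2 by ring] at h
    have := Int.le_of_dvd (by norm_num) h
    omega
  have hsucc : ∀ i, H.Adj (x i) (x (i + 1)) := by
    intro i
    have h1 := hmod i
    have hadj := p.adj_getVert_succ (i := (i % (p.length : ℤ)).toNat) (by omega)
    suffices h : x (i + 1) = p.getVert ((i % (p.length : ℤ)).toNat + 1) by rw [h]; exact hadj
    simp only [hx]
    rw [Int.add_emod, Int.emod_eq_of_lt (a := 1) (by omega) (by omega)]
    by_cases h : i % (p.length : ℤ) + 1 = p.length
    · rw [h, Int.emod_self, show (i % (p.length : ℤ)).toNat + 1 = p.length by omega]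
      simp
    · rw [Int.emod_eq_of_lt (by omega) (by omega)]
      congr 1
      omega
  refine ⟨p.length, x, by exact_mod_cast hlen, ?_, hxx, hne, ?_⟩
  · intro v
    have hv : v ∈ p.toSubgraph.verts := by
      rw [hverts]
      exact SimpleGraph.ConnectedComponent.sound (hc.preconnected v v₀)
    rw [SimpleGraph.Walk.mem_verts_toSubgraph,
      SimpleGraph.Walk.mem_support_iff_exists_getVert] at hv
    obtain ⟨n, rfl, hn⟩ := hv
    refine ⟨n, ?_⟩
    rcases hn.eq_or_lt with rfl | hn
    · simp [hx]
    · simp only [hx]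
      rw [Int.emod_eq_of_lt (by omega) (by omega), Int.toNat_natCast]
  · intro i v
    have hpred : H.Adj (x i) (x (i - 1)) := by simpa using (hsucc (i - 1)).symm
    have hN : ({x (i - 1), x (i + 1)} : Set V) = H.neighborSet (x i) := by
      refine Set.eq_of_subset_of_ncard_le ?_ ?_ (Set.toFinite _)
      · rintro _ (rfl | rfl)
        exacts [hpred, hsucc i]
      · rw [hdeg, Set.ncard_pair (hne i)]
    rw [← SimpleGraph.mem_neighborSet, ← hN]
    simp

/-- If `s` meets every window of four consecutive integers and every `i ∈ s` has `i` or `i + 1` in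
`rem`, then every gap of `rem` has length at most four. -/
lemma exists_between_of_gaps (s rem : ℤ → Prop)
    (hs : ∀ i, s i ∨ s (i + 1) ∨ s (i + 2) ∨ s (i + 3))
    (hrem : ∀ i, s i → rem i ∨ rem (i + 1)) (i : ℤ) (hi : ¬ rem i) :
    ∃ a b, a < i ∧ i < b ∧ b ≤ a + 5 ∧ rem a ∧ rem b := by
  have hi0 : ∀ j, rem j → j ≠ i := by rintro _ h rfl; exact hi h
  obtain ⟨c, hc, hci, hmax⟩ : ∃ c, s c ∧ c ≤ i ∧ ∀ j, c < j → s j → i < j := by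
    by_contra! hcon
    have h0 : ¬ s i := fun h => by
      obtain ⟨j, h1, -, h2⟩ := hcon i h le_rfl
      omega
    have h1 : ¬ s (i - 1) := fun h => by
      obtain ⟨j, h1, h2, h3⟩ := hcon _ h (by omega)
      obtain rfl : j = i := by omega
      exact h0 h2
    have h2 : ¬ s (i - 2) := fun h => by
      obtain ⟨j, h3, h4, h5⟩ := hcon _ h (by omega)
      obtain rfl | rfl : j = i ∨ j = i - 1 := by omega
      exacts [h0 h4, h1 h4]
    have h3 : ¬ s (i - 3) := fun h => by
      obtain ⟨j, h4, h5, h6⟩ := hcon _ h (by omega)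
      obtain rfl | rfl | rfl : j = i ∨ j = i - 1 ∨ j = i - 2 := by omega
      exacts [h0 h5, h1 h5, h2 h5]
    have := hs (i - 3)
    rw [show i - 3 + 1 = i - 2 by ring, show i - 3 + 2 = i - 1 by ring,
      show i - 3 + 3 = i by ring] at this
    tauto
  have hwindow : ∀ k, ∃ r, rem r ∧ ∃ d, s d ∧ k ≤ d ∧ d ≤ k + 3 ∧ d ≤ r ∧ r ≤ d + 1 := by
    intro k
    obtain ⟨d, hd, hkd, hdk⟩ : ∃ d, s d ∧ k ≤ d ∧ d ≤ k + 3 := by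
      rcases hs k with h | h | h | h
      all_goals exact ⟨_, h, by omega, by omega⟩
    rcases hrem d hd with h | h
    all_goals exact ⟨_, h, d, hd, hkd, hdk, by omega, by omega⟩
  rcases hci.eq_or_lt with rfl | hci
  · obtain ⟨r, hr, d, -, h1, h2, h3, h4⟩ := hwindow (c - 4)
    have := hi0 r hr
    exact ⟨r, c + 1, by omega, by omega, by omega, hr, (hrem c hc).resolve_left hi⟩
  · obtain ⟨r, hr, d, hd, h1, h2, h3, h4⟩ := hwindow (c + 1)
    have := hmax d (by omega) hd
    rcases hrem c hc with h | h
    all_goals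
      have := hi0 _ h
      exact ⟨_, r, by omega, by omega, by omega, h, hr⟩

/-- Every cycle of length at least `3` other than `5` can be cut into blocks of length `3` and `4`;
`S` is the set of positions at which a block starts. -/
lemma exists_block_pattern (N : ℤ) (hN : 3 ≤ N) (hN5 : N ≠ 5) :
    ∃ S : ℤ → Prop, (∀ i, S (i % N) → ¬ S ((i + 1) % N) ∧ ¬ S ((i + 2) % N)) ∧
      ∀ i, S (i % N) ∨ S ((i + 1) % N) ∨ S ((i + 2) % N) ∨ S ((i + 3) % N) := by
  have hmod : ∀ i, 0 ≤ i % N ∧ i % N < N := fun i =>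
    ⟨Int.emod_nonneg _ (by omega), Int.emod_lt_of_pos _ (by omega)⟩
  have hsucc : ∀ i, ((i + 1) % N = i % N + 1 ∧ i % N + 1 < N) ∨
      ((i + 1) % N = 0 ∧ i % N + 1 = N) := by
    intro i
    have h1 := hmod i
    rw [Int.add_emod, Int.emod_eq_of_lt (a := 1) (by omega) (by omega)]
    by_cases h : i % N + 1 = N
    · right; rw [h, Int.emod_self]; simp
    · left; rw [Int.emod_eq_of_lt (by omega) (by omega)]; omega
  refine ⟨fun t => (t < 4 * (N % 3) ∧ t % 4 = 0) ∨
    (4 * (N % 3) ≤ t ∧ (t - 4 * (N % 3)) % 3 = 0), fun i => ?_, fun i => ?_⟩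
  all_goals
    have h0 := hmod i
    have h1 := hsucc i
    have h2 := hsucc (i + 1)
    have h3 := hsucc (i + 2)
    rw [show i + 1 + 1 = i + 2 by ring] at h2
    rw [show i + 2 + 1 = i + 3 by ring] at h3
    have hr : N % 3 = 0 ∨ N % 3 = 1 ∨ N % 3 = 2 := by omega
    generalize i % N = t0 at *
    generalize (i + 1) % N = t1 at *
    generalize (i + 2) % N = t2 at *
    generalize (i + 3) % N = t3 at *
    rcases hr with hr | hr | hr <;> rw [hr] <;> omega

theorem stmt_15 {V : Type*} [Fintype V] (H : SimpleGraph V)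
    -- `H` is a cycle of length `n ≥ 3`, `n ≠ 4` (a connected 2-regular graph), or
    -- a path with `m ≥ 4` edges
    (hH : (H.Connected ∧ (∀ v : V, (H.neighborSet v).ncard = 2) ∧
            3 ≤ Fintype.card V ∧ Fintype.card V ≠ 4) ∨
          (∃ m : ℕ, 4 ≤ m ∧ ∃ w : Fin (m + 1) → V, Function.Bijective w ∧
            ∀ u v : V, H.Adj u v ↔ ∃ i : Fin m,
              (u = w i.castSucc ∧ v = w i.succ) ∨ (v = w i.castSucc ∧ u = w i.succ))) :
    ∃ A B : Set V, A ∪ B = Set.univ ∧ Disjoint A B ∧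
      -- (1) every vertex of `B` has degree 2 in `H` and exactly one neighbour in `B`
      (∀ v ∈ B, (H.neighborSet v).ncard = 2 ∧ (H.neighborSet v ∩ B).ncard = 1) ∧
      -- (2) for every maximal independent subset `W'` of `B`, every connected component of
      -- the induced subgraph `H[A ∪ W']` has at most 4 vertices
      (∀ W' : Set V, W' ⊆ B → W'.Pairwise (fun u v => ¬ H.Adj u v) →
        (∀ W'' : Set V, W' ⊆ W'' → W'' ⊆ B → W''.Pairwise (fun u v => ¬ H.Adj u v) →
          W'' = W') →
        ∀ v : ↑(A ∪ W'),
          {u : ↑(A ∪ W') | (H.induce (A ∪ W')).Reachable u v}.ncard ≤ 4) := by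
  rcases hH with ⟨hc, hdeg, -, -⟩ | ⟨m, hm, w, hw, hadj⟩
  · obtain ⟨N, x, hN, hsurj, hxx, hne, hadj⟩ := exists_periodic_labelling H hc hdeg
    have hsurj' : ∀ v, ∃ i, True ∧ x i = v := fun v => by simpa using hsurj v
    have hadj' : ∀ i, True → ∀ v,
        H.Adj (x i) v ↔ ∃ j, True ∧ (j = i - 1 ∨ j = i + 1) ∧ v = x j := fun i _ v => by
      simpa using hadj i v
    have hper : ∀ i j k : ℤ, i % N = j % N → (i + k) % N = (j + k) % N := fun i j k h => by
      rw [Int.add_emod, h, ← Int.add_emod]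
    by_cases hN5 : N = 5
    · subst hN5
      refine exists_partition_of_labelling H x (fun _ => True) (fun i => i % 5 = 0)
        hsurj' hadj' (fun i _ _ => hne i) ?_ (by simp) (fun i hi => by omega) ?_
      · intro i j _ _ h
        rw [hxx] at h
        omega
      · intro rem _ hrem hpair i hi
        have hshift : ∀ j k, j % 5 = k % 5 → rem j → rem k := fun j k h =>
          hrem j k trivial trivial ((hxx j k).2 h)
        have hi0 : ∀ j, rem j → j ≠ i := by rintro _ h rfl; exact hi h
        rcases hpair (i - i % 5) (by omega) with h | h
        · have := hi0 _ h
          exact ⟨_, i - i % 5 + 5, by omega, by omega, by omega, h, hshift _ _ (by omega) h⟩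
        · have := hi0 _ h
          by_cases hi5 : i % 5 = 0
          · exact ⟨i - i % 5 - 4, _, by omega, by omega, by omega,
              hshift _ _ (by omega) h, h⟩
          · exact ⟨_, i - i % 5 + 6, by omega, by omega, by omega, h, hshift _ _ (by omega) h⟩
    · obtain ⟨S, hS1, hS2⟩ := exists_block_pattern N hN hN5
      refine exists_partition_of_labelling H x (fun _ => True) (fun i => S (i % N))
        hsurj' hadj' (fun i _ _ => hne i) ?_ (by simp) hS1 ?_
      · intro i j _ _ h
        rw [hxx] at h
        have h' := hper i j (-1) h
        simp only [← sub_eq_add_neg] at h'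
        simp [h, h']
      · intro rem _ _ hpair i hi
        exact exists_between_of_gaps (fun j => S (j % N)) rem hS2 hpair i hi
  · set x : ℤ → V := fun i => w ⟨min i.toNat m, by omega⟩ with hx
    have hxw : ∀ (k : ℕ) (hk : k < m + 1), x k = w ⟨k, hk⟩ := by
      intro k hk
      simp only [hx, Int.toNat_natCast]
      congr
      omega
    have hxx : ∀ i j : ℤ, (0 ≤ i ∧ i ≤ m) → (0 ≤ j ∧ j ≤ m) → x i = x j → i = j := by
      intro i j hi hj h
      have := congrArg Fin.val (hw.1 h)
      simp only at this
      omega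
    refine exists_partition_of_labelling H x (fun i => 0 ≤ i ∧ i ≤ m)
      (fun i => 1 ≤ i ∧ i + 2 ≤ m ∧ i % 3 = 1) ?_ ?_ ?_ ?_ ?_ ?_ ?_
    · intro v
      obtain ⟨k, rfl⟩ := hw.2 v
      exact ⟨(k : ℕ), by omega, hxw _ k.2⟩
    · intro i hi v
      rw [hadj]
      constructor
      · rintro ⟨k, ⟨h1, rfl⟩ | ⟨rfl, h1⟩⟩
        · have h2 := hxx i (k : ℕ) hi (by omega) (by rw [h1, hxw _ (by omega)]; rfl)
          refine ⟨(k + 1 : ℕ), by omega, by omega, ?_⟩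
          rw [hxw _ (by omega)]
          rfl
        · have h2 := hxx i (k + 1 : ℕ) hi (by omega) (by rw [h1, hxw _ (by omega)]; rfl)
          refine ⟨(k : ℕ), by omega, by omega, ?_⟩
          rw [hxw _ (by omega)]
          rfl
      · rintro ⟨j, hj, hji, rfl⟩
        lift i to ℕ using hi.1
        lift j to ℕ using hj.1
        rw [hxw i (by omega), hxw j (by omega)]
        rcases hji with h | h
        · obtain rfl : i = j + 1 := by omega
          exact ⟨⟨j, by omega⟩, .inr ⟨rfl, rfl⟩⟩
        · obtain rfl : j = i + 1 := by omega
          exact ⟨⟨i, by omega⟩, .inl ⟨rfl, rfl⟩⟩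
    · intro i h1 h2 h
      have := hxx _ _ h1 h2 h
      omega
    · intro i j hi hj h
      rw [hxx i j hi hj h]
      simp
    · intro i hi
      omega
    · intro i hi
      omega
    · intro rem hout _ hpair i hi
      have hi0 : ∀ j, rem j → j ≠ i := by rintro _ h rfl; exact hi h
      have hid : 0 ≤ i ∧ i ≤ m := by
        by_contra h
        exact hi (hout i h)
      have hbefore : ∃ a, rem a ∧ a < i - i % 3 ∧ i - i % 3 ≤ a + 2 := by
        by_cases h0 : i - i % 3 = 0
        · exact ⟨-1, hout _ (by omega), by omega, by omega⟩
        · rcases hpair (i - i % 3 - 2) (by omega) with h | h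
          · exact ⟨_, h, by omega, by omega⟩
          · exact ⟨_, h, by omega, by omega⟩
      have hafter : ∀ j : ℤ, 0 ≤ j → j ≤ m → j % 3 = 0 →
          ∃ b, rem b ∧ j < b ∧ (j + 3 ≤ m ∧ b ≤ j + 2 ∨ b = m + 1 ∧ b ≤ j + 3) := by
        intro j hj hjm hj3
        by_cases h0 : j + 3 ≤ m
        · rcases hpair (j + 1) (by omega) with h | h
          · exact ⟨_, h, by omega, by omega⟩
          · exact ⟨_, h, by omega, by omega⟩
        · exact ⟨m + 1, hout _ (by omega), by omega, by omega⟩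
      obtain ⟨a, ha, hai, hai'⟩ := hbefore
      obtain ⟨b, hb, hib, hib'⟩ := hafter (i - i % 3) (by omega) (by omega) (by omega)
      have hbi := hi0 b hb
      by_cases hlt : i < b
      · exact ⟨a, b, by omega, hlt, by omega, ha, hb⟩
      · obtain ⟨c, hc, hic, hic'⟩ := hafter (i - i % 3 + 3) (by omega) (by omega) (by omega)
        exact ⟨b, c, by omega, by omega, by omega, hb, hc⟩
end
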